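/- Let a, b : [0,∞) × ℝ → ℝ be bounded continuous functions that are 2π-periodic in their second argument, and let v : [0,∞) × ℝ → ℝ be a classical solution of v_t = v_xx + a(t,x)·v_x + b(t,x)·v on the circle (continuous on [0,∞) × ℝ, 2π-periodic in x, with v_t, v_x, v_xx continuous on (0,∞) × ℝ and satisfying the equation there), such that v(t,·) is not identically zero for every t ≥ 0. Then there exists T₀ > 0 such that for every t ≥ T₀ all zeros of v(t,·) are simple, i.e., v(t,x) = 0 implies v_x(t,x) ≠ 0; consequently the zero number t ↦ z(v(t,·)) is constant on [T₀, ∞). -/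

import Mathlib

open Real Set

namespace ZN
open MeasureTheory

noncomputable def rho (y : ℝ) : ℝ := Real.exp (-(y ^ 2 / 4))

lemma rho_pos (y : ℝ) : 0 < rho y := Real.exp_pos _
lemma rho_nonneg (y : ℝ) : 0 ≤ rho y := (rho_pos y).le
lemma rho_cont : Continuous rho := by unfold rho; fun_prop
lemma rho_le_one (y : ℝ) : rho y ≤ 1 := by
  unfold rho; apply Real.exp_le_one_iff.mpr; nlinarith [sq_nonneg y]
lemma rho_hasDeriv (y : ℝ) : HasDerivAt rho (-(y / 2) * rho y) y := by
  unfold rho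
  have h : HasDerivAt (fun y : ℝ => -(y ^ 2 / 4)) (-(y / 2)) y := by
    have := ((hasDerivAt_pow 2 y).div_const 4).neg
    exact this.congr_deriv (by norm_num; ring)
  exact h.exp.congr_deriv (by ring)

/-- continuous functions of polynomial growth -/
def PG (f : ℝ → ℝ) : Prop := Continuous f ∧ ∃ C : ℝ, ∃ k : ℕ, ∀ y, |f y| ≤ C * (1 + y ^ 2) ^ k

lemma one_le_pw (y : ℝ) (k : ℕ) : 1 ≤ (1 + y ^ 2) ^ k :=
  one_le_pow₀ (by nlinarith [sq_nonneg y])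

lemma PG.cont {f} (h : PG f) : Continuous f := h.1

lemma PG.bd {f} (h : PG f) : ∃ C : ℝ, 0 ≤ C ∧ ∃ k : ℕ, ∀ y, |f y| ≤ C * (1 + y ^ 2) ^ k := by
  obtain ⟨_, C, k, h⟩ := h
  refine ⟨|C|, abs_nonneg _, k, fun y => (h y).trans ?_⟩
  exact mul_le_mul_of_nonneg_right (le_abs_self _) (zero_le_one.trans (one_le_pw y k))

lemma PG.const (c : ℝ) : PG (fun _ => c) := ⟨continuous_const, |c|, 0, by simp⟩

lemma PG.id : PG (fun y => y) :=
  ⟨continuous_id, 1, 1, fun y => by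
    rw [pow_one, one_mul, abs_le]; constructor <;> nlinarith [sq_nonneg (y + 1), sq_nonneg (y - 1)]⟩

lemma PG.add {f g} (hf : PG f) (hg : PG g) : PG (fun y => f y + g y) := by
  obtain ⟨C, hC, k, hk⟩ := hf.bd
  obtain ⟨D, hD, l, hl⟩ := hg.bd
  refine ⟨hf.1.add hg.1, C + D, k + l, fun y => ?_⟩
  have h1 := one_le_pw y k
  have h2 := one_le_pw y l
  calc |f y + g y| ≤ |f y| + |g y| := abs_add_le _ _
    _ ≤ C * (1 + y ^ 2) ^ k + D * (1 + y ^ 2) ^ l := add_le_add (hk y) (hl y)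
    _ ≤ C * ((1 + y ^ 2) ^ k * (1 + y ^ 2) ^ l) + D * ((1 + y ^ 2) ^ k * (1 + y ^ 2) ^ l) := by
        gcongr <;> nlinarith
    _ = _ := by rw [pow_add]; ring

lemma PG.mul {f g} (hf : PG f) (hg : PG g) : PG (fun y => f y * g y) := by
  obtain ⟨C, hC, k, hk⟩ := hf.bd
  obtain ⟨D, hD, l, hl⟩ := hg.bd
  refine ⟨hf.1.mul hg.1, C * D, k + l, fun y => ?_⟩
  rw [abs_mul, pow_add]
  calc |f y| * |g y| ≤ (C * (1 + y ^ 2) ^ k) * (D * (1 + y ^ 2) ^ l) :=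
        mul_le_mul (hk y) (hl y) (abs_nonneg _) (by positivity)
    _ = _ := by ring

lemma PG.neg {f} (hf : PG f) : PG (fun y => - f y) := by
  obtain ⟨C, k, hk⟩ := hf.2
  exact ⟨hf.1.neg, C, k, fun y => by rw [abs_neg]; exact hk y⟩

lemma PG.sub {f g} (hf : PG f) (hg : PG g) : PG (fun y => f y - g y) := by
  simpa [sub_eq_add_neg] using hf.add hg.neg

lemma PG.abs {f} (hf : PG f) : PG (fun y => |f y|) := by
  obtain ⟨C, k, hk⟩ := hf.2
  exact ⟨hf.1.abs, C, k, fun y => by rw [abs_abs]; exact hk y⟩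

lemma PG.cmul {f} (c : ℝ) (hf : PG f) : PG (fun y => c * f y) := (PG.const c).mul hf

lemma PG.pow {f} (hf : PG f) (n : ℕ) : PG (fun y => f y ^ n) := by
  induction n with
  | zero => simpa using PG.const 1
  | succ n ih => simpa [pow_succ] using ih.mul hf

lemma pw_integrable (k : ℕ) : Integrable (fun y : ℝ => (1 + y ^ 2) ^ k * rho y) := by
  have h := (integrable_exp_neg_mul_sq (b := 1 / 8) (by norm_num)).const_mul
    (8 ^ k * (k.factorial : ℝ) * Real.exp (1 / 8))
  refine h.mono' ?_ ?_
  · exact (Continuous.mul (by fun_prop) rho_cont).aestronglyMeasurable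
  · refine Filter.Eventually.of_forall fun y => ?_
    have h0 : 0 ≤ (1 + y ^ 2) ^ k * rho y := mul_nonneg (by positivity) (rho_nonneg y)
    rw [Real.norm_eq_abs, abs_of_nonneg h0]
    have h1 := Real.pow_div_factorial_le_exp ((1 + y ^ 2) / 8) (by positivity) k
    rw [div_pow, div_div, div_le_iff₀ (by positivity)] at h1
    calc (1 + y ^ 2) ^ k * rho y ≤ (Real.exp ((1 + y ^ 2) / 8) * (8 ^ k * (k.factorial : ℝ))) * rho y :=
          mul_le_mul_of_nonneg_right h1 (rho_nonneg y)
      _ = (8 ^ k * (k.factorial : ℝ)) * (Real.exp ((1 + y ^ 2) / 8) * Real.exp (-(y ^ 2 / 4))) := by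
          unfold rho; ring
      _ = _ := by
          rw [← Real.exp_add, mul_assoc (8 ^ k * (k.factorial : ℝ)), ← Real.exp_add]
          congr 2; ring

lemma PG.integrable {f} (hf : PG f) : Integrable (fun y => f y * rho y) := by
  obtain ⟨C, hC, k, hk⟩ := hf.bd
  refine ((pw_integrable k).const_mul C).mono' (hf.1.mul rho_cont).aestronglyMeasurable ?_
  refine Filter.Eventually.of_forall fun y => ?_
  rw [Real.norm_eq_abs, abs_mul, abs_of_pos (rho_pos y), ← mul_assoc]
  exact mul_le_mul_of_nonneg_right (hk y) (rho_nonneg y)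

/-- weighted integral -/
noncomputable def wi (f : ℝ → ℝ) : ℝ := ∫ y, f y * rho y

lemma wi_add {f g} (hf : PG f) (hg : PG g) : wi (fun y => f y + g y) = wi f + wi g := by
  unfold wi; rw [← integral_add hf.integrable hg.integrable]; congr 1; ext y; ring
lemma wi_sub {f g} (hf : PG f) (hg : PG g) : wi (fun y => f y - g y) = wi f - wi g := by
  unfold wi; rw [← integral_sub hf.integrable hg.integrable]; congr 1; ext y; ring
lemma wi_cmul (c : ℝ) (f) : wi (fun y => c * f y) = c * wi f := by
  unfold wi; rw [← integral_const_mul]; congr 1; ext y; ring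
lemma wi_mono {f g} (hf : PG f) (hg : PG g) (h : ∀ y, f y ≤ g y) : wi f ≤ wi g := by
  unfold wi
  exact integral_mono hf.integrable hg.integrable fun y =>
    mul_le_mul_of_nonneg_right (h y) (rho_nonneg y)
lemma wi_nonneg {f} (h : ∀ y, 0 ≤ f y) : 0 ≤ wi f :=
  integral_nonneg fun y => mul_nonneg (h y) (rho_nonneg y)
lemma wi_neg (f) : wi (fun y => - f y) = - wi f := by
  simpa using wi_cmul (-1) f
lemma wi_abs {f} (hf : PG f) : |wi f| ≤ wi (fun y => |f y|) := by
  rw [abs_le]; constructor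
  · rw [← wi_neg]; exact wi_mono hf.abs.neg hf fun y => neg_abs_le _
  · exact wi_mono hf hf.abs fun y => le_abs_self _
lemma wi_one : wi (fun _ => 1) ≤ 4 := by
  have h := integral_gaussian (1 / 4)
  have : wi (fun _ => 1) = √(π / (1 / 4)) := by
    rw [← h]; unfold wi rho; congr 1; ext y; rw [one_mul]; congr 1; ring
  rw [this]
  apply Real.sqrt_le_iff.mpr; constructor
  · norm_num
  · have := Real.pi_lt_four; linarith

lemma wi_pos {f} (hf : PG f) (h : ∀ y, 0 ≤ f y) {y₀ : ℝ} (h0 : f y₀ ≠ 0) : 0 < wi f := by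
  unfold wi
  have hc : Continuous (fun y => f y * rho y) := hf.1.mul rho_cont
  refine (integral_pos_iff_support_of_nonneg (fun y => mul_nonneg (h y) (rho_nonneg y)) hf.integrable).mpr ?_
  refine (hc.isOpen_support).measure_pos _ ⟨y₀, ?_⟩
  simp [h0, (rho_pos y₀).ne']

lemma wi_CS {f g} (hf : PG f) (hg : PG g) :
    (wi (fun y => f y * g y)) ^ 2 ≤ wi (fun y => f y ^ 2) * wi (fun y => g y ^ 2) := by
  have key : ∀ x : ℝ, 0 ≤ wi (fun y => g y ^ 2) * (x * x) + (2 * wi (fun y => f y * g y)) * x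
      + wi (fun y => f y ^ 2) := by
    intro x
    have h : wi (fun y => (f y + x * g y) ^ 2) =
        wi (fun y => g y ^ 2) * (x * x) + (2 * wi (fun y => f y * g y)) * x
      + wi (fun y => f y ^ 2) := by
      have e : (fun y => (f y + x * g y) ^ 2) = fun y => ((x * x) * g y ^ 2 + (2 * x) * (f y * g y)) + f y ^ 2 := by
        ext y; ring
      rw [e, wi_add (((hg.pow 2).cmul _).add ((hf.mul hg).cmul _)) (hf.pow 2),
        wi_add ((hg.pow 2).cmul _) ((hf.mul hg).cmul _), wi_cmul, wi_cmul]
      ring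
    rw [← h]; exact wi_nonneg fun y => sq_nonneg _
  have := discrim_le_zero key
  unfold discrim at this
  nlinarith

/-- integration by parts against the Gaussian weight -/
lemma wi_ibp {u u' g g' : ℝ → ℝ} (hu : ∀ y, HasDerivAt u (u' y) y) (hg : ∀ y, HasDerivAt g (g' y) y)
    (pu : PG u) (pu' : PG u') (pg : PG g) (pg' : PG g') :
    wi (fun y => u' y * g y) = wi (fun y => u y * (y / 2 * g y - g' y)) := by
  have hv : ∀ y, HasDerivAt (fun y => g y * rho y) (g' y * rho y + g y * (-(y / 2) * rho y)) y :=
    fun y => (hg y).mul (rho_hasDeriv y)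
  have h := integral_mul_deriv_eq_deriv_mul_of_integrable (u := u) (u' := u')
    (v := fun y => g y * rho y) (v' := fun y => g' y * rho y + g y * (-(y / 2) * rho y))
    (fun x _ => hu x) (fun x _ => hv x) ?_ ?_ ?_
  · unfold wi
    have e1 : (fun y => u' y * g y * rho y) = fun y => u' y * (g y * rho y) := by ext y; ring
    rw [e1, ← neg_eq_iff_eq_neg.mpr h, ← integral_neg]
    congr 1; ext y; ring
  · have : PG (fun y => u y * (g' y - y * g y / 2)) := pu.mul (pg'.sub (by
      simpa [mul_div_assoc, mul_comm, mul_left_comm, div_eq_mul_inv] using (PG.id.mul pg).cmul (1/2)))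
    convert this.integrable using 2 with y
    simp only [Pi.mul_apply]; ring
  · convert (pu'.mul pg).integrable using 2 with y
    simp only [Pi.mul_apply]; ring
  · convert (pu.mul pg).integrable using 2 with y
    simp only [Pi.mul_apply]; ring

end ZN

namespace ZN
open MeasureTheory

structure Fn (w w1 w2 : ℝ → ℝ) : Prop where
  d1 : ∀ y, HasDerivAt w (w1 y) y
  d2 : ∀ y, HasDerivAt w1 (w2 y) y
  p0 : PG w
  p1 : PG w1
  p2 : PG w2

/-- residual `A w - L w` -/
noncomputable def res (w w1 w2 : ℝ → ℝ) (L : ℝ) : ℝ → ℝ := fun y => (y / 2 * w1 y - w2 y) - L * w y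

lemma PG.half {f} (hf : PG f) : PG (fun y => y / 2 * f y) := by
  have e : (fun y => y / 2 * f y) = fun y => (1 / 2 * y) * f y := by ext y; ring
  rw [e]; exact (PG.id.cmul (1/2)).mul hf

lemma Fn.pA {w w1 w2} (F : Fn w w1 w2) : PG (fun y => y / 2 * w1 y - w2 y) := F.p1.half.sub F.p2
lemma Fn.pres {w w1 w2} (F : Fn w w1 w2) (L : ℝ) : PG (res w w1 w2 L) := F.pA.sub (F.p0.cmul L)

lemma Fn.DA {w w1 w2} (F : Fn w w1 w2) :
    wi (fun y => w1 y ^ 2) = wi (fun y => w y * (y / 2 * w1 y - w2 y)) := by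
  rw [← wi_ibp F.d1 F.d2 F.p0 F.p1 F.p1 F.p2]; congr 1; ext y; ring

lemma wi_zero : wi (fun _ => 0) = 0 := by simp [wi]

lemma Fn.A1 {w w1 w2} (F : Fn w w1 w2) : wi (fun y => y / 2 * w1 y - w2 y) = 0 := by
  have := wi_ibp (u := fun _ => 1) (u' := fun _ => 0) (fun y => hasDerivAt_const y 1) F.d2
    (PG.const 1) (PG.const 0) F.p1 F.p2
  simp only [zero_mul, one_mul, wi_zero] at this
  exact this.symm

lemma Fn.Ay {w w1 w2} (F : Fn w w1 w2) :
    wi (fun y => y * (y / 2 * w1 y - w2 y)) = 1 / 2 * wi (fun y => y * w y) := by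
  have h1 := wi_ibp (u := fun y => y) (u' := fun _ => 1) (fun y => hasDerivAt_id y) F.d2
    PG.id (PG.const 1) F.p1 F.p2
  have h2 := wi_ibp (g := fun _ => 1) (g' := fun _ => 0) F.d1 (fun y => hasDerivAt_const y 1)
    F.p0 F.p1 (PG.const 1) (PG.const 0)
  rw [← h1, ← wi_cmul]
  simp only [one_mul, mul_one, sub_zero] at h2 ⊢
  rw [h2]; congr 1; ext y; ring

lemma Fn.res1 {w w1 w2} (F : Fn w w1 w2) (L : ℝ) : wi (res w w1 w2 L) = - L * wi w := by
  unfold res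
  rw [wi_sub F.pA (F.p0.cmul L), F.A1, wi_cmul]; ring

lemma Fn.resy {w w1 w2} (F : Fn w w1 w2) (L : ℝ) :
    wi (fun y => y * res w w1 w2 L y) = (1 / 2 - L) * wi (fun y => y * w y) := by
  unfold res
  have : (fun y => y * ((y / 2 * w1 y - w2 y) - L * w y)) =
      fun y => y * (y / 2 * w1 y - w2 y) - L * (y * w y) := by ext y; ring
  rw [this, wi_sub (PG.id.mul F.pA) ((PG.id.mul F.p0).cmul L), F.Ay, wi_cmul]; ring

lemma Fn.y2 {w w1 w2} (F : Fn w w1 w2) :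
    wi (fun y => y ^ 2 * w y ^ 2) ≤ 4 * wi (fun y => w y ^ 2) + 16 * wi (fun y => w1 y ^ 2) := by
  have h := wi_ibp (u := fun y => w y ^ 2) (u' := fun y => 2 * w y * w1 y) (g := fun y => y)
    (g' := fun _ => 1) (fun y => by have := (F.d1 y).pow 2; exact this.congr_deriv (by norm_num))
    (fun y => hasDerivAt_id y)
    (F.p0.pow 2) ((F.p0.cmul 2).mul F.p1) PG.id (PG.const 1)
  have e : (fun y => w y ^ 2 * (y / 2 * y - 1)) = fun y => 1 / 2 * (y ^ 2 * w y ^ 2) - w y ^ 2 := by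
    ext y; ring
  rw [e, wi_sub (((PG.id.pow 2).mul (F.p0.pow 2)).cmul _) (F.p0.pow 2), wi_cmul] at h
  have h2 : wi (fun y => 2 * w y * w1 y * y) ≤ wi (fun y => 1 / 4 * (y ^ 2 * w y ^ 2) + 4 * w1 y ^ 2) := by
    apply wi_mono (((F.p0.cmul 2).mul F.p1).mul PG.id)
      ((((PG.id.pow 2).mul (F.p0.pow 2)).cmul _).add ((F.p1.pow 2).cmul _))
    intro y; nlinarith [sq_nonneg (y * w y / 2 - 2 * w1 y)]
  rw [wi_add (((PG.id.pow 2).mul (F.p0.pow 2)).cmul _) ((F.p1.pow 2).cmul _), wi_cmul, wi_cmul] at h2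
  linarith

lemma peak {w w1 w2} (F : Fn w w1 w2) {K : ℝ} (hK : 0 ≤ K) (h1 : wi (fun y => w y ^ 2) = 1)
    (hD : wi (fun y => w1 y ^ 2) ≤ K) : ∃ y, |y| ≤ 9 + 32 * K ∧ 1 / 8 ≤ w y ^ 2 := by
  by_contra! hcon
  set R := 9 + 32 * K with hR
  have hRp : 0 < R := by positivity
  have hpt : ∀ y, w y ^ 2 ≤ 1 / 8 * 1 + 1 / R ^ 2 * (y ^ 2 * w y ^ 2) := by
    intro y
    by_cases hy : |y| ≤ R
    · have := (hcon y hy).le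
      have h3 : 0 ≤ 1 / R ^ 2 * (y ^ 2 * w y ^ 2) := by positivity
      linarith
    · push Not at hy
      have h3 : 1 ≤ 1 / R ^ 2 * y ^ 2 := by
        rw [one_div, inv_mul_eq_div, le_div_iff₀ (by positivity), one_mul, ← sq_abs y]
        exact pow_le_pow_left₀ hRp.le hy.le 2
      nlinarith [sq_nonneg (w y)]
  have h := wi_mono (F.p0.pow 2) (((PG.const 1).cmul (1/8)).add (((PG.id.pow 2).mul (F.p0.pow 2)).cmul (1 / R ^ 2))) hpt
  rw [wi_add ((PG.const 1).cmul (1/8)) (((PG.id.pow 2).mul (F.p0.pow 2)).cmul (1 / R ^ 2)), wi_cmul, wi_cmul, h1] at h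
  have h4 := wi_one
  have h5 := F.y2
  rw [h1] at h5
  have h6 : wi (fun y => y ^ 2 * w y ^ 2) ≤ R := by linarith
  have h7 : 1 / R ^ 2 * wi (fun y => y ^ 2 * w y ^ 2) ≤ 1 / R := by
    rw [one_div, inv_mul_le_iff₀ (by positivity)]
    calc _ ≤ R := h6
      _ = R ^ 2 * (1 / R) := by field_simp
  have h8 : 1 / R ≤ 1 / 9 := by apply one_div_le_one_div_of_le <;> linarith
  linarith

lemma rho_ge {R y : ℝ} (h : |y| ≤ R) : Real.exp (-(R ^ 2 / 4)) ≤ rho y := by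
  unfold rho
  apply Real.exp_le_exp.mpr
  have : y ^ 2 ≤ R ^ 2 := by rw [← sq_abs y]; exact pow_le_pow_left₀ (abs_nonneg y) h 2
  linarith

/-- local integral bounded by weighted integral -/
lemma local_le {G : ℝ → ℝ} (hG : PG G) (h0 : ∀ y, 0 ≤ G y) {R p q : ℝ} (hp : -R ≤ p) (hpq : p ≤ q)
    (hq : q ≤ R) : ∫ y in p..q, G y ≤ Real.exp (R ^ 2 / 4) * wi G := by
  have hc : Continuous (fun y => Real.exp (R ^ 2 / 4) * (G y * rho y)) := by
    have := hG.1; have := rho_cont; fun_prop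
  have h1 : ∫ y in p..q, G y ≤ ∫ y in p..q, Real.exp (R ^ 2 / 4) * (G y * rho y) := by
    apply intervalIntegral.integral_mono_on hpq (hG.1.intervalIntegrable _ _)
      (hc.intervalIntegrable _ _)
    intro y hy
    have h2 := rho_ge (R := R) (y := y) (abs_le.mpr ⟨by linarith [hy.1], by linarith [hy.2]⟩)
    have h3 : 1 ≤ Real.exp (R ^ 2 / 4) * rho y := by
      calc 1 = Real.exp (R ^ 2 / 4) * Real.exp (-(R ^ 2 / 4)) := by rw [← Real.exp_add]; simp
        _ ≤ _ := mul_le_mul_of_nonneg_left h2 (Real.exp_pos _).le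
    nlinarith [h0 y]
  refine h1.trans ?_
  rw [intervalIntegral.integral_const_mul]
  apply mul_le_mul_of_nonneg_left _ (Real.exp_pos _).le
  rw [intervalIntegral.integral_of_le hpq]
  exact setIntegral_le_integral hG.integrable
    (Filter.Eventually.of_forall fun y => mul_nonneg (h0 y) (rho_nonneg y))

lemma wi_ge {f : ℝ → ℝ} (hf : PG f) (h0 : ∀ y, 0 ≤ f y) {R p l m : ℝ} (hp : -R ≤ p) (hl : 0 ≤ l)
    (hq : p + l ≤ R) (hm : ∀ y ∈ Icc p (p + l), m ≤ f y) : m * l * Real.exp (-(R ^ 2 / 4)) ≤ wi f := by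
  have h := local_le hf h0 hp (by linarith : p ≤ p + l) hq
  have h2 : ∫ y in p..(p + l), m ≤ ∫ y in p..(p + l), f y :=
    intervalIntegral.integral_mono_on (by linarith) (by simp) (hf.1.intervalIntegrable _ _) hm
  rw [intervalIntegral.integral_const, smul_eq_mul] at h2
  have h3 : m * l ≤ Real.exp (R ^ 2 / 4) * wi f := by linarith [h2.trans h]
  calc m * l * Real.exp (-(R ^ 2 / 4)) ≤ (Real.exp (R ^ 2 / 4) * wi f) * Real.exp (-(R ^ 2 / 4)) :=
        mul_le_mul_of_nonneg_right h3 (Real.exp_pos _).le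
    _ = wi f * (Real.exp (R ^ 2 / 4) * Real.exp (-(R ^ 2 / 4))) := by ring
    _ = wi f := by rw [← Real.exp_add]; simp

/-- modulus of continuity -/
lemma modulus {f f1 G : ℝ → ℝ} (hd : ∀ y, HasDerivAt f (f1 y) y) (hf1 : Continuous f1) (hG : PG G)
    (h0 : ∀ y, 0 ≤ G y) {R p q lam : ℝ} (hp : -R ≤ p) (hpq : p ≤ q) (hq : q ≤ R) (hl : 0 < lam)
    (hle : ∀ y, |y| ≤ R → f1 y ^ 2 ≤ G y) :
    |f q - f p| ≤ (lam * (Real.exp (R ^ 2 / 4) * wi G) + (q - p) / lam) / 2 := by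
  have h1 : ∫ y in p..q, f1 y = f q - f p :=
    intervalIntegral.integral_eq_sub_of_hasDerivAt (fun y _ => hd y) (hf1.intervalIntegrable _ _)
  have h2 : |∫ y in p..q, f1 y| ≤ ∫ y in p..q, |f1 y| :=
    intervalIntegral.abs_integral_le_integral_abs hpq
  have hc0 : Continuous (fun y => lam / 2 * G y) := by
    have := hG.1; fun_prop
  have hc : Continuous (fun y => lam / 2 * G y + 1 / (2 * lam)) := by
    have := hG.1; fun_prop
  have h3 : ∫ y in p..q, |f1 y| ≤ ∫ y in p..q, (lam / 2 * G y + 1 / (2 * lam)) := by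
    apply intervalIntegral.integral_mono_on hpq (hf1.abs.intervalIntegrable _ _)
      (hc.intervalIntegrable _ _)
    intro y hy
    have h4 := hle y (abs_le.mpr ⟨by linarith [hy.1], by linarith [hy.2]⟩)
    have h5 : |f1 y| ≤ lam / 2 * f1 y ^ 2 + 1 / (2 * lam) := by
      rw [← sq_abs (f1 y)]
      have : 0 ≤ (lam * |f1 y| - 1) ^ 2 / (2 * lam) := by positivity
      have e : (lam * |f1 y| - 1) ^ 2 / (2 * lam) = lam / 2 * |f1 y| ^ 2 + 1 / (2 * lam) - |f1 y| := by
        field_simp; ring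
      linarith
    nlinarith
  rw [intervalIntegral.integral_add (hc0.intervalIntegrable _ _) (by simp),
    intervalIntegral.integral_const_mul, intervalIntegral.integral_const, smul_eq_mul] at h3
  have h6 := local_le hG h0 hp hpq hq
  rw [h1] at h2
  have h7 : (q - p) * (1 / (2 * lam)) = (q - p) / lam / 2 := by field_simp
  rw [h7] at h3
  nlinarith [h2.trans h3]

/-- plateau -/
lemma plateau (K : ℝ) (hK : 0 ≤ K) : ∃ R δ : ℝ, 0 < R ∧ 0 < δ ∧ ∀ w w1 w2, Fn w w1 w2 →
    wi (fun y => w y ^ 2) = 1 → wi (fun y => w1 y ^ 2) ≤ K →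
    ∃ p, -R ≤ p ∧ p + δ ≤ R ∧ ∀ y ∈ Icc p (p + δ), 1 / 6 ≤ |w y| := by
  set R := 9 + 32 * K with hR
  have hRp : 9 ≤ R := by linarith
  set B := Real.exp (R ^ 2 / 4) * K with hB
  have hBp : 0 ≤ B := by positivity
  set lam := 1 / (6 * B + 6) with hlam
  have hlp : 0 < lam := by positivity
  have hl1 : lam ≤ 1 := by
    rw [hlam, div_le_one (by positivity)]; linarith
  have hlB : lam * B ≤ 1 / 6 := by
    rw [hlam, one_div, inv_mul_le_iff₀ (by positivity)]; linarith
  refine ⟨R, lam / 6, by linarith, by positivity, ?_⟩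
  intro w w1 w2 F h1 hD
  obtain ⟨z, hz, hwz⟩ := peak F hK h1 hD
  rw [← hR] at hz
  have hz' := abs_le.mp hz
  have hwz' : 1 / 3 ≤ |w z| := by
    by_contra! h
    have : |w z| ^ 2 < (1 / 3) ^ 2 := pow_lt_pow_left₀ h (abs_nonneg _) (by norm_num)
    rw [sq_abs] at this; linarith
  have hmod : ∀ p q, -R ≤ p → p ≤ q → q ≤ R → q - p ≤ lam / 6 → |w q - w p| ≤ 1 / 6 := by
    intro p q hp hpq hq hd
    have := modulus F.d1 F.p1.1 (F.p1.pow 2) (fun y => sq_nonneg _) hp hpq hq hlp (fun y _ => le_rfl)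
    have h2 : (q - p) / lam ≤ 1 / 6 := by
      rw [div_le_iff₀ hlp]; linarith
    have h3 : lam * (Real.exp (R ^ 2 / 4) * wi (fun y => w1 y ^ 2)) ≤ lam * B := by
      rw [hB]; gcongr
    linarith
  rcases le_or_gt z 0 with h | h
  · refine ⟨z, hz'.1, by linarith, fun y hy => ?_⟩
    have := hmod z y hz'.1 hy.1 (by linarith [hy.2]) (by linarith [hy.2])
    have h2 := abs_sub_abs_le_abs_sub (w z) (w y)
    rw [abs_sub_comm] at h2
    linarith
  · refine ⟨z - lam / 6, by linarith, by linarith, fun y hy => ?_⟩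
    have := hmod y z (by linarith [hy.1]) (by linarith [hy.2]) hz'.2 (by linarith [hy.1])
    have h2 := abs_sub_abs_le_abs_sub (w z) (w y)
    linarith

end ZN

namespace ZN
open MeasureTheory

lemma le_of_sq_le_add {x C : ℝ} (h : x ^ 2 ≤ C) : x ≤ C + 1 := by nlinarith [sq_nonneg (x - 1)]

lemma mom {w P : ℝ → ℝ} (hP : PG P) (hw : PG w) (h1 : wi (fun y => w y ^ 2) = 1) :
    wi (fun y => P y * |w y|) ≤ wi (fun y => P y ^ 2) + 1 := by
  apply le_of_sq_le_add
  have h := wi_CS hP hw.abs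
  simp only [sq_abs] at h
  rw [h1, mul_one] at h
  exact h

lemma wi_res_small {w w1 w2} (F : Fn w w1 w2) {L η : ℝ} (hη : 0 ≤ η) {P : ℝ → ℝ} (hP : PG P)
    (hr : wi (fun y => res w w1 w2 L y ^ 2) ≤ η ^ 2) :
    |wi (fun y => P y * res w w1 w2 L y)| ≤ (wi (fun y => P y ^ 2) + 1) * η := by
  have h := wi_CS hP (F.pres L)
  have h0 : 0 ≤ wi (fun y => P y ^ 2) := wi_nonneg fun y => sq_nonneg _
  apply abs_le_of_sq_le_sq _ (by positivity)
  calc _ ≤ _ := h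
    _ ≤ wi (fun y => P y ^ 2) * η ^ 2 := by gcongr
    _ ≤ (wi (fun y => P y ^ 2) + 1) ^ 2 * η ^ 2 := by gcongr; nlinarith
    _ = _ := by ring

lemma no_change {w : ℝ → ℝ} {R : ℝ}
    (h : ∀ y1 y2, -R ≤ y1 → y1 < y2 → y2 ≤ R → 0 ≤ w y1 * w y2) :
    ∃ ε : ℝ, |ε| = 1 ∧ ∀ y, |y| ≤ R → 0 ≤ ε * w y := by
  by_cases hn : ∃ y, |y| ≤ R ∧ w y < 0
  · obtain ⟨y, hy, hw⟩ := hn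
    refine ⟨-1, by simp, fun z hz => ?_⟩
    rw [abs_le] at hy hz
    rcases lt_trichotomy z y with hlt | heq | hlt
    · have := h z y hz.1 hlt hy.2; nlinarith
    · rw [heq]; linarith
    · have := h y z hy.1 hlt hz.2; nlinarith
  · push Not at hn
    exact ⟨1, by simp, fun z hz => by rw [one_mul]; exact hn z hz⟩

lemma SC1 (K : ℝ) (hK : 0 ≤ K) : ∃ R η : ℝ, 0 < R ∧ 0 < η ∧ ∀ w w1 w2, Fn w w1 w2 →
    wi (fun y => w y ^ 2) = 1 → wi (fun y => w1 y ^ 2) ≤ K → 1 / 4 ≤ wi (fun y => w1 y ^ 2) →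
    wi (fun y => res w w1 w2 (wi (fun y => w1 y ^ 2)) y ^ 2) ≤ η ^ 2 →
    ∃ y1 y2, -R ≤ y1 ∧ y1 < y2 ∧ y2 ≤ R ∧ w y1 * w y2 < 0 := by
  obtain ⟨R0, δ, hR0, hδ, hpl⟩ := plateau K hK
  set κ := 1 / 6 * δ * Real.exp (-(R0 ^ 2 / 4)) with hκ
  have hκp : 0 < κ := by positivity
  set C := wi (fun y => (y ^ 2) ^ 2) + 1 with hC
  have hCp : 0 < C := by have : 0 ≤ wi (fun y => (y ^ 2) ^ 2) := wi_nonneg fun y => sq_nonneg _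
                         linarith
  set C1 := wi (fun _ => (1:ℝ) ^ 2) + 1 with hC1
  have hC1p : 0 < C1 := by have : 0 ≤ wi (fun _ => (1:ℝ) ^ 2) := wi_nonneg fun y => sq_nonneg _
                           linarith
  refine ⟨8 * C / κ + 1, κ / (16 * C1), by positivity, by positivity, ?_⟩
  intro w w1 w2 F h1 hD hD4 hr
  by_contra! hcon
  set R := 8 * C / κ + 1 with hR
  have hRp : 1 ≤ R := by rw [hR]; have : 0 < 8 * C / κ := by positivity
                         linarith
  obtain ⟨ε, hε, hs⟩ := no_change hcon
  obtain ⟨p, hp, hq, hw⟩ := hpl w w1 w2 F h1 hD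
  have hlow := wi_ge F.p0.abs (fun y => abs_nonneg _) hp hδ.le hq hw
  rw [← hκ] at hlow
  have hpt : ∀ y, |w y| ≤ ε * w y + 2 / R ^ 2 * (y ^ 2 * |w y|) := by
    intro y
    by_cases hy : |y| ≤ R
    · have h3 : |w y| = ε * w y := by
        rw [← abs_of_nonneg (hs y hy), abs_mul, hε, one_mul]
      have : 0 ≤ 2 / R ^ 2 * (y ^ 2 * |w y|) := by positivity
      linarith
    · push Not at hy
      have h3 : -|w y| ≤ ε * w y := by
        have := neg_abs_le (ε * w y); rwa [abs_mul, hε, one_mul] at this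
      have h4 : 2 ≤ 2 / R ^ 2 * y ^ 2 := by
        rw [div_mul_eq_mul_div, le_div_iff₀ (by positivity), ← sq_abs y]
        have := pow_le_pow_left₀ (by linarith) hy.le 2
        linarith
      nlinarith [abs_nonneg (w y)]
  have hP := ((PG.id.pow 2).mul F.p0.abs)
  have h := wi_mono F.p0.abs ((F.p0.cmul ε).add (hP.cmul (2 / R ^ 2))) hpt
  rw [wi_add (F.p0.cmul ε) (hP.cmul (2 / R ^ 2)), wi_cmul, wi_cmul] at h
  have hm := mom (PG.id.pow 2) F.p0 h1
  rw [← hC] at hm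
  have hres := wi_res_small F (η := κ / (16 * C1)) (by positivity) (PG.const 1) hr
  simp only [one_mul] at hres
  rw [← hC1, F.res1, abs_mul, abs_neg] at hres
  have e1 : C1 * (κ / (16 * C1)) = κ / 16 := by field_simp
  rw [e1] at hres
  have hww : |wi w| ≤ κ / 4 := by
    have := le_abs_self (wi fun y => w1 y ^ 2)
    nlinarith [abs_nonneg (wi w)]
  have h5 : ε * wi w ≤ κ / 4 := by
    have := le_abs_self (ε * wi w); rw [abs_mul, hε, one_mul] at this; linarith
  have h6 : 2 / R ^ 2 * wi (fun y => y ^ 2 * |w y|) ≤ κ / 4 := by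
    rw [div_mul_eq_mul_div, div_le_iff₀ (by positivity)]
    have h7 : R * κ = 8 * C + κ := by rw [hR]; field_simp
    nlinarith
  linarith

lemma SC2_aux {w : ℝ → ℝ} {R : ℝ} (hR : 0 < R)
    (h : ∀ y1 y2 y3, -R ≤ y1 → y1 < y2 → y2 < y3 → y3 ≤ R → w y1 * w y2 < 0 → 0 ≤ w y2 * w y3) :
    ∃ c ε : ℝ, |c| ≤ R ∧ |ε| = 1 ∧ ∀ y, |y| ≤ R → 0 ≤ ε * (w y * (y - c)) := by
  by_cases hn : ∃ y1 y2, -R ≤ y1 ∧ y1 < y2 ∧ y2 ≤ R ∧ w y1 * w y2 < 0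
  · obtain ⟨y1, y2, h1, h12, h2, hneg⟩ := hn
    -- ε with ε w y1 < 0
    obtain ⟨ε, hε, hε2, hw1, hw2⟩ : ∃ ε : ℝ, |ε| = 1 ∧ ε * ε = 1 ∧ ε * w y1 < 0 ∧ 0 < ε * w y2 := by
      rcases lt_trichotomy (w y1) 0 with hl | hl | hl
      · exact ⟨1, by simp, by simp, by linarith, by nlinarith⟩
      · rw [hl] at hneg; simp at hneg
      · exact ⟨-1, by simp, by simp, by linarith, by nlinarith⟩
    set S := {y | |y| ≤ R ∧ ε * w y < 0} with hS
    have hne : S.Nonempty := ⟨y1, abs_le.mpr ⟨h1, by linarith⟩, hw1⟩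
    have hbd : BddAbove S := ⟨R, fun y hy => (abs_le.mp hy.1).2⟩
    refine ⟨sSup S, ε, abs_le.mpr ⟨?_, ?_⟩, hε, ?_⟩
    · exact h1.trans (le_csSup hbd ⟨abs_le.mpr ⟨h1, by linarith⟩, hw1⟩)
    · exact csSup_le hne fun y hy => (abs_le.mp hy.1).2
    · intro y hy
      rw [← mul_assoc]
      rcases lt_trichotomy y (sSup S) with hl | hl | hl
      · obtain ⟨z, hz, hyz⟩ := exists_lt_of_lt_csSup hne hl
        apply mul_nonneg_of_nonpos_of_nonpos _ (by linarith)
        by_contra! hpos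
        have hz1 := abs_le.mp hz.1
        have hy1 := abs_le.mp hy
        have hz2 : ε * w z < 0 := hz.2
        have prod : ∀ u t, w u * w t = (ε * w u) * (ε * w t) := by
          intro u t; rw [show (ε * w u) * (ε * w t) = (ε * ε) * (w u * w t) by ring, hε2, one_mul]
        rcases lt_trichotomy y2 z with h3 | h3 | h3
        · have := h y1 y2 z h1 h12 h3 hz1.2 hneg
          rw [prod] at this; nlinarith
        · rw [h3] at hw2; linarith
        · have := h y z y2 hy1.1 hyz h3 h2 (by rw [prod]; nlinarith)
          rw [prod] at this; nlinarith
      · rw [hl]; simp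
      · apply mul_nonneg _ (by linarith)
        by_contra! hneg'
        exact absurd (le_csSup hbd (show y ∈ S from ⟨hy, hneg'⟩)) (by linarith)
  · push Not at hn
    obtain ⟨ε, hε, hs⟩ := no_change hn
    refine ⟨-R, ε, by rw [abs_neg, abs_of_pos hR], hε, fun y hy => ?_⟩
    rw [← mul_assoc]
    exact mul_nonneg (hs y hy) (by linarith [(abs_le.mp hy).1])

set_option maxHeartbeats 1000000 in
lemma SC2 (K : ℝ) (hK : 0 ≤ K) : ∃ R η : ℝ, 0 < R ∧ 0 < η ∧ ∀ w w1 w2, Fn w w1 w2 →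
    wi (fun y => w y ^ 2) = 1 → wi (fun y => w1 y ^ 2) ≤ K → 3 / 4 ≤ wi (fun y => w1 y ^ 2) →
    wi (fun y => res w w1 w2 (wi (fun y => w1 y ^ 2)) y ^ 2) ≤ η ^ 2 →
    ∃ y1 y2 y3, -R ≤ y1 ∧ y1 < y2 ∧ y2 < y3 ∧ y3 ≤ R ∧ w y1 * w y2 < 0 ∧ w y2 * w y3 < 0 := by
  obtain ⟨R0, δ, hR0, hδ, hpl⟩ := plateau K hK
  set κ := 1 / 6 * (δ / 4) * (δ / 4) * Real.exp (-(R0 ^ 2 / 4)) with hκ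
  have hκp : 0 < κ := by positivity
  set C := wi (fun y => (|y| ^ 3) ^ 2) + 1 with hC
  have hCp : 0 < C := by have : 0 ≤ wi (fun y => (|y| ^ 3) ^ 2) := wi_nonneg fun y => sq_nonneg _
                         linarith
  set C1 := wi (fun _ => (1:ℝ) ^ 2) + 1 with hC1
  have hC1p : 0 < C1 := by have : 0 ≤ wi (fun _ => (1:ℝ) ^ 2) := wi_nonneg fun y => sq_nonneg _
                           linarith
  set C2 := wi (fun y => y ^ 2) + 1 with hC2
  have hC2p : 0 < C2 := by have : 0 ≤ wi (fun y => y ^ 2) := wi_nonneg fun y => sq_nonneg _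
                           linarith
  set R := 16 * C / κ + 1 with hR
  have hRp : 1 ≤ R := by rw [hR]; have : 0 < 16 * C / κ := by positivity
                         linarith
  have hRpos : 0 < R := by linarith
  set η := κ / (16 * C2 + 16 * R * C1) with hη
  have hηp : 0 < η := by positivity
  have hηe : η * (16 * C2 + 16 * R * C1) = κ := by rw [hη]; field_simp
  refine ⟨R, η, hRpos, hηp, ?_⟩
  intro w w1 w2 F h1 hD hD4 hr
  by_contra! hcon
  obtain ⟨c, ε, hc, hε, hs⟩ := SC2_aux hRpos hcon
  obtain ⟨p, hp, hq, hw⟩ := hpl w w1 w2 F h1 hD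
  have hG : PG (fun y => |w y| * |y - c|) := F.p0.abs.mul (PG.id.sub (PG.const c)).abs
  have hlow : κ ≤ wi (fun y => |w y| * |y - c|) := by
    have e : κ = 1 / 6 * (δ / 4) * (δ / 4) * Real.exp (-(R0 ^ 2 / 4)) := hκ
    rw [e]
    rcases le_total c (p + δ / 2) with hcp | hcp
    · apply wi_ge hG (fun y => by positivity) (p := p + 3 * δ / 4) (by linarith) (by positivity) (by linarith)
      intro y hy
      exact mul_le_mul (hw y ⟨by linarith [hy.1], by linarith [hy.2]⟩)
        (by have := le_abs_self (y - c); linarith [hy.1]) (by positivity) (abs_nonneg _)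
    · apply wi_ge hG (fun y => by positivity) (p := p) (by linarith) (by positivity) (by linarith)
      intro y hy
      exact mul_le_mul (hw y ⟨by linarith [hy.1], by linarith [hy.2]⟩)
        (by have := neg_le_abs (y - c); linarith [hy.2]) (by positivity) (abs_nonneg _)
  have hpt : ∀ y, |w y| * |y - c| ≤ ε * (y * w y - c * w y) + 4 / R ^ 2 * (|y| ^ 3 * |w y|) := by
    intro y
    have e : ε * (y * w y - c * w y) = ε * (w y * (y - c)) := by ring
    rw [e]
    by_cases hy : |y| ≤ R
    · have h3 : |w y| * |y - c| = ε * (w y * (y - c)) := by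
        rw [← abs_of_nonneg (hs y hy), abs_mul, hε, one_mul, abs_mul]
      have : 0 ≤ 4 / R ^ 2 * (|y| ^ 3 * |w y|) := by positivity
      linarith
    · push Not at hy
      have h3 : -(|w y| * |y - c|) ≤ ε * (w y * (y - c)) := by
        have := neg_abs_le (ε * (w y * (y - c))); rwa [abs_mul, hε, one_mul, abs_mul] at this
      have h4 : 4 * |y| ≤ 4 / R ^ 2 * |y| ^ 3 := by
        rw [div_mul_eq_mul_div, le_div_iff₀ (by positivity)]
        have := pow_le_pow_left₀ (by linarith) hy.le 2
        nlinarith [abs_nonneg y]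
      have h5 : |y - c| ≤ 2 * |y| := by
        have := abs_sub y c; linarith
      have h6 : 2 * (|w y| * |y - c|) ≤ |w y| * (4 * |y|) := by nlinarith [abs_nonneg (w y)]
      have h7 : |w y| * (4 * |y|) ≤ |w y| * (4 / R ^ 2 * |y| ^ 3) :=
        mul_le_mul_of_nonneg_left h4 (abs_nonneg _)
      linarith
  have hP := (PG.id.abs.pow 3).mul F.p0.abs
  have hQ := ((PG.id.mul F.p0).sub (F.p0.cmul c)).cmul ε
  have h := wi_mono hG (hQ.add (hP.cmul (4 / R ^ 2))) hpt
  rw [wi_add hQ (hP.cmul (4 / R ^ 2)), wi_cmul, wi_cmul, wi_sub (PG.id.mul F.p0) (F.p0.cmul c), wi_cmul] at h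
  have hm := mom (PG.id.abs.pow 3) F.p0 h1
  rw [← hC] at hm
  have hres := wi_res_small F hηp.le (PG.const 1) hr
  simp only [one_mul] at hres
  rw [← hC1, F.res1, abs_mul, abs_neg] at hres
  have hres2 := wi_res_small F hηp.le PG.id hr
  rw [← hC2, F.resy, abs_mul] at hres2
  have hww : |wi w| ≤ 4 * (C1 * η) := by
    have := le_abs_self (wi fun y => w1 y ^ 2)
    nlinarith [abs_nonneg (wi w)]
  have hwy : |wi (fun y => y * w y)| ≤ 4 * (C2 * η) := by
    have := neg_le_abs (1 / 2 - wi fun y => w1 y ^ 2)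
    nlinarith [abs_nonneg (wi (fun y => y * w y))]
  have h5 : ε * (wi (fun y => y * w y) - c * wi w) ≤ κ / 4 := by
    have h8 := le_abs_self (ε * (wi (fun y => y * w y) - c * wi w))
    rw [abs_mul, hε, one_mul] at h8
    have h9 := abs_sub (wi (fun y => y * w y)) (c * wi w)
    rw [abs_mul] at h9
    have h10 : |c| * |wi w| ≤ R * (4 * (C1 * η)) :=
      mul_le_mul hc hww (abs_nonneg _) hRpos.le
    nlinarith
  have h6 : 4 / R ^ 2 * wi (fun y => |y| ^ 3 * |w y|) ≤ κ / 2 := by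
    rw [div_mul_eq_mul_div, div_le_iff₀ (by positivity)]
    have h7 : R * κ = 16 * C + κ := by rw [hR]; field_simp
    nlinarith
  linarith

/-- one-sided Gronwall -/
lemma gron {E E' e2 : ℝ → ℝ} {c p q : ℝ} (hc : 0 ≤ c) (hpq : p ≤ q) (hE : ∀ y, HasDerivAt E (E' y) y)
    (he : Continuous e2) (h0 : ∀ y, 0 ≤ e2 y) (h : ∀ y ∈ Icc p q, E' y ≤ c * E y + e2 y) :
    E q ≤ Real.exp (c * (q - p)) * (E p + ∫ y in p..q, e2 y) := by
  set φ : ℝ → ℝ := fun y => Real.exp (-(c * (y - p))) * E y - ∫ z in p..y, e2 z with hφ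
  have hd : ∀ y, HasDerivAt φ (Real.exp (-(c * (y - p))) * (-c) * E y + Real.exp (-(c * (y - p))) * E' y - e2 y) y := by
    intro y
    have h1 : HasDerivAt (fun y => -(c * (y - p))) (-c) y := by
      have := (((hasDerivAt_id y).sub_const p).const_mul c).neg
      exact this.congr_deriv (by simp)
    have h2 : HasDerivAt (fun y => ∫ z in p..y, e2 z) (e2 y) y :=
      intervalIntegral.integral_hasDerivAt_right (he.intervalIntegrable _ _)
        (he.stronglyMeasurableAtFilter _ _) he.continuousAt
    exact (h1.exp.mul (hE y)).sub h2
  have hanti : AntitoneOn φ (Icc p q) := by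
    apply antitoneOn_of_deriv_nonpos (convex_Icc p q)
    · exact fun y _ => (hd y).continuousAt.continuousWithinAt
    · exact fun y _ => (hd y).differentiableAt.differentiableWithinAt
    · intro y hy
      rw [interior_Icc] at hy
      rw [(hd y).deriv]
      have h3 := h y ⟨hy.1.le, hy.2.le⟩
      have h4 : Real.exp (-(c * (y - p))) ≤ 1 := by
        apply Real.exp_le_one_iff.mpr
        have := mul_nonneg hc (sub_nonneg.mpr hy.1.le); linarith
      have h5 := Real.exp_pos (-(c * (y - p)))
      nlinarith [h0 y]
  have h6 := hanti (left_mem_Icc.mpr hpq) (right_mem_Icc.mpr hpq) hpq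
  simp only [hφ, sub_self, mul_zero, neg_zero, Real.exp_zero, one_mul, intervalIntegral.integral_same, sub_zero] at h6
  have h7 : E q = Real.exp (c * (q - p)) * (Real.exp (-(c * (q - p))) * E q) := by
    rw [← mul_assoc, ← Real.exp_add]; simp
  rw [h7]
  apply mul_le_mul_of_nonneg_left _ (Real.exp_pos _).le
  linarith

set_option maxHeartbeats 1000000 in
lemma SEP (K : ℝ) (hK : 0 ≤ K) : ∃ η θ : ℝ, 0 < η ∧ 0 < θ ∧ ∀ w w1 w2, Fn w w1 w2 →
    wi (fun y => w y ^ 2) = 1 → wi (fun y => w1 y ^ 2) ≤ K →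
    wi (fun y => res w w1 w2 (wi (fun y => w1 y ^ 2)) y ^ 2) ≤ η ^ 2 →
    ∀ y0 y1, |y0| ≤ 2 → |y1| ≤ 2 → |y0 - y1| ≤ θ → w y0 = 0 → w1 y1 ≠ 0 := by
  set R := 9 + 32 * K with hR
  have hR9 : 9 ≤ R := by linarith
  set c := 2 + R + K with hc
  have hcp : 0 < c := by linarith
  set μ := Real.exp (-(2 * c * R)) / 32 with hμ
  have hμp : 0 < μ := by positivity
  have hμ1 : μ ≤ 1 := by
    rw [hμ]; have : Real.exp (-(2 * c * R)) ≤ 1 := Real.exp_le_one_iff.mpr (by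
      have : 0 < 2 * c * R := by positivity
      linarith)
    linarith
  set X := Real.exp (R ^ 2 / 4) with hX
  have hX1 : 1 ≤ X := Real.one_le_exp (by positivity)
  have hXp : 0 < X := by linarith
  set η := μ / X with hη
  have hηp : 0 < η := by positivity
  have hη1 : η ≤ μ := div_le_self hμp.le hX1
  have hXη : X * η = μ := by rw [hη]; field_simp
  set B := X * (3 * (R ^ 2 / 4 * K + K ^ 2 + 1)) with hB
  have hBp : 0 < B := by positivity
  set lam := μ / (B + 1) with hlam
  have hlp : 0 < lam := by positivity
  have hlB : lam * B ≤ μ := by rw [hlam, div_mul_eq_mul_div, div_le_iff₀ (by positivity)]; nlinarith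
  refine ⟨η, μ * lam, hηp, by positivity, ?_⟩
  intro w w1 w2 F h1 hD hr y0 y1 hy0 hy1 hyy hw0 hw1
  set D := wi (fun y => w1 y ^ 2) with hDdef
  have hD0 : 0 ≤ D := wi_nonneg fun y => sq_nonneg _
  set e := res w w1 w2 D with he
  have pe : PG e := F.pres D
  have hw2 : ∀ y, w2 y = y / 2 * w1 y - D * w y - e y := by intro y; simp only [he, res]; ring
  -- bound for w1 y0
  set G : ℝ → ℝ := fun y => 3 * ((R ^ 2 / 4 * w1 y ^ 2 + K ^ 2 * w y ^ 2) + e y ^ 2) with hG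
  have pG1 : PG (fun y => R ^ 2 / 4 * w1 y ^ 2 + K ^ 2 * w y ^ 2) := ((F.p1.pow 2).cmul _).add ((F.p0.pow 2).cmul _)
  have pG : PG G := (pG1.add (pe.pow 2)).cmul 3
  have hGw : wi G ≤ 3 * (R ^ 2 / 4 * K + K ^ 2 + 1) := by
    rw [hG, wi_cmul, wi_add pG1 (pe.pow 2), wi_add ((F.p1.pow 2).cmul _) ((F.p0.pow 2).cmul _), wi_cmul, wi_cmul, h1]
    have : η ^ 2 ≤ 1 := pow_le_one₀ hηp.le (hη1.trans hμ1)
    have h3 : R ^ 2 / 4 * D ≤ R ^ 2 / 4 * K := by gcongr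
    linarith
  have hm : |w1 y0| ≤ μ := by
    have key : ∀ p q, -R ≤ p → p ≤ q → q ≤ R → q - p ≤ μ * lam → |w1 q - w1 p| ≤ μ := by
      intro p q hp hpq hq hd
      have := modulus (G := G) F.d2 F.p2.1 pG (fun y => by simp only [hG]; positivity) hp hpq hq hlp (by
        intro y hy
        have h3 : (y / 2 * w1 y) ^ 2 ≤ R ^ 2 / 4 * w1 y ^ 2 := by
          have : y ^ 2 ≤ R ^ 2 := by rw [← sq_abs y]; exact pow_le_pow_left₀ (abs_nonneg y) hy 2
          nlinarith [sq_nonneg (w1 y)]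
        have h4 : (D * w y) ^ 2 ≤ K ^ 2 * w y ^ 2 := by
          rw [mul_pow]; gcongr
        rw [hw2]; simp only [hG]
        nlinarith [sq_nonneg (y / 2 * w1 y + D * w y), sq_nonneg (y / 2 * w1 y + e y), sq_nonneg (D * w y - e y)])
      have h2 : (q - p) / lam ≤ μ := by rw [div_le_iff₀ hlp]; linarith
      have h3 : lam * (X * wi G) ≤ lam * B := by rw [hB]; gcongr
      linarith
    have hy0' := abs_le.mp hy0
    have hy1' := abs_le.mp hy1
    have hyy' := abs_le.mp hyy
    rcases le_total y0 y1 with hle | hle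
    · have := key y0 y1 (by linarith) hle (by linarith) (by linarith)
      rwa [hw1, zero_sub, abs_neg] at this
    · have := key y1 y0 (by linarith) hle (by linarith) (by linarith)
      rwa [hw1, sub_zero] at this
  -- energy
  obtain ⟨z, hz, hwz⟩ := peak F hK h1 hD
  rw [← hR] at hz
  have hz' := abs_le.mp hz
  have hy0' := abs_le.mp hy0
  set E : ℝ → ℝ := fun y => w y ^ 2 + w1 y ^ 2 with hE
  set E' : ℝ → ℝ := fun y => 2 * w y * w1 y + 2 * w1 y * w2 y with hE'
  have hEd : ∀ y, HasDerivAt E (E' y) y := by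
    intro y
    exact (((F.d1 y).pow 2).add ((F.d2 y).pow 2)).congr_deriv (by simp only [hE']; norm_num)
  have hb : ∀ y, |y| ≤ R → |E' y| ≤ c * E y + e y ^ 2 := by
    intro y hy
    have hy' := abs_le.mp hy
    simp only [hE', hE, hw2, hc]
    have h3 : |w y * w1 y| ≤ (w y ^ 2 + w1 y ^ 2) / 2 := by
      rw [abs_le]; constructor <;> nlinarith [sq_nonneg (w y + w1 y), sq_nonneg (w y - w1 y)]
    have h4 : |w1 y * e y| ≤ (w1 y ^ 2 + e y ^ 2) / 2 := by
      rw [abs_le]; constructor <;> nlinarith [sq_nonneg (w1 y + e y), sq_nonneg (w1 y - e y)]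
    have h5 : |y * w1 y ^ 2| ≤ R * w1 y ^ 2 := by
      rw [abs_mul, abs_of_nonneg (sq_nonneg (w1 y))]; gcongr
    have h6 : |D * (w y * w1 y)| ≤ K * ((w y ^ 2 + w1 y ^ 2) / 2) := by
      rw [abs_mul, abs_of_nonneg hD0]; gcongr
    have e1 : 2 * w y * w1 y + 2 * w1 y * (y / 2 * w1 y - D * w y - e y) =
      2 * (w y * w1 y) + y * w1 y ^ 2 - 2 * (D * (w y * w1 y)) - 2 * (w1 y * e y) := by ring
    rw [e1]
    rw [abs_le] at h3 h4 h5 h6 ⊢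
    have h7 : 0 ≤ R * w y ^ 2 := by positivity
    have h8 := sq_nonneg (w y)
    have h9 := sq_nonneg (w1 y)
    constructor <;> linarith
  have hE0 : E y0 ≤ μ := by
    simp only [hE, hw0]
    have : w1 y0 ^ 2 ≤ μ ^ 2 := by rw [← sq_abs (w1 y0)]; gcongr
    have h2 : μ ^ 2 ≤ μ := by rw [pow_two]; exact mul_le_of_le_one_right hμp.le hμ1
    linarith
  have hinteg : ∀ p q, -R ≤ p → p ≤ q → q ≤ R → ∫ y in p..q, e y ^ 2 ≤ μ := by
    intro p q hp hpq hq
    have := local_le (pe.pow 2) (fun y => sq_nonneg _) hp hpq hq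
    have h3 : X * wi (fun y => e y ^ 2) ≤ X * η ^ 2 := by gcongr
    have h4 : X * η ^ 2 ≤ μ := by
      have : X * η ^ 2 = μ * η := by rw [← hXη]; ring
      rw [this]; exact mul_le_of_le_one_right hμp.le (hη1.trans hμ1)
    linarith
  have hfin : ∀ d I, 0 ≤ d → d ≤ 2 * R → I ≤ μ → E z ≤ Real.exp (c * d) * (E y0 + I) → False := by
    intro d I hd0 hd hI hle
    have h3 : Real.exp (c * d) ≤ Real.exp (2 * c * R) := Real.exp_le_exp.mpr (by
      have := mul_le_mul_of_nonneg_left hd hcp.le; linarith)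
    have h4 : Real.exp (c * d) * (E y0 + I) ≤ Real.exp (c * d) * (2 * μ) := by gcongr; linarith
    have h5 : Real.exp (c * d) * (2 * μ) ≤ Real.exp (2 * c * R) * (2 * μ) := by gcongr
    have h6 : Real.exp (2 * c * R) * (2 * μ) = 1 / 16 := by
      have : Real.exp (2 * c * R) * Real.exp (-(2 * c * R)) = 1 := by rw [← Real.exp_add]; simp
      rw [hμ]; linear_combination this / 16
    have h7 : w z ^ 2 ≤ E z := by simp only [hE]; linarith [sq_nonneg (w1 z)]
    linarith
  rcases le_total y0 z with hle | hle
  · have := gron hcp.le hle hEd (pe.pow 2).1 (fun y => sq_nonneg _)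
      (fun y hy => (le_abs_self _).trans (hb y (abs_le.mpr ⟨by linarith [hy.1], by linarith [hy.2]⟩)))
    exact hfin (z - y0) _ (by linarith) (by linarith) (hinteg y0 z (by linarith) hle hz'.2) this
  · have := gron (E := fun y => E (-y)) (E' := fun y => - E' (-y)) (e2 := fun y => e (-y) ^ 2) hcp.le
      (neg_le_neg hle) (fun y => by
        have := HasDerivAt.comp (h₂ := E) y (hEd (-y)) (hasDerivAt_neg y)
        exact this.congr_deriv (by ring))
      (by have := pe.1; fun_prop) (fun y => sq_nonneg _)
      (fun y hy => (neg_le_abs _).trans (hb (-y) (abs_le.mpr ⟨by linarith [hy.2], by linarith [hy.1]⟩)))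
    rw [intervalIntegral.integral_comp_neg (f := fun y => e y ^ 2)] at this
    simp only [neg_neg] at this
    exact hfin _ _ (by linarith) (by linarith) (hinteg z y0 hz'.1 hle (by linarith)) this

end ZN

namespace ZN
open MeasureTheory Filter Topology

structure Sol (a b v vt vx vxx : ℝ → ℝ → ℝ) (M : ℝ) : Prop where
  M0 : 0 ≤ M
  ha : ∀ t x : ℝ, 0 ≤ t → |a t x| ≤ M
  hb : ∀ t x : ℝ, 0 ≤ t → |b t x| ≤ M
  vP : ∀ t x : ℝ, 0 ≤ t → v t (x + 2 * π) = v t x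
  aP : ∀ t x : ℝ, 0 ≤ t → a t (x + 2 * π) = a t x
  bP : ∀ t x : ℝ, 0 ≤ t → b t (x + 2 * π) = b t x
  ht : ∀ t x : ℝ, 0 < t → HasDerivAt (fun s => v s x) (vt t x) t
  hx : ∀ t x : ℝ, 0 < t → HasDerivAt (fun y => v t y) (vx t x) x
  hxx : ∀ t x : ℝ, 0 < t → HasDerivAt (fun y => vx t y) (vxx t x) x
  tC : ContinuousOn (fun p : ℝ × ℝ => vt p.1 p.2) (Set.Ioi 0 ×ˢ Set.univ)
  xC : ContinuousOn (fun p : ℝ × ℝ => vx p.1 p.2) (Set.Ioi 0 ×ˢ Set.univ)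
  xxC : ContinuousOn (fun p : ℝ × ℝ => vxx p.1 p.2) (Set.Ioi 0 ×ˢ Set.univ)
  eq : ∀ t x : ℝ, 0 < t → vt t x = vxx t x + a t x * vx t x + b t x * v t x
  nz : ∀ t : ℝ, 0 ≤ t → ∃ x : ℝ, v t x ≠ 0

variable {a b v vt vx vxx : ℝ → ℝ → ℝ} {M : ℝ}

lemma nhds_half {t : ℝ} (x : ℝ) (ht : 0 < t) : (Set.Ioi (0:ℝ) ×ˢ (Set.univ : Set ℝ)) ∈ 𝓝 ((t, x) : ℝ × ℝ) :=
  (isOpen_Ioi.prod isOpen_univ).mem_nhds ⟨ht, mem_univ _⟩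

lemma cAt {f : ℝ → ℝ → ℝ} (h : ContinuousOn (fun p : ℝ × ℝ => f p.1 p.2) (Set.Ioi 0 ×ˢ Set.univ))
    {t : ℝ} (x : ℝ) (ht : 0 < t) : ContinuousAt (fun p : ℝ × ℝ => f p.1 p.2) (t, x) :=
  h.continuousAt (nhds_half x ht)

lemma Sol.fd (S : Sol a b v vt vx vxx M) {t : ℝ} (x : ℝ) (h : 0 < t) :
    HasFDerivAt (fun p : ℝ × ℝ => v p.1 p.2)
      ((ContinuousLinearMap.toSpanSingleton ℝ (vt t x)).coprod
        (ContinuousLinearMap.toSpanSingleton ℝ (vx t x))) (t, x) := by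
  have hpos : ∀ᶠ p : ℝ × ℝ in 𝓝 (t, x), 0 < p.1 := by
    filter_upwards [nhds_half x h] with p hp using hp.1
  have := hasStrictFDerivAt_uncurry_coprod (𝕜 := ℝ) (f := v) (u := ((t, x) : ℝ × ℝ))
    (f₁ := fun p q => ContinuousLinearMap.toSpanSingleton ℝ (vt p q))
    (f₂ := fun p q => ContinuousLinearMap.toSpanSingleton ℝ (vx p q))
    (by filter_upwards [hpos] with p hp; exact (S.ht p.1 p.2 hp).hasFDerivAt)
    (by filter_upwards [hpos] with p hp; exact (S.hx p.1 p.2 hp).hasFDerivAt)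
    (by have := cAt S.tC x h
        exact (ContinuousLinearMap.toSpanSingletonCLE (𝕜 := ℝ) (E := ℝ)).continuous.continuousAt.comp this)
    (by have := cAt S.xC x h
        exact (ContinuousLinearMap.toSpanSingletonCLE (𝕜 := ℝ) (E := ℝ)).continuous.continuousAt.comp this)
  exact this.hasFDerivAt

lemma Sol.vC (S : Sol a b v vt vx vxx M) :
    ContinuousOn (fun p : ℝ × ℝ => v p.1 p.2) (Set.Ioi 0 ×ˢ Set.univ) :=
  fun p hp => (S.fd p.2 hp.1).continuousAt.continuousWithinAt

lemma Sol.tP (S : Sol a b v vt vx vxx M) (t x : ℝ) (h : 0 < t) : vt t (x + 2 * π) = vt t x := by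
  have h1 := S.ht t (x + 2 * π) h
  have h2 : HasDerivAt (fun s => v s (x + 2 * π)) (vt t x) t := by
    refine (S.ht t x h).congr_of_eventuallyEq ?_
    filter_upwards [Ioi_mem_nhds h] with s hs
    exact S.vP s x (le_of_lt hs)
  exact h1.unique h2

lemma Sol.xP (S : Sol a b v vt vx vxx M) (t x : ℝ) (h : 0 < t) : vx t (x + 2 * π) = vx t x := by
  have h1 := (S.hx t (x + 2 * π) h).comp_add_const x (2 * π)
  have h2 : HasDerivAt (fun y => v t (y + 2 * π)) (vx t x) x := by
    refine (S.hx t x h).congr_of_eventuallyEq ?_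
    exact Eventually.of_forall fun y => S.vP t y h.le
  exact h1.unique h2

lemma Sol.xxP (S : Sol a b v vt vx vxx M) (t x : ℝ) (h : 0 < t) : vxx t (x + 2 * π) = vxx t x := by
  have h1 := (S.hxx t (x + 2 * π) h).comp_add_const x (2 * π)
  have h2 : HasDerivAt (fun y => vx t (y + 2 * π)) (vxx t x) x := by
    refine (S.hxx t x h).congr_of_eventuallyEq ?_
    exact Eventually.of_forall fun y => S.xP t y h
  exact h1.unique h2

lemma per_bd {f : ℝ → ℝ → ℝ} (h : ContinuousOn (fun p : ℝ × ℝ => f p.1 p.2) (Set.Ioi 0 ×ˢ Set.univ))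
    (hp : ∀ t x, 0 < t → f t (x + 2 * π) = f t x) {t1 t2 : ℝ} (h1 : 0 < t1) :
    ∃ C : ℝ, 0 ≤ C ∧ ∀ t x, t1 ≤ t → t ≤ t2 → |f t x| ≤ C := by
  have hK : IsCompact (Icc t1 t2 ×ˢ Icc (0:ℝ) (2 * π)) := isCompact_Icc.prod isCompact_Icc
  obtain ⟨C, hC⟩ := hK.exists_bound_of_continuousOn (h.mono (fun p hp => ⟨lt_of_lt_of_le h1 hp.1.1, mem_univ _⟩))
  refine ⟨|C|, abs_nonneg _, fun t x ht1 ht2 => ?_⟩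
  have hper : Function.Periodic (f t) (2 * π) := fun x => hp t x (by linarith)
  obtain ⟨y, hy, hxy⟩ := hper.exists_mem_Ico₀ (by positivity) x
  rw [hxy]
  exact (hC (t, y) ⟨⟨ht1, ht2⟩, hy.1, hy.2.le⟩).trans (le_abs_self C)

lemma Sol.bdd (S : Sol a b v vt vx vxx M) {t1 : ℝ} (t2 : ℝ) (h1 : 0 < t1) : ∃ C : ℝ, 0 ≤ C ∧ ∀ t x, t1 ≤ t → t ≤ t2 →
    |v t x| ≤ C ∧ |vt t x| ≤ C ∧ |vx t x| ≤ C ∧ |vxx t x| ≤ C := by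
  obtain ⟨C0, h0, hC0⟩ := per_bd (t2 := t2) S.vC (fun t x h => S.vP t x h.le) h1
  obtain ⟨C1, h1', hC1⟩ := per_bd (t2 := t2) S.tC S.tP h1
  obtain ⟨C2, h2, hC2⟩ := per_bd (t2 := t2) S.xC S.xP h1
  obtain ⟨C3, h3, hC3⟩ := per_bd (t2 := t2) S.xxC S.xxP h1
  refine ⟨C0 + C1 + C2 + C3, by positivity, fun t x ha hb => ⟨?_, ?_, ?_, ?_⟩⟩
  · linarith [hC0 t x ha hb]
  · linarith [hC1 t x ha hb]
  · linarith [hC2 t x ha hb]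
  · linarith [hC3 t x ha hb]

/-- similarity variables -/
noncomputable def U (f : ℝ → ℝ → ℝ) (t0 x0 τ y : ℝ) : ℝ := f (t0 - exp (-τ)) (x0 + exp (-τ / 2) * y)
noncomputable def W1 (vx : ℝ → ℝ → ℝ) (t0 x0 τ y : ℝ) : ℝ := exp (-τ / 2) * U vx t0 x0 τ y
noncomputable def W2 (vxx : ℝ → ℝ → ℝ) (t0 x0 τ y : ℝ) : ℝ := exp (-τ) * U vxx t0 x0 τ y
noncomputable def Wt (vt vx : ℝ → ℝ → ℝ) (t0 x0 τ y : ℝ) : ℝ := exp (-τ) * U vt t0 x0 τ y - y / 2 * W1 vx t0 x0 τ y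
noncomputable def AW (vx vxx : ℝ → ℝ → ℝ) (t0 x0 τ y : ℝ) : ℝ := y / 2 * W1 vx t0 x0 τ y - W2 vxx t0 x0 τ y
noncomputable def ff (vt vx vxx : ℝ → ℝ → ℝ) (t0 x0 τ y : ℝ) : ℝ := Wt vt vx t0 x0 τ y + AW vx vxx t0 x0 τ y

lemma exp_half {τ : ℝ} (h : 1 < τ) : exp (-τ) ≤ 1 / 2 := by
  have h1 : exp (-τ) ≤ exp (-1) := exp_le_exp.mpr (by linarith)
  have h2 : exp (-1 : ℝ) * exp 1 = 1 := by rw [← exp_add]; simp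
  have h3 := Real.add_one_le_exp (1:ℝ)
  nlinarith [exp_pos (-1:ℝ)]

lemma tm {t0 τ : ℝ} (h0 : 1 ≤ t0) (h : 1 < τ) : 1 / 2 ≤ t0 - exp (-τ) ∧ t0 - exp (-τ) ≤ t0 := by
  have := exp_half h; have := exp_pos (-τ); constructor <;> linarith

lemma sq_r (τ : ℝ) : exp (-τ / 2) ^ 2 = exp (-τ) := by rw [← exp_nat_mul]; congr 1; push_cast; ring
lemma r_le {τ : ℝ} (h : 1 < τ) : exp (-τ / 2) ≤ 1 := exp_le_one_iff.mpr (by linarith)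
lemma s_le {τ : ℝ} (h : 1 < τ) : exp (-τ) ≤ 1 := exp_le_one_iff.mpr (by linarith)

lemma U_cont_y {f : ℝ → ℝ → ℝ} (h : ContinuousOn (fun p : ℝ × ℝ => f p.1 p.2) (Set.Ioi 0 ×ˢ Set.univ))
    {t0 τ : ℝ} (x0 : ℝ) (h0 : 1 ≤ t0) (ht : 1 < τ) : Continuous (U f t0 x0 τ) := by
  rw [continuous_iff_continuousAt]; intro y
  have h1 := cAt h (t := t0 - exp (-τ)) (x0 + exp (-τ / 2) * y) (by linarith [(tm h0 ht).1])
  exact ContinuousAt.comp (f := fun y => ((t0 - exp (-τ), x0 + exp (-τ / 2) * y) : ℝ × ℝ)) (x := y) h1 (by fun_prop)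

lemma U_cont_t {f : ℝ → ℝ → ℝ} (h : ContinuousOn (fun p : ℝ × ℝ => f p.1 p.2) (Set.Ioi 0 ×ˢ Set.univ))
    {t0 τ : ℝ} (x0 y : ℝ) (h0 : 1 ≤ t0) (ht : 1 < τ) : ContinuousAt (fun τ => U f t0 x0 τ y) τ := by
  have h1 := cAt h (t := t0 - exp (-τ)) (x0 + exp (-τ / 2) * y) (by linarith [(tm h0 ht).1])
  exact ContinuousAt.comp (f := fun τ => ((t0 - exp (-τ), x0 + exp (-τ / 2) * y) : ℝ × ℝ)) (x := τ) h1 (by fun_prop)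

lemma PG.of_bd {f : ℝ → ℝ} (h : Continuous f) {C : ℝ} (hb : ∀ y, |f y| ≤ C) : PG f :=
  ⟨h, C, 0, fun y => by simpa using hb y⟩


lemma Sol.PGs (S : Sol a b v vt vx vxx M) {t0 : ℝ} (x0 : ℝ) (h0 : 1 ≤ t0) {τ : ℝ} (ht : 1 < τ) : PG (U v t0 x0 τ) ∧ PG (U vt t0 x0 τ) ∧ PG (U vx t0 x0 τ) ∧ PG (U vxx t0 x0 τ) := by
  obtain ⟨C, _, hC⟩ := S.bdd (t1 := 1 / 2) t0 (by norm_num)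
  have h := tm h0 ht
  exact ⟨PG.of_bd (U_cont_y S.vC x0 h0 ht) fun y => (hC _ _ h.1 h.2).1,
    PG.of_bd (U_cont_y S.tC x0 h0 ht) fun y => (hC _ _ h.1 h.2).2.1,
    PG.of_bd (U_cont_y S.xC x0 h0 ht) fun y => (hC _ _ h.1 h.2).2.2.1,
    PG.of_bd (U_cont_y S.xxC x0 h0 ht) fun y => (hC _ _ h.1 h.2).2.2.2⟩

lemma Sol.pgt (S : Sol a b v vt vx vxx M) {t0 : ℝ} (x0 : ℝ) (h0 : 1 ≤ t0) {τ : ℝ} (ht : 1 < τ) : PG (Wt vt vx t0 x0 τ) :=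
  ((S.PGs x0 h0 ht).2.1.cmul _).sub ((S.PGs x0 h0 ht).2.2.1.cmul _).half

lemma Sol.fn (S : Sol a b v vt vx vxx M) {t0 : ℝ} (x0 : ℝ) (h0 : 1 ≤ t0) {τ : ℝ} (ht : 1 < τ) : Fn (U v t0 x0 τ) (W1 vx t0 x0 τ) (W2 vxx t0 x0 τ) where
  d1 y := by
    have h := S.hx (t0 - exp (-τ)) (x0 + exp (-τ / 2) * y) (by linarith [(tm h0 ht).1])
    have h2 : HasDerivAt (fun y => x0 + exp (-τ / 2) * y) (exp (-τ / 2)) y := by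
      simpa using ((hasDerivAt_id y).const_mul (exp (-τ / 2))).const_add x0
    exact (HasDerivAt.comp (h := fun y => x0 + exp (-τ / 2) * y) y h h2).congr_deriv (by simp only [W1, U]; ring)
  d2 y := by
    have h := S.hxx (t0 - exp (-τ)) (x0 + exp (-τ / 2) * y) (by linarith [(tm h0 ht).1])
    have h2 : HasDerivAt (fun y => x0 + exp (-τ / 2) * y) (exp (-τ / 2)) y := by
      simpa using ((hasDerivAt_id y).const_mul (exp (-τ / 2))).const_add x0
    exact ((HasDerivAt.comp (h := fun y => x0 + exp (-τ / 2) * y) y h h2).const_mul (exp (-τ / 2))).congr_deriv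
      (by simp only [W2, U]; rw [← sq_r]; ring)
  p0 := (S.PGs x0 h0 ht).1
  p1 := (S.PGs x0 h0 ht).2.2.1.cmul _
  p2 := (S.PGs x0 h0 ht).2.2.2.cmul _

lemma Sol.dt (S : Sol a b v vt vx vxx M) {t0 : ℝ} (x0 : ℝ) (h0 : 1 ≤ t0) {τ : ℝ} (y : ℝ) (ht : 1 < τ) : HasDerivAt (fun τ => U v t0 x0 τ y) (Wt vt vx t0 x0 τ y) τ := by
  have h := S.fd (t := t0 - exp (-τ)) (x0 + exp (-τ / 2) * y) (by linarith [(tm h0 ht).1])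
  have h1 : HasDerivAt (fun τ => t0 - exp (-τ)) (exp (-τ)) τ := by
    simpa using ((hasDerivAt_neg τ).exp).const_sub t0
  have h2 : HasDerivAt (fun τ => x0 + exp (-τ / 2) * y) (exp (-τ / 2) * (-1 / 2) * y) τ := by
    have := ((((hasDerivAt_neg τ).div_const 2).exp).mul_const y).const_add x0
    simpa using this
  refine (h.comp_hasDerivAt τ (h1.prodMk h2)).congr_deriv ?_
  simp [Wt, W1, U]; ring

lemma Sol.unif (S : Sol a b v vt vx vxx M) {t0 : ℝ} (x0 : ℝ) (h0 : 1 ≤ t0) : ∃ C : ℝ, 0 ≤ C ∧ ∀ τ y, 1 < τ → |U v t0 x0 τ y| ≤ C * (1 + y ^ 2) ∧ |Wt vt vx t0 x0 τ y| ≤ C * (1 + y ^ 2)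
    ∧ |AW vx vxx t0 x0 τ y| ≤ C * (1 + y ^ 2) := by
  obtain ⟨C, hC0, hC⟩ := S.bdd (t1 := 1 / 2) t0 (by norm_num)
  refine ⟨2 * C, by positivity, fun τ y ht => ?_⟩
  have h := tm h0 ht
  obtain ⟨c1, c2, c3, c4⟩ := hC _ (x0 + exp (-τ / 2) * y) h.1 h.2
  have hr := r_le ht
  have hs := s_le ht
  have hr0 := exp_pos (-τ / 2)
  have hs0 := exp_pos (-τ)
  have hy : |y / 2| ≤ 1 + y ^ 2 := by
    rw [abs_le]; constructor <;> nlinarith [sq_nonneg (y + 1), sq_nonneg (y - 1)]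
  have hy2 := sq_nonneg y
  have e1 : |y / 2 * (exp (-τ / 2) * vx (t0 - exp (-τ)) (x0 + exp (-τ / 2) * y))| ≤ (1 + y ^ 2) * (1 * C) := by
    rw [abs_mul, abs_mul, abs_of_pos hr0]; gcongr
  have e2 : |exp (-τ) * vt (t0 - exp (-τ)) (x0 + exp (-τ / 2) * y)| ≤ 1 * C := by
    rw [abs_mul, abs_of_pos hs0]; gcongr
  have e3 : |exp (-τ) * vxx (t0 - exp (-τ)) (x0 + exp (-τ / 2) * y)| ≤ 1 * C := by
    rw [abs_mul, abs_of_pos hs0]; gcongr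
  have hCy : 0 ≤ C * y ^ 2 := by positivity
  refine ⟨?_, ?_, ?_⟩
  · unfold U; linarith
  · unfold Wt W1 U
    refine (abs_sub _ _).trans ?_; linarith
  · unfold AW W1 W2 U
    refine (abs_sub _ _).trans ?_; linarith

lemma Sol.ff_bd (S : Sol a b v vt vx vxx M) {t0 : ℝ} (x0 : ℝ) (h0 : 1 ≤ t0) {τ : ℝ} (y : ℝ) (ht : 1 < τ) : |ff vt vx vxx t0 x0 τ y| ≤
    M * (exp (-τ / 2) * |W1 vx t0 x0 τ y| + exp (-τ) * |U v t0 x0 τ y|) := by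
  have hp : 0 < t0 - exp (-τ) := by linarith [(tm h0 ht).1]
  set t := t0 - exp (-τ)
  set x := x0 + exp (-τ / 2) * y
  have h := S.eq t x hp
  have h1 := S.ha t x hp.le
  have h2 := S.hb t x hp.le
  have hr0 := exp_pos (-τ / 2)
  have hs0 := exp_pos (-τ)
  have e : ff vt vx vxx t0 x0 τ y = exp (-τ) * (a t x * vx t x) + exp (-τ) * (b t x * v t x) := by
    unfold ff Wt AW W1 W2 U
    rw [h]; ring
  rw [e]
  refine (abs_add_le _ _).trans ?_
  unfold W1 U
  simp only [abs_mul, abs_of_pos hr0, abs_of_pos hs0]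
  have e2 : exp (-τ / 2) * (exp (-τ / 2) * |vx t x|) = exp (-τ) * |vx t x| := by rw [← sq_r]; ring
  rw [e2, mul_add]
  have := mul_le_mul_of_nonneg_right h1 (mul_nonneg hs0.le (abs_nonneg (vx t x)))
  have := mul_le_mul_of_nonneg_right h2 (mul_nonneg hs0.le (abs_nonneg (v t x)))
  linarith

lemma Sol.pff (S : Sol a b v vt vx vxx M) {t0 : ℝ} (x0 : ℝ) (h0 : 1 ≤ t0) {τ : ℝ} (ht : 1 < τ) : PG (ff vt vx vxx t0 x0 τ) :=
  (S.pgt x0 h0 ht).add (S.fn x0 h0 ht).pA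

end ZN

namespace ZN
open MeasureTheory Filter Topology
variable {a b v vt vx vxx : ℝ → ℝ → ℝ} {M : ℝ}

noncomputable def HH (v : ℝ → ℝ → ℝ) (t0 x0 τ : ℝ) : ℝ := wi (fun y => U v t0 x0 τ y ^ 2)
noncomputable def DD (vx : ℝ → ℝ → ℝ) (t0 x0 τ : ℝ) : ℝ := wi (fun y => W1 vx t0 x0 τ y ^ 2)
noncomputable def Lam (v vx : ℝ → ℝ → ℝ) (t0 x0 τ : ℝ) : ℝ := DD vx t0 x0 τ / HH v t0 x0 τ
noncomputable def gg (v vx vxx : ℝ → ℝ → ℝ) (t0 x0 τ : ℝ) : ℝ :=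
  wi (fun y => res (U v t0 x0 τ) (W1 vx t0 x0 τ) (W2 vxx t0 x0 τ) (Lam v vx t0 x0 τ) y ^ 2) / HH v t0 x0 τ
noncomputable def FF (v vx : ℝ → ℝ → ℝ) (M t0 x0 τ : ℝ) : ℝ :=
  (Lam v vx t0 x0 τ + 1) * exp (2 * M ^ 2 * exp (-τ))

lemma Sol.Hpos (S : Sol a b v vt vx vxx M) {t0 : ℝ} (x0 : ℝ) (h0 : 1 ≤ t0) {τ : ℝ} (ht : 1 < τ) :
    0 < HH v t0 x0 τ := by
  obtain ⟨x, hx⟩ := S.nz (t0 - exp (-τ)) (by linarith [(tm h0 ht).1])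
  have F := S.fn x0 h0 ht
  refine wi_pos (F.p0.pow 2) (fun y => sq_nonneg _) (y₀ := (x - x0) / exp (-τ / 2)) ?_
  apply pow_ne_zero
  unfold U
  have : x0 + exp (-τ / 2) * ((x - x0) / exp (-τ / 2)) = x := by
    have := (exp_pos (-τ / 2)).ne'
    field_simp; ring
  rwa [this]

lemma Sol.Hderiv (S : Sol a b v vt vx vxx M) {t0 : ℝ} (x0 : ℝ) (h0 : 1 ≤ t0) {τ : ℝ} (ht : 1 < τ) :
    HasDerivAt (HH v t0 x0) (2 * wi (fun y => U v t0 x0 τ y * Wt vt vx t0 x0 τ y)) τ := by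
  obtain ⟨C, hC, hb⟩ := S.unif x0 h0
  have key := hasDerivAt_integral_of_dominated_loc_of_deriv_le (μ := volume) (𝕜 := ℝ) (x₀ := τ) (s := Ioi 1)
    (F := fun τ y => U v t0 x0 τ y ^ 2 * rho y)
    (F' := fun τ y => 2 * (U v t0 x0 τ y * Wt vt vx t0 x0 τ y) * rho y)
    (bound := fun y => 2 * C ^ 2 * ((1 + y ^ 2) ^ 2 * rho y)) (Ioi_mem_nhds ht)
    (by filter_upwards [Ioi_mem_nhds ht] with s hs
        exact ((S.fn x0 h0 hs).p0.pow 2).integrable.aestronglyMeasurable)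
    ((S.fn x0 h0 ht).p0.pow 2).integrable
    ((((S.fn x0 h0 ht).p0.mul (S.pgt x0 h0 ht)).cmul 2).integrable.aestronglyMeasurable)
    (Eventually.of_forall fun y s hs => by
      obtain ⟨b1, b2, _⟩ := hb s y hs
      rw [norm_eq_abs, abs_mul, abs_mul, abs_mul, abs_of_pos (rho_pos y), abs_two]
      have : |U v t0 x0 s y| * |Wt vt vx t0 x0 s y| ≤ (C * (1 + y ^ 2)) * (C * (1 + y ^ 2)) :=
        mul_le_mul b1 b2 (abs_nonneg _) (by positivity)
      have h2 := mul_le_mul_of_nonneg_right this (rho_nonneg y)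
      calc _ = 2 * (|U v t0 x0 s y| * |Wt vt vx t0 x0 s y| * rho y) := by ring
        _ ≤ 2 * ((C * (1 + y ^ 2)) * (C * (1 + y ^ 2)) * rho y) := by linarith
        _ = _ := by ring)
    ((pw_integrable 2).const_mul _)
    (Eventually.of_forall fun y s hs => by
      have := ((S.dt x0 h0 y hs).pow 2).mul_const (rho y)
      exact this.congr_deriv (by push_cast; ring))
  have := key.2
  rw [← wi_cmul]
  exact this

lemma Sol.Ddiff (S : Sol a b v vt vx vxx M) {t0 : ℝ} (x0 : ℝ) (h0 : 1 ≤ t0) {τ σ : ℝ} (ht : 1 < τ) (hs : 1 < σ) :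
    DD vx t0 x0 σ - DD vx t0 x0 τ =
      wi (fun y => (U v t0 x0 σ y - U v t0 x0 τ y) * (AW vx vxx t0 x0 σ y + AW vx vxx t0 x0 τ y)) := by
  have F := S.fn x0 h0 ht
  have G := S.fn x0 h0 hs
  have h := wi_ibp (u := fun y => U v t0 x0 σ y - U v t0 x0 τ y) (g := fun y => W1 vx t0 x0 σ y + W1 vx t0 x0 τ y)
    (fun y => (G.d1 y).sub (F.d1 y)) (fun y => (G.d2 y).add (F.d2 y)) (G.p0.sub F.p0) (G.p1.sub F.p1)
    (G.p1.add F.p1) (G.p2.add F.p2)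
  have e1 : (fun y => (U v t0 x0 σ y - U v t0 x0 τ y) * (AW vx vxx t0 x0 σ y + AW vx vxx t0 x0 τ y)) =
    fun y => (U v t0 x0 σ y - U v t0 x0 τ y) * (y / 2 * (W1 vx t0 x0 σ y + W1 vx t0 x0 τ y) -
      (W2 vxx t0 x0 σ y + W2 vxx t0 x0 τ y)) := by
    ext y; unfold AW; ring
  rw [e1, ← h]
  unfold DD
  rw [← wi_sub (G.p1.pow 2) (F.p1.pow 2)]
  congr 1; ext y; ring

lemma Sol.Dderiv (S : Sol a b v vt vx vxx M) {t0 : ℝ} (x0 : ℝ) (h0 : 1 ≤ t0) {τ : ℝ} (ht : 1 < τ) :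
    HasDerivAt (DD vx t0 x0) (2 * wi (fun y => Wt vt vx t0 x0 τ y * AW vx vxx t0 x0 τ y)) τ := by
  obtain ⟨C, hC, hb⟩ := S.unif x0 h0
  rw [hasDerivAt_iff_tendsto_slope]
  have hF := S.fn x0 h0 ht
  have hev : ∀ᶠ σ in 𝓝[≠] τ, 1 < σ ∧ σ ≠ τ := by
    filter_upwards [self_mem_nhdsWithin, nhdsWithin_le_nhds (Ioi_mem_nhds ht)] with σ h1 h2
    exact ⟨h2, h1⟩
  have hlip : ∀ σ y, 1 < σ → |U v t0 x0 σ y - U v t0 x0 τ y| ≤ C * (1 + y ^ 2) * |σ - τ| := by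
    intro σ y hs
    exact (convex_Ioi (1:ℝ)).norm_image_sub_le_of_norm_hasDerivWithin_le (f := fun τ => U v t0 x0 τ y)
      (f' := fun τ => Wt vt vx t0 x0 τ y)
      (fun z hz => (S.dt x0 h0 y hz).hasDerivWithinAt) (fun z hz => (hb z y hz).2.1) ht hs
  have hlim := tendsto_integral_filter_of_dominated_convergence (μ := volume) (l := 𝓝[≠] τ)
    (F := fun σ y => ((σ - τ)⁻¹ * ((U v t0 x0 σ y - U v t0 x0 τ y) * (AW vx vxx t0 x0 σ y + AW vx vxx t0 x0 τ y))) * rho y)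
    (f := fun y => 2 * (Wt vt vx t0 x0 τ y * AW vx vxx t0 x0 τ y) * rho y)
    (bound := fun y => 2 * C ^ 2 * ((1 + y ^ 2) ^ 2 * rho y))
    (by filter_upwards [hev] with σ hs
        have G := S.fn x0 h0 hs.1
        exact (((G.p0.sub hF.p0).mul (G.pA.add hF.pA)).cmul _).integrable.aestronglyMeasurable)
    (by filter_upwards [hev] with σ hs
        refine Eventually.of_forall fun y => ?_
        have h1 := hlip σ y hs.1
        have h2 := (hb σ y hs.1).2.2
        have h3 := (hb τ y ht).2.2
        have hne : 0 < |σ - τ| := abs_pos.mpr (sub_ne_zero.mpr hs.2)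
        rw [norm_eq_abs, abs_mul, abs_mul, abs_mul, abs_of_pos (rho_pos y), abs_inv]
        have h4 : |AW vx vxx t0 x0 σ y + AW vx vxx t0 x0 τ y| ≤ 2 * (C * (1 + y ^ 2)) :=
          (abs_add_le _ _).trans (by linarith)
        have h5 : |U v t0 x0 σ y - U v t0 x0 τ y| * |AW vx vxx t0 x0 σ y + AW vx vxx t0 x0 τ y| ≤
          (C * (1 + y ^ 2) * |σ - τ|) * (2 * (C * (1 + y ^ 2))) := mul_le_mul h1 h4 (abs_nonneg _) (by positivity)
        have h6 := mul_le_mul_of_nonneg_left h5 (inv_nonneg.mpr hne.le)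
        have h7 := mul_le_mul_of_nonneg_right h6 (rho_nonneg y)
        refine h7.trans (le_of_eq ?_)
        field_simp)
    ((pw_integrable 2).const_mul _)
    (Eventually.of_forall fun y => by
      have h1 := hasDerivAt_iff_tendsto_slope.mp (S.dt x0 h0 y ht)
      have h2 : ContinuousAt (fun σ => AW vx vxx t0 x0 σ y) τ := by
        unfold AW W1 W2
        have c1 := U_cont_t S.xC x0 y h0 ht
        have c2 := U_cont_t S.xxC x0 y h0 ht
        have c3 : ContinuousAt (fun σ : ℝ => exp (-σ / 2)) τ := by fun_prop
        have c4 : ContinuousAt (fun σ : ℝ => exp (-σ)) τ := by fun_prop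
        exact (continuousAt_const.mul (c3.mul c1)).sub (c4.mul c2)
      have h3 : Tendsto (fun σ => AW vx vxx t0 x0 σ y) (𝓝[≠] τ) (𝓝 (AW vx vxx t0 x0 τ y)) :=
        h2.tendsto.mono_left nhdsWithin_le_nhds
      have h4 := (h1.mul (h3.add_const (AW vx vxx t0 x0 τ y))).mul_const (rho y)
      have e : (2 * (Wt vt vx t0 x0 τ y * AW vx vxx t0 x0 τ y) * rho y) =
        (Wt vt vx t0 x0 τ y * (AW vx vxx t0 x0 τ y + AW vx vxx t0 x0 τ y)) * rho y := by ring
      rw [e]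
      refine h4.congr fun σ => ?_
      rw [slope_def_field]; ring)
  rw [← wi_cmul]
  refine (hlim.congr' ?_)
  filter_upwards [hev] with σ hs
  rw [slope_def_field, S.Ddiff x0 h0 ht hs.1, div_eq_inv_mul, ← wi_cmul]
  rfl

lemma Sol.fn_facts (S : Sol a b v vt vx vxx M) {t0 : ℝ} (x0 : ℝ) (h0 : 1 ≤ t0) {τ : ℝ} (ht : 1 < τ) :
    (|wi (fun y => ff vt vx vxx t0 x0 τ y * U v t0 x0 τ y)| ≤ M * exp (-τ / 2) * (DD vx t0 x0 τ + 2 * HH v t0 x0 τ)) ∧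
    wi (fun y => ff vt vx vxx t0 x0 τ y ^ 2) ≤ 2 * M ^ 2 * exp (-τ) * (DD vx t0 x0 τ + HH v t0 x0 τ) := by
  have F := S.fn x0 h0 ht
  have pf := S.pff x0 h0 ht
  have hM := S.M0
  have hr0 := exp_pos (-τ / 2)
  have hr := r_le ht
  have hb := fun y => S.ff_bd x0 h0 y ht
  simp only [← sq_r τ] at hb ⊢
  set r := exp (-τ / 2)
  have hrr : r ^ 2 ≤ r := by nlinarith
  constructor
  · refine (wi_abs (pf.mul F.p0)).trans ?_
    have : wi (fun y => |ff vt vx vxx t0 x0 τ y * U v t0 x0 τ y|) ≤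
      wi (fun y => M * r * (W1 vx t0 x0 τ y ^ 2 + 2 * U v t0 x0 τ y ^ 2)) := by
      apply wi_mono (pf.mul F.p0).abs (((F.p1.pow 2).add ((F.p0.pow 2).cmul 2)).cmul _)
      intro y
      rw [abs_mul, ← sq_abs (W1 vx t0 x0 τ y), ← sq_abs (U v t0 x0 τ y)]
      have h1 := hb y
      set p := |W1 vx t0 x0 τ y|
      set q := |U v t0 x0 τ y|
      have hp : 0 ≤ p := abs_nonneg _
      have hq : 0 ≤ q := abs_nonneg _
      calc _ ≤ M * (r * p + r ^ 2 * q) * q := mul_le_mul_of_nonneg_right h1 hq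
        _ ≤ M * (r * p + r * q) * q := by gcongr
        _ = M * r * ((p + q) * q) := by ring
        _ ≤ _ := by gcongr; nlinarith [sq_nonneg (p - q)]
    rwa [wi_cmul, wi_add (F.p1.pow 2) ((F.p0.pow 2).cmul 2), wi_cmul] at this
  · have : wi (fun y => ff vt vx vxx t0 x0 τ y ^ 2) ≤
      wi (fun y => 2 * M ^ 2 * r ^ 2 * (W1 vx t0 x0 τ y ^ 2 + U v t0 x0 τ y ^ 2)) := by
      apply wi_mono (pf.pow 2) (((F.p1.pow 2).add (F.p0.pow 2)).cmul _)
      intro y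
      rw [← sq_abs (W1 vx t0 x0 τ y), ← sq_abs (U v t0 x0 τ y), ← sq_abs (ff vt vx vxx t0 x0 τ y)]
      have h1 := hb y
      set p := |W1 vx t0 x0 τ y|
      set q := |U v t0 x0 τ y|
      have hp : 0 ≤ p := abs_nonneg _
      have hq : 0 ≤ q := abs_nonneg _
      calc _ ≤ (M * (r * p + r ^ 2 * q)) ^ 2 := pow_le_pow_left₀ (abs_nonneg _) h1 2
        _ ≤ (M * (r * p + r * q)) ^ 2 := by gcongr
        _ = M ^ 2 * r ^ 2 * (p + q) ^ 2 := by ring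
        _ ≤ M ^ 2 * r ^ 2 * (2 * (p ^ 2 + q ^ 2)) := by gcongr; nlinarith [sq_nonneg (p - q)]
        _ = _ := by ring
    rwa [wi_cmul, wi_add (F.p1.pow 2) (F.p0.pow 2)] at this

lemma Sol.Lam_nonneg (S : Sol a b v vt vx vxx M) {t0 : ℝ} (x0 : ℝ) (h0 : 1 ≤ t0) {τ : ℝ} (ht : 1 < τ) :
    0 ≤ Lam v vx t0 x0 τ := div_nonneg (wi_nonneg fun y => sq_nonneg _) (S.Hpos x0 h0 ht).le

lemma Sol.gg_nonneg (S : Sol a b v vt vx vxx M) {t0 : ℝ} (x0 : ℝ) (h0 : 1 ≤ t0) {τ : ℝ} (ht : 1 < τ) :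
    0 ≤ gg v vx vxx t0 x0 τ := div_nonneg (wi_nonneg fun y => sq_nonneg _) (S.Hpos x0 h0 ht).le

/-- derivative of H in frequency form -/
lemma Sol.Hderiv' (S : Sol a b v vt vx vxx M) {t0 : ℝ} (x0 : ℝ) (h0 : 1 ≤ t0) {τ : ℝ} (ht : 1 < τ) :
    ∃ H', HasDerivAt (HH v t0 x0) H' τ ∧
     -(2 * Lam v vx t0 x0 τ + 2 * (M * exp (-τ / 2)) * (Lam v vx t0 x0 τ + 2)) * HH v t0 x0 τ ≤ H' ∧
     H' = -2 * DD vx t0 x0 τ + 2 * wi (fun y => ff vt vx vxx t0 x0 τ y * U v t0 x0 τ y) := by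
  have F := S.fn x0 h0 ht
  have pf := S.pff x0 h0 ht
  have h := S.Hderiv x0 h0 ht
  have hH := S.Hpos x0 h0 ht
  have e : wi (fun y => U v t0 x0 τ y * Wt vt vx t0 x0 τ y) = - DD vx t0 x0 τ +
      wi (fun y => ff vt vx vxx t0 x0 τ y * U v t0 x0 τ y) := by
    have h1 : (fun y => U v t0 x0 τ y * Wt vt vx t0 x0 τ y) = fun y =>
      ff vt vx vxx t0 x0 τ y * U v t0 x0 τ y - U v t0 x0 τ y * (y / 2 * W1 vx t0 x0 τ y - W2 vxx t0 x0 τ y) := by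
      ext y; unfold ff AW; ring
    rw [h1, wi_sub (pf.mul F.p0) (F.p0.mul F.pA), ← F.DA]
    unfold DD; ring
  rw [e] at h
  refine ⟨_, h, ?_, by ring⟩
  have hf := (abs_le.mp (S.fn_facts x0 h0 ht).1).1
  have hD : DD vx t0 x0 τ = Lam v vx t0 x0 τ * HH v t0 x0 τ := by unfold Lam; field_simp
  rw [hD] at hf ⊢
  linarith

set_option maxHeartbeats 1000000 in
lemma Sol.Fderiv (S : Sol a b v vt vx vxx M) {t0 : ℝ} (x0 : ℝ) (h0 : 1 ≤ t0) {τ : ℝ} (ht : 1 < τ) :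
    ∃ F', HasDerivAt (FF v vx M t0 x0) F' τ ∧ F' ≤ - gg v vx vxx t0 x0 τ := by
  have F := S.fn x0 h0 ht
  have pf := S.pff x0 h0 ht
  have hH := S.Hpos x0 h0 ht
  obtain ⟨H', dH, _, eH⟩ := S.Hderiv' x0 h0 ht
  have dD := S.Dderiv x0 h0 ht
  have dL := dD.div dH hH.ne'
  have dE : HasDerivAt (fun τ => exp (2 * M ^ 2 * exp (-τ))) (exp (2 * M ^ 2 * exp (-τ)) * (2 * M ^ 2 * (- exp (-τ)))) τ := by
    have := (((hasDerivAt_neg τ).exp).const_mul (2 * M ^ 2)).exp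
    exact this.congr_deriv (by ring)
  have dF := (dL.add_const 1).mul dE
  refine ⟨_, dF, ?_⟩
  have hff := (S.fn_facts x0 h0 ht).2
  set H := HH v t0 x0 τ with hHd
  set D := DD vx t0 x0 τ with hDd
  set L := Lam v vx t0 x0 τ with hLd
  have hD : D = L * H := by rw [hLd]; unfold Lam; rw [← hHd, ← hDd]; field_simp
  have hDL : D / H = L := by rw [hD]; field_simp
  set e := res (U v t0 x0 τ) (W1 vx t0 x0 τ) (W2 vxx t0 x0 τ) L with he
  have pe : PG e := F.pres L
  have heA : ∀ y, AW vx vxx t0 x0 τ y = e y + L * U v t0 x0 τ y := by intro y; simp only [he, res, AW]; ring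
  set fW := wi (fun y => ff vt vx vxx t0 x0 τ y * U v t0 x0 τ y) with hfW
  set fe := wi (fun y => ff vt vx vxx t0 x0 τ y * e y) with hfe
  set ee := wi (fun y => e y ^ 2) with hee
  have heW : wi (fun y => e y * U v t0 x0 τ y) = 0 := by
    have h1 : (fun y => e y * U v t0 x0 τ y) = fun y => U v t0 x0 τ y * (y / 2 * W1 vx t0 x0 τ y - W2 vxx t0 x0 τ y)
      - L * U v t0 x0 τ y ^ 2 := by ext y; simp only [he, res]; ring
    rw [h1, wi_sub (F.p0.mul F.pA) ((F.p0.pow 2).cmul L), wi_cmul, ← F.DA]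
    have : wi (fun y => W1 vx t0 x0 τ y ^ 2) = D := rfl
    have h3 : wi (fun y => U v t0 x0 τ y ^ 2) = H := rfl
    rw [this, h3, hD]; ring
  have hWA : wi (fun y => Wt vt vx t0 x0 τ y * AW vx vxx t0 x0 τ y) = fe + L * fW - ee - L ^ 2 * H := by
    have h1 : (fun y => Wt vt vx t0 x0 τ y * AW vx vxx t0 x0 τ y) = fun y =>
      ((ff vt vx vxx t0 x0 τ y * e y + L * (ff vt vx vxx t0 x0 τ y * U v t0 x0 τ y)) -
        (e y ^ 2 + (2 * L) * (e y * U v t0 x0 τ y))) - L ^ 2 * U v t0 x0 τ y ^ 2 := by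
      ext y
      have h2 : Wt vt vx t0 x0 τ y = ff vt vx vxx t0 x0 τ y - AW vx vxx t0 x0 τ y := by unfold ff; ring
      rw [h2, heA]; ring
    rw [h1, wi_sub (((pf.mul pe).add ((pf.mul F.p0).cmul L)).sub ((pe.pow 2).add ((pe.mul F.p0).cmul _))) ((F.p0.pow 2).cmul _),
      wi_sub ((pf.mul pe).add ((pf.mul F.p0).cmul L)) ((pe.pow 2).add ((pe.mul F.p0).cmul _)),
      wi_add (pf.mul pe) ((pf.mul F.p0).cmul L), wi_add (pe.pow 2) ((pe.mul F.p0).cmul _), wi_cmul, wi_cmul, wi_cmul, heW]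
    have h3 : wi (fun y => U v t0 x0 τ y ^ 2) = H := rfl
    rw [h3]; ring
  have hfe2 : 2 * fe ≤ wi (fun y => ff vt vx vxx t0 x0 τ y ^ 2) + ee := by
    rw [hfe, hee, ← wi_add (pf.pow 2) (pe.pow 2), ← wi_cmul]
    apply wi_mono ((pf.mul pe).cmul 2) ((pf.pow 2).add (pe.pow 2))
    intro y; nlinarith [sq_nonneg (ff vt vx vxx t0 x0 τ y - e y)]
  have hgg : gg v vx vxx t0 x0 τ = ee / H := rfl
  have hee0 : 0 ≤ ee := wi_nonneg fun y => sq_nonneg _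
  have hDL' : (DD vx t0 x0 / HH v t0 x0) τ = L := rfl
  rw [hgg, hWA, eH, hDL']
  set X := exp (2 * M ^ 2 * exp (-τ)) with hX
  have hX1 : 1 ≤ X := one_le_exp (by positivity)
  have e1 : (2 * (fe + L * fW - ee - L ^ 2 * H) * H - D * (-2 * D + 2 * fW)) / H ^ 2 = (2 * fe - 2 * ee) / H := by
    rw [hD]; field_simp; ring
  have e2 : ((2 * (fe + L * fW - ee - L ^ 2 * H) * H - D * (-2 * D + 2 * fW)) / H ^ 2) * X + (L + 1) * (X * (2 * M ^ 2 * -exp (-τ)))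
     = X * ((2 * fe - 2 * ee) / H - 2 * M ^ 2 * exp (-τ) * (L + 1)) := by rw [e1]; ring
  have e3 : (2 * fe - 2 * ee) / H - 2 * M ^ 2 * exp (-τ) * (L + 1) ≤ - (ee / H) := by
    have : 2 * M ^ 2 * exp (-τ) * (L + 1) = (2 * M ^ 2 * exp (-τ) * (D + H)) / H := by rw [hD]; field_simp
    rw [this, ← sub_div, ← neg_div]
    gcongr
    linarith
  have e4 : X * -(ee / H) ≤ -(ee / H) := by
    have : 0 ≤ ee / H := by positivity
    nlinarith
  refine le_trans (le_of_eq ?_) ((mul_le_mul_of_nonneg_left e3 (by linarith : 0 ≤ X)).trans e4)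
  rw [← e2]

/-- normalisation -/
lemma Sol.norm (S : Sol a b v vt vx vxx M) {t0 : ℝ} (x0 : ℝ) (h0 : 1 ≤ t0) {τ : ℝ} (ht : 1 < τ) :
    ∃ w w1 w2 : ℝ → ℝ, ∃ h : ℝ, Fn w w1 w2 ∧ 0 < h ∧ (∀ y, w y = h * U v t0 x0 τ y) ∧
      (∀ y, w1 y = h * W1 vx t0 x0 τ y) ∧ wi (fun y => w y ^ 2) = 1 ∧
      wi (fun y => w1 y ^ 2) = Lam v vx t0 x0 τ ∧
      wi (fun y => res w w1 w2 (wi (fun y => w1 y ^ 2)) y ^ 2) = gg v vx vxx t0 x0 τ := by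
  have F := S.fn x0 h0 ht
  have hH := S.Hpos x0 h0 ht
  set H := HH v t0 x0 τ with hHd
  have hs : (1 / √H) ^ 2 = 1 / H := by rw [div_pow, one_pow, sq_sqrt hH.le]
  set h := 1 / √H with hh
  have hw1 : wi (fun y => (h * W1 vx t0 x0 τ y) ^ 2) = Lam v vx t0 x0 τ := by
    have : (fun y => (h * W1 vx t0 x0 τ y) ^ 2) = fun y => 1 / H * W1 vx t0 x0 τ y ^ 2 := by
      ext y; rw [mul_pow, hs]
    rw [this, wi_cmul]; unfold Lam DD; ring
  refine ⟨fun y => h * U v t0 x0 τ y, fun y => h * W1 vx t0 x0 τ y, fun y => h * W2 vxx t0 x0 τ y, h,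
    ⟨fun y => (F.d1 y).const_mul h, fun y => (F.d2 y).const_mul h, F.p0.cmul h, F.p1.cmul h, F.p2.cmul h⟩,
    by positivity, fun y => rfl, fun y => rfl, ?_, hw1, ?_⟩
  · have : (fun y => (h * U v t0 x0 τ y) ^ 2) = fun y => 1 / H * U v t0 x0 τ y ^ 2 := by
      ext y; rw [mul_pow, hs]
    have h3 : wi (fun y => U v t0 x0 τ y ^ 2) = H := rfl
    rw [this, wi_cmul, h3]; field_simp
  · rw [hw1]
    have : (fun y => res (fun y => h * U v t0 x0 τ y) (fun y => h * W1 vx t0 x0 τ y) (fun y => h * W2 vxx t0 x0 τ y)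
        (Lam v vx t0 x0 τ) y ^ 2) = fun y => 1 / H * res (U v t0 x0 τ) (W1 vx t0 x0 τ) (W2 vxx t0 x0 τ) (Lam v vx t0 x0 τ) y ^ 2 := by
      ext y; rw [← hs]; unfold res; ring
    rw [this, wi_cmul]; unfold gg; rw [← hHd]; ring

end ZN

namespace ZN
open MeasureTheory Filter Topology
variable {a b v vt vx vxx : ℝ → ℝ → ℝ} {M : ℝ}

lemma Sol.Fanti (S : Sol a b v vt vx vxx M) {t0 : ℝ} (x0 : ℝ) (h0 : 1 ≤ t0) :
    AntitoneOn (FF v vx M t0 x0) (Ioi 1) := by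
  apply antitoneOn_of_deriv_nonpos (convex_Ioi 1)
  · intro τ hτ; obtain ⟨F', h, _⟩ := S.Fderiv x0 h0 hτ; exact h.continuousAt.continuousWithinAt
  · intro τ hτ; rw [interior_Ioi] at hτ
    obtain ⟨F', h, _⟩ := S.Fderiv x0 h0 hτ; exact h.differentiableAt.differentiableWithinAt
  · intro τ hτ; rw [interior_Ioi] at hτ
    obtain ⟨F', h, h2⟩ := S.Fderiv x0 h0 hτ; rw [h.deriv]; linarith [S.gg_nonneg x0 h0 hτ]

lemma Sol.Lam_le (S : Sol a b v vt vx vxx M) {t0 : ℝ} (x0 : ℝ) (h0 : 1 ≤ t0) {τ : ℝ} (ht : 1 < τ) :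
    Lam v vx t0 x0 τ + 1 ≤ FF v vx M t0 x0 τ := by
  unfold FF
  have : 1 ≤ exp (2 * M ^ 2 * exp (-τ)) := one_le_exp (by positivity)
  nlinarith [S.Lam_nonneg x0 h0 ht]

lemma tau2 (M : ℝ) : ∃ τ2 : ℝ, 2 ≤ τ2 ∧ ∀ τ, τ2 ≤ τ → exp (2 * M ^ 2 * exp (-τ)) ≤ 1.02 ∧ M * exp (-τ / 2) ≤ 0.01 := by
  have h1 : Tendsto (fun τ : ℝ => exp (2 * M ^ 2 * exp (-τ))) atTop (𝓝 (exp (2 * M ^ 2 * 0))) :=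
    (continuous_exp.tendsto _).comp ((tendsto_exp_neg_atTop_nhds_zero).const_mul _)
  have h2 : Tendsto (fun τ : ℝ => M * exp (-τ / 2)) atTop (𝓝 (M * 0)) := by
    apply Tendsto.const_mul
    have : Tendsto (fun τ : ℝ => τ / 2) atTop atTop := tendsto_id.atTop_div_const (by norm_num)
    have := tendsto_exp_neg_atTop_nhds_zero.comp this
    refine this.congr fun τ => ?_
    simp only [Function.comp]; congr 1; ring
  simp only [mul_zero, exp_zero] at h1 h2
  have h3 := h1.eventually (Iic_mem_nhds (show (1:ℝ) < 1.02 by norm_num))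
  have h4 := h2.eventually (Iic_mem_nhds (show (0:ℝ) < 0.01 by norm_num))
  obtain ⟨T, hT⟩ := eventually_atTop.mp (h3.and h4)
  exact ⟨max T 2, le_max_right _ _, fun τ hτ => hT τ (le_trans (le_max_left _ _) hτ)⟩

lemma Sol.low (S : Sol a b v vt vx vxx M) {t0 : ℝ} (x0 : ℝ) (h0 : 1 ≤ t0) {L0 k C : ℝ}
    (hL3 : L0 ≤ 3 / 4) (hk : 2 * L0 + 0.2 < k) (hH : ∀ τ, 1 < τ → HH v t0 x0 τ ≤ C * exp (-(k * τ)))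
    {τ2 : ℝ} (h2 : 2 ≤ τ2) (hτ2 : ∀ τ, τ2 ≤ τ → exp (2 * M ^ 2 * exp (-τ)) ≤ 1.02 ∧ M * exp (-τ / 2) ≤ 0.01)
    {s : ℝ} (hs : τ2 ≤ s) : L0 ≤ Lam v vx t0 x0 s := by
  by_contra! hlt
  have hs1 : 1 < s := by linarith
  have hM := S.M0
  have hL00 : 0 < L0 := lt_of_le_of_lt (S.Lam_nonneg x0 h0 hs1) hlt
  have hLs : FF v vx M t0 x0 s ≤ L0 + 1.05 := by
    unfold FF
    have h3 := (hτ2 s hs).1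
    have h4 := S.Lam_nonneg x0 h0 hs1
    have h5 := exp_pos (2 * M ^ 2 * exp (-s))
    calc _ ≤ (L0 + 1) * 1.02 := mul_le_mul (by linarith) h3 h5.le (by linarith)
      _ ≤ _ := by norm_num; linarith
  have hL : ∀ τ, s ≤ τ → Lam v vx t0 x0 τ ≤ L0 + 0.05 := by
    intro τ hτ
    have h3 := S.Lam_le x0 h0 (show 1 < τ by linarith)
    have h4 := S.Fanti x0 h0 (show s ∈ Ioi 1 from hs1) (show τ ∈ Ioi 1 from by simp; linarith) hτ
    norm_num at hLs ⊢; linarith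
  set c := 2 * L0 + 0.2 with hc
  have hd : ∀ τ, s ≤ τ → ∃ d, HasDerivAt (fun τ => HH v t0 x0 τ * exp (c * τ)) d τ ∧ 0 ≤ d := by
    intro τ hτ
    have hτ1 : 1 < τ := by linarith
    obtain ⟨H', dH, hle, _⟩ := S.Hderiv' x0 h0 hτ1
    have dE : HasDerivAt (fun τ => exp (c * τ)) (exp (c * τ) * c) τ := by
      have := ((hasDerivAt_id τ).const_mul c).exp
      simpa using this
    refine ⟨_, dH.mul dE, ?_⟩
    have hHp := S.Hpos x0 h0 hτ1
    have hLn := S.Lam_nonneg x0 h0 hτ1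
    have hLu := hL τ hτ
    have hMu := (hτ2 τ (by linarith)).2
    have hMn : 0 ≤ M * exp (-τ / 2) := by positivity
    have h5 : 2 * Lam v vx t0 x0 τ + 2 * (M * exp (-τ / 2)) * (Lam v vx t0 x0 τ + 2) ≤ c := by
      have : (M * exp (-τ / 2)) * (Lam v vx t0 x0 τ + 2) ≤ 0.01 * (L0 + 0.05 + 2) := by
        apply mul_le_mul hMu (by linarith) (by linarith) (by norm_num)
      norm_num at this hLu
      rw [hc]; norm_num; linarith
    have h6 : -c * HH v t0 x0 τ ≤ H' := by nlinarith
    have h7 := exp_pos (c * τ)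
    nlinarith
  have hmono : ∀ τ, s ≤ τ → HH v t0 x0 s * exp (c * s) ≤ HH v t0 x0 τ * exp (c * τ) := by
    have : MonotoneOn (fun τ => HH v t0 x0 τ * exp (c * τ)) (Ici s) := by
      apply monotoneOn_of_deriv_nonneg (convex_Ici s)
      · intro τ hτ; obtain ⟨d, h, _⟩ := hd τ hτ; exact h.continuousAt.continuousWithinAt
      · intro τ hτ; rw [interior_Ici] at hτ
        obtain ⟨d, h, _⟩ := hd τ (le_of_lt hτ); exact h.differentiableAt.differentiableWithinAt
      · intro τ hτ; rw [interior_Ici] at hτ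
        obtain ⟨d, h, h2⟩ := hd τ (le_of_lt hτ); rw [h.deriv]; exact h2
    exact fun τ hτ => this (self_mem_Ici) hτ hτ
  have hlim : Tendsto (fun τ : ℝ => C * exp (-((k - c) * τ))) atTop (𝓝 (C * 0)) := by
    apply Tendsto.const_mul
    exact tendsto_exp_neg_atTop_nhds_zero.comp (tendsto_id.const_mul_atTop (by linarith))
  rw [mul_zero] at hlim
  have hpos : 0 < HH v t0 x0 s * exp (c * s) := mul_pos (S.Hpos x0 h0 hs1) (exp_pos _)
  obtain ⟨τ, hτ1, hτ2⟩ := ((hlim.eventually (Iio_mem_nhds hpos)).and (eventually_ge_atTop s)).exists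
  have h8 := hmono τ hτ2
  have h9 := mul_le_mul_of_nonneg_right (hH τ (by linarith)) (exp_pos (c * τ)).le
  have e : C * exp (-(k * τ)) * exp (c * τ) = C * exp (-((k - c) * τ)) := by
    rw [mul_assoc, ← exp_add]; congr 2; ring
  rw [e] at h9
  have : C * exp (-((k - c) * τ)) < HH v t0 x0 s * exp (c * s) := hτ1
  linarith

lemma lip_of_deriv {f f' : ℝ → ℝ} {s : Set ℝ} (hs : Convex ℝ s) {C : ℝ} (h : ∀ x ∈ s, HasDerivAt f (f' x) x)
    (hb : ∀ x ∈ s, |f' x| ≤ C) {x y : ℝ} (hx : x ∈ s) (hy : y ∈ s) : |f y - f x| ≤ C * |y - x| :=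
  hs.norm_image_sub_le_of_norm_hasDerivWithin_le (fun z hz => (h z hz).hasDerivWithinAt) hb hx hy

lemma Sol.vlip_t (S : Sol a b v vt vx vxx M) {t0 C : ℝ}
    (hC : ∀ t x, 1 / 2 ≤ t → t ≤ t0 →
    |v t x| ≤ C ∧ |vt t x| ≤ C ∧ |vx t x| ≤ C ∧ |vxx t x| ≤ C) {t : ℝ} (x : ℝ) (h1 : 1 / 2 ≤ t) (h2 : t ≤ t0) :
    |v t x - v t0 x| ≤ C * |t - t0| := by
  apply lip_of_deriv (convex_Icc (1/2) t0) (f := fun t => v t x) (f' := fun t => vt t x)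
    (fun s hs => S.ht s x (by linarith [hs.1])) (fun s hs => (hC s x hs.1 hs.2).2.1) ⟨by linarith, le_rfl⟩ ⟨h1, h2⟩

lemma HH_bd {t0 x0 τ K : ℝ} (hp : PG (U v t0 x0 τ)) (_hK : 0 ≤ K)
    (h : ∀ y, |U v t0 x0 τ y| ≤ K * (1 + y ^ 2)) :
    HH v t0 x0 τ ≤ K ^ 2 * wi (fun y => (1 + y ^ 2) ^ 2) := by
  unfold HH
  rw [← wi_cmul]
  apply wi_mono (hp.pow 2) ((((PG.const 1).add (PG.id.pow 2)).pow 2).cmul _)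
  intro y
  rw [← sq_abs, ← mul_pow]
  exact pow_le_pow_left₀ (abs_nonneg _) (h y) 2

lemma Sol.low1 (S : Sol a b v vt vx vxx M) {t0 x0 : ℝ} (h0 : 1 ≤ t0) (hz : v t0 x0 = 0)
    {τ2 : ℝ} (h2 : 2 ≤ τ2) (hτ2 : ∀ τ, τ2 ≤ τ → exp (2 * M ^ 2 * exp (-τ)) ≤ 1.02 ∧ M * exp (-τ / 2) ≤ 0.01)
    {s : ℝ} (hs : τ2 ≤ s) : 1 / 4 ≤ Lam v vx t0 x0 s := by
  obtain ⟨C, hC0, hC⟩ := S.bdd (t1 := 1 / 2) t0 (by norm_num)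
  refine S.low x0 h0 (L0 := 1 / 4) (k := 1) (C := (2 * C) ^ 2 * wi (fun y => (1 + y ^ 2) ^ 2)) (by norm_num)
    (by norm_num) ?_ h2 hτ2 hs
  intro τ hτ
  have ht := tm h0 hτ
  have hr0 := exp_pos (-τ / 2)
  have hr1 := r_le hτ
  have hsr : exp (-τ) ≤ exp (-τ / 2) := exp_le_exp.mpr (by linarith)
  have := HH_bd (v := v) (t0 := t0) (x0 := x0) (τ := τ) (K := 2 * C * exp (-τ / 2)) (S.PGs x0 h0 hτ).1 (by positivity) (by
    intro y
    unfold U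
    have e1 := S.vlip_t hC (x0 + exp (-τ / 2) * y) ht.1 ht.2
    have e2 := lip_of_deriv convex_univ (f := fun x => v t0 x) (f' := fun x => vx t0 x)
      (fun z _ => S.hx t0 z (by linarith)) (fun z _ => (hC t0 z (by linarith) le_rfl).2.2.1)
      (mem_univ x0) (mem_univ (x0 + exp (-τ / 2) * y))
    rw [hz, sub_zero] at e2
    have e3 : |x0 + exp (-τ / 2) * y - x0| = exp (-τ / 2) * |y| := by
      rw [add_sub_cancel_left, abs_mul, abs_of_pos hr0]
    have e4 : |t0 - exp (-τ) - t0| = exp (-τ) := by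
      rw [sub_sub_cancel_left, abs_neg, abs_of_pos (exp_pos _)]
    rw [e3] at e2; rw [e4] at e1
    have e5 : |v (t0 - exp (-τ)) (x0 + exp (-τ / 2) * y)| ≤ C * exp (-τ) + C * (exp (-τ / 2) * |y|) := by
      have := abs_add_le (v (t0 - exp (-τ)) (x0 + exp (-τ / 2) * y) - v t0 (x0 + exp (-τ / 2) * y)) (v t0 (x0 + exp (-τ / 2) * y))
      rw [sub_add_cancel] at this; linarith
    have e6 : |y| ≤ 1 + y ^ 2 := by rw [← sq_abs]; nlinarith [sq_nonneg (|y| - 1), abs_nonneg y]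
    calc _ ≤ _ := e5
      _ ≤ C * exp (-τ / 2) + C * (exp (-τ / 2) * (1 + y ^ 2)) := by gcongr
      _ ≤ _ := by
        have : 0 ≤ C * exp (-τ / 2) * y ^ 2 := by positivity
        linarith)
  refine this.trans (le_of_eq ?_)
  rw [mul_pow, sq_r, one_mul]; ring

lemma Sol.low2 (S : Sol a b v vt vx vxx M) {t0 x0 : ℝ} (h0 : 1 ≤ t0) (hz : v t0 x0 = 0) (hz' : vx t0 x0 = 0)
    {τ2 : ℝ} (h2 : 2 ≤ τ2) (hτ2 : ∀ τ, τ2 ≤ τ → exp (2 * M ^ 2 * exp (-τ)) ≤ 1.02 ∧ M * exp (-τ / 2) ≤ 0.01)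
    {s : ℝ} (hs : τ2 ≤ s) : 3 / 4 ≤ Lam v vx t0 x0 s := by
  obtain ⟨C, hC0, hC⟩ := S.bdd (t1 := 1 / 2) t0 (by norm_num)
  refine S.low x0 h0 (L0 := 3 / 4) (k := 2) (C := C ^ 2 * wi (fun y => (1 + y ^ 2) ^ 2)) (by norm_num)
    (by norm_num) ?_ h2 hτ2 hs
  intro τ hτ
  have ht := tm h0 hτ
  have hr0 := exp_pos (-τ / 2)
  have := HH_bd (v := v) (t0 := t0) (x0 := x0) (τ := τ) (K := C * exp (-τ)) (S.PGs x0 h0 hτ).1 (by positivity) (by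
    intro y
    unfold U
    have e1 := S.vlip_t hC (x0 + exp (-τ / 2) * y) ht.1 ht.2
    set z := x0 + exp (-τ / 2) * y with hzd
    have e3 : |z - x0| = exp (-τ / 2) * |y| := by
      rw [hzd, add_sub_cancel_left, abs_mul, abs_of_pos hr0]
    have e2 : |v t0 z| ≤ C * |z - x0| * |z - x0| := by
      have := lip_of_deriv (convex_closedBall x0 |z - x0|) (f := fun x => v t0 x) (f' := fun x => vx t0 x) (C := C * |z - x0|)
        (fun z _ => S.hx t0 z (by linarith)) (fun u hu => by
          have := lip_of_deriv convex_univ (f := fun x => vx t0 x) (f' := fun x => vxx t0 x)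
            (fun z _ => S.hxx t0 z (by linarith)) (fun z _ => (hC t0 z (by linarith) le_rfl).2.2.2)
            (mem_univ x0) (mem_univ u)
          rw [hz', sub_zero] at this
          refine this.trans ?_
          have hu2 : |u - x0| ≤ |z - x0| := by simpa [Real.dist_eq] using hu
          gcongr)
        (show x0 ∈ Metric.closedBall x0 |z - x0| by simp) (show z ∈ Metric.closedBall x0 |z - x0| by simp [Real.dist_eq])
      rwa [hz, sub_zero] at this
    have e4 : |t0 - exp (-τ) - t0| = exp (-τ) := by
      rw [sub_sub_cancel_left, abs_neg, abs_of_pos (exp_pos _)]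
    rw [e3] at e2; rw [e4] at e1
    have e5 := abs_add_le (v (t0 - exp (-τ)) z - v t0 z) (v t0 z)
    rw [sub_add_cancel] at e5
    have e6 : C * (exp (-τ / 2) * |y|) * (exp (-τ / 2) * |y|) = C * exp (-τ) * y ^ 2 := by
      rw [← sq_r, ← sq_abs y]; ring
    linarith)
  refine this.trans (le_of_eq ?_)
  have : exp (-(2 * τ)) = exp (-τ) ^ 2 := by rw [← exp_nat_mul]; congr 1; push_cast; ring
  rw [this]; ring

end ZN

namespace ZN
open MeasureTheory Filter Topology
variable {a b v vt vx vxx : ℝ → ℝ → ℝ} {M : ℝ}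

/-- `m` sign changes of `u` inside `[α, β]`. -/
def AltL (u : ℝ → ℝ) (α β : ℝ) (m : ℕ) : Prop :=
  ∃ x : ℕ → ℝ, α ≤ x 0 ∧ x m ≤ β ∧ ∀ i < m, x i < x (i+1) ∧ u (x i) * u (x (i+1)) < 0

lemma AltL.mono {u : ℝ → ℝ} {α β α' β' : ℝ} {m : ℕ} (h : AltL u α β m) (h1 : α' ≤ α) (h2 : β ≤ β') :
    AltL u α' β' m := by
  obtain ⟨x, h3, h4, h5⟩ := h
  exact ⟨x, by linarith, by linarith, h5⟩

lemma AltL.one {u : ℝ → ℝ} {α β y1 y2 : ℝ} (h1 : α ≤ y1) (h : y1 < y2) (h2 : y2 ≤ β) (h3 : u y1 * u y2 < 0) :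
    AltL u α β 1 := by
  refine ⟨fun i => if i = 0 then y1 else y2, by simpa, by simpa, ?_⟩
  intro i hi
  obtain rfl : i = 0 := by omega
  simpa using ⟨h, h3⟩

lemma AltL.two {u : ℝ → ℝ} {α β y1 y2 y3 : ℝ} (h1 : α ≤ y1) (h : y1 < y2) (h' : y2 < y3) (h2 : y3 ≤ β)
    (h3 : u y1 * u y2 < 0) (h4 : u y2 * u y3 < 0) : AltL u α β 2 := by
  refine ⟨fun i => if i = 0 then y1 else if i = 1 then y2 else y3, by simpa, by simpa, ?_⟩
  intro i hi
  interval_cases i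
  · simpa using ⟨h, h3⟩
  · simpa using ⟨h', h4⟩

lemma AltL.le {u : ℝ → ℝ} {x : ℕ → ℝ} {m : ℕ} (h : ∀ i < m, x i < x (i+1) ∧ u (x i) * u (x (i+1)) < 0) {i : ℕ} (hi : i ≤ m) :
    x i ≤ x m := by
  induction m with
  | zero => obtain rfl : i = 0 := by omega
            rfl
  | succ k ih =>
    rcases Nat.lt_or_ge i (k+1) with h1 | h1
    · exact (ih (fun j hj => h j (by omega)) (by omega)).trans (h k (by omega)).1.le
    · obtain rfl : i = k + 1 := by omega
      rfl

lemma AltL.concat {u : ℝ → ℝ} {α β γ δ : ℝ} {m k : ℕ} (h1 : AltL u α β m) (h2 : AltL u γ δ k) (hβ : β < γ)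
    (hk : 1 ≤ k) : AltL u α δ (m + k) := by
  rcases Nat.eq_zero_or_pos m with rfl | hm
  · obtain ⟨x, a1, a2, -⟩ := h1
    rw [zero_add]; exact h2.mono (by linarith) le_rfl
  obtain ⟨x, a1, a2, a3⟩ := h1
  obtain ⟨y, b1, b2, b3⟩ := h2
  have hxy : x m < y 0 := by linarith
  have hxm := (a3 (m-1) (by omega)); rw [show m - 1 + 1 = m by omega] at hxm
  have hy0 := (b3 0 hk).2
  have hne1 : u (x m) ≠ 0 := by intro h; rw [h] at hxm; simp at hxm
  have hne2 : u (y 0) ≠ 0 := by intro h; rw [h] at hy0; simp at hy0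
  rcases lt_or_gt_of_ne (mul_ne_zero hne1 hne2) with hs | hs
  · refine ⟨fun i => if i ≤ m then x i else y (i - m - 1), by simpa, ?_, ?_⟩
    · have : ¬ (m + k ≤ m) := by omega
      simp only [this, if_false]
      exact (AltL.le b3 (by omega)).trans b2
    · intro i hi
      rcases lt_trichotomy i m with h | h | h
      · simp only [show i ≤ m by omega, show i + 1 ≤ m by omega, if_true]; exact a3 i h
      · subst h
        simp only [le_refl, if_true, show ¬ (i + 1 ≤ i) by omega, if_false]
        rw [show i + 1 - i - 1 = 0 by omega]; exact ⟨hxy, hs⟩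
      · simp only [show ¬ (i ≤ m) by omega, show ¬ (i + 1 ≤ m) by omega, if_false]
        rw [show i + 1 - m - 1 = (i - m - 1) + 1 by omega]; exact b3 _ (by omega)
  · refine ⟨fun i => if i < m then x i else y (i - m), by simpa [hm], ?_, ?_⟩
    · have : ¬ (m + k < m) := by omega
      simp only [this, if_false]
      rw [show m + k - m = k by omega]; exact b2
    · intro i hi
      rcases lt_trichotomy (i+1) m with h | h | h
      · simp only [show i < m by omega, show i + 1 < m by omega, if_true]; exact a3 i (by omega)
      · subst h
        simp only [lt_add_iff_pos_right, zero_lt_one, if_true, lt_irrefl, if_false, Nat.sub_self]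
        obtain ⟨c1, c2⟩ := a3 i (by omega)
        refine ⟨by linarith, ?_⟩
        by_contra! hc
        have := mul_nonneg hc hs.le
        have h6 : 0 < u (y 0) ^ 2 := by positivity
        nlinarith
      · simp only [show ¬ (i < m) by omega, show ¬ (i + 1 < m) by omega, if_false]
        rw [show i + 1 - m = (i - m) + 1 by omega]; exact b3 _ (by omega)

lemma AltL.finset {u : ℝ → ℝ} {r α : ℝ} (hr : 0 < r) (c : ℝ → ℕ) (F : Finset ℝ) :
    ∀ β, α ≤ β → (∀ p ∈ F, AltL u (p - r) (p + r) (c p) ∧ 1 ≤ c p ∧ α ≤ p - 2 * r ∧ p + r ≤ β) →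
    (∀ p ∈ F, ∀ q ∈ F, p < q → p + 3 * r ≤ q) → AltL u α β (∑ p ∈ F, c p) := by
  induction F using Finset.induction_on_max with
  | empty => intro β h _ _; exact ⟨fun _ => α, le_rfl, h, by simp⟩
  | insert q s hq ih =>
    intro β hβ h1 h2
    have hqs : q ∉ s := fun h => lt_irrefl _ (hq q h)
    obtain ⟨c1, c2, c3, c4⟩ := h1 q (Finset.mem_insert_self _ _)
    rw [Finset.sum_insert hqs, add_comm]
    have := ih (q - 2 * r) c3 (fun p hp => by
      obtain ⟨d1, d2, d3, d4⟩ := h1 p (Finset.mem_insert_of_mem hp)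
      refine ⟨d1, d2, d3, ?_⟩
      have := h2 p (Finset.mem_insert_of_mem hp) q (Finset.mem_insert_self _ _) (hq p hp)
      linarith) (fun p hp p' hp' => h2 p (Finset.mem_insert_of_mem hp) p' (Finset.mem_insert_of_mem hp'))
    exact (this.concat c1 (by linarith) c2).mono le_rfl c4

/-- `2n` cyclic sign alternations. -/
def Alt (u : ℝ → ℝ) (n : ℕ) : Prop :=
  ∃ (x : ℕ → ℝ) (σ : ℝ), σ ≠ 0 ∧ (∀ i, i + 1 < 2 * n → x i < x (i+1)) ∧ x (2 * n - 1) < x 0 + 2 * π ∧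
    ∀ i < 2 * n, 0 < σ * (-1) ^ i * u (x i)

lemma AltL.alt {u : ℝ → ℝ} {α β : ℝ} {m n : ℕ} (h : AltL u α β m) (hβ : β < α + 2 * π) (hn : 1 ≤ n)
    (hm : 2 * n - 1 ≤ m) : Alt u n := by
  obtain ⟨x, h1, h2, h3⟩ := h
  have hx0 : u (x 0) ≠ 0 := by
    intro h; have := (h3 0 (by omega)).2; rw [h] at this; simp at this
  refine ⟨x, u (x 0), hx0, fun i hi => (h3 i (by omega)).1, ?_, ?_⟩
  · have := AltL.le h3 hm; linarith
  · intro i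
    induction i with
    | zero => intro _; simp only [pow_zero, mul_one]; exact mul_self_pos.mpr hx0
    | succ i ih =>
      intro hi
      have h4 := ih (by omega)
      have h5 := (h3 i (by omega)).2
      rw [pow_succ]
      by_contra! hc
      have hne : u (x i) ≠ 0 := by intro h; rw [h] at h5; simp at h5
      have h6 : 0 < u (x i) ^ 2 := by positivity
      have h7 : 0 ≤ u (x 0) * (-1) ^ i * u (x (i+1)) := by linarith
      have h8 := mul_nonneg h4.le h7
      have h9 : (u (x 0) * (-1) ^ i) ^ 2 = u (x 0) ^ 2 := by
        rw [mul_pow, ← pow_mul, mul_comm i 2, pow_mul]; simp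
      have h10 : 0 < u (x 0) ^ 2 := by positivity
      have h11 : u (x 0) * (-1) ^ i * u (x i) * (u (x 0) * (-1) ^ i * u (x (i + 1)))
        = u (x 0) ^ 2 * (u (x i) * u (x (i+1))) := by rw [← h9]; ring
      rw [h11] at h8
      nlinarith

lemma mvt_good {Φ G : ℝ → ℝ} {p q : ℝ} (hpq : p < q)
    (h : ∀ τ ∈ Icc p q, ∃ F', HasDerivAt Φ F' τ ∧ F' ≤ - G τ) :
    ∃ c ∈ Ioo p q, G c * (q - p) ≤ Φ p - Φ q := by
  have hd : ∀ τ ∈ Icc p q, HasDerivAt Φ (deriv Φ τ) τ := by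
    intro τ hτ; obtain ⟨F', h1, _⟩ := h τ hτ; exact h1.differentiableAt.hasDerivAt
  obtain ⟨c, hc, hc2⟩ := exists_hasDerivAt_eq_slope Φ (deriv Φ) hpq
    (fun τ hτ => (hd τ hτ).continuousAt.continuousWithinAt) (fun τ hτ => hd τ (Ioo_subset_Icc_self hτ))
  refine ⟨c, hc, ?_⟩
  obtain ⟨F', h1, h2⟩ := h c (Ioo_subset_Icc_self hc)
  rw [h1.deriv] at hc2
  have hqp : 0 < q - p := by linarith
  rw [eq_div_iff hqp.ne'] at hc2
  nlinarith

lemma Sol.sc (S : Sol a b v vt vx vxx M) (K : ℝ) (hK : 0 ≤ K) : ∃ R η : ℝ, 0 < R ∧ 0 < η ∧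
    ∀ t0 x0 τ, 1 ≤ t0 → 1 < τ → Lam v vx t0 x0 τ ≤ K → gg v vx vxx t0 x0 τ ≤ η ^ 2 →
    (1 / 4 ≤ Lam v vx t0 x0 τ → AltL (v (t0 - exp (-τ))) (x0 - R * exp (-τ/2)) (x0 + R * exp (-τ/2)) 1) ∧
    (3 / 4 ≤ Lam v vx t0 x0 τ → AltL (v (t0 - exp (-τ))) (x0 - R * exp (-τ/2)) (x0 + R * exp (-τ/2)) 2) := by
  obtain ⟨R1, η1, hR1, hη1, H1⟩ := SC1 K hK
  obtain ⟨R2, η2, hR2, hη2, H2⟩ := SC2 K hK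
  refine ⟨max R1 R2, min η1 η2, lt_max_of_lt_left hR1, lt_min hη1 hη2, ?_⟩
  intro t0 x0 τ h0 ht hL hg
  obtain ⟨w, w1, w2, h, hF, hh, hw, hw1, e1, e2, e3⟩ := S.norm x0 h0 ht
  have hm : 0 < min η1 η2 := lt_min hη1 hη2
  have g1 : gg v vx vxx t0 x0 τ ≤ η1 ^ 2 := hg.trans (pow_le_pow_left₀ hm.le (min_le_left _ _) 2)
  have g2 : gg v vx vxx t0 x0 τ ≤ η2 ^ 2 := hg.trans (pow_le_pow_left₀ hm.le (min_le_right _ _) 2)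
  have he := exp_pos (-τ/2)
  have conv : ∀ y y', w y * w y' < 0 → v (t0 - exp (-τ)) (x0 + exp (-τ/2) * y) * v (t0 - exp (-τ)) (x0 + exp (-τ/2) * y') < 0 := by
    intro y y' hy
    rw [hw, hw] at hy
    unfold U at hy
    by_contra! hc
    have := mul_nonneg (mul_pos hh hh).le hc
    linarith
  constructor
  · intro h4
    obtain ⟨y1, y2, c1, c2, c3, c4⟩ := H1 w w1 w2 hF e1 (by rw [e2]; exact hL) (by rw [e2]; exact h4) (by rw [e3]; exact g1)
    have hm := le_max_left R1 R2
    refine AltL.one (y1 := x0 + exp (-τ/2) * y1) (y2 := x0 + exp (-τ/2) * y2) ?_ ?_ ?_ (conv _ _ c4) <;> nlinarith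
  · intro h4
    obtain ⟨y1, y2, y3, c1, c2, c2', c3, c4, c5⟩ := H2 w w1 w2 hF e1 (by rw [e2]; exact hL) (by rw [e2]; exact h4) (by rw [e3]; exact g2)
    have hm := le_max_right R1 R2
    refine AltL.two (y1 := x0 + exp (-τ/2) * y1) (y2 := x0 + exp (-τ/2) * y2) (y3 := x0 + exp (-τ/2) * y3) ?_ ?_ ?_ ?_ (conv _ _ c4) (conv _ _ c5) <;> nlinarith

lemma Sol.FF_pos (S : Sol a b v vt vx vxx M) {t0 : ℝ} (x0 : ℝ) (h0 : 1 ≤ t0) {τ : ℝ} (ht : 1 < τ) :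
    0 < FF v vx M t0 x0 τ := by
  linarith [S.Lam_le x0 h0 ht, S.Lam_nonneg x0 h0 ht]

lemma Sol.good (S : Sol a b v vt vx vxx M) {t0 : ℝ} (h0 : 1 ≤ t0) (F : Finset ℝ) {η : ℝ} (hη : 0 < η) {T : ℝ} (hT : 1 < T) :
    ∃ τ, T < τ ∧ ∀ p ∈ F, gg v vx vxx t0 p τ ≤ η := by
  set Φ : ℝ → ℝ := fun τ => ∑ p ∈ F, FF v vx M t0 p τ with hΦ
  set G : ℝ → ℝ := fun τ => ∑ p ∈ F, gg v vx vxx t0 p τ with hG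
  have hΦ0 : ∀ τ, 1 < τ → 0 ≤ Φ τ := fun τ hτ => Finset.sum_nonneg fun p _ => (S.FF_pos p h0 hτ).le
  have hl : 0 < Φ T / η + 1 := by have := hΦ0 T hT; positivity
  obtain ⟨c, hc, hc2⟩ := mvt_good (Φ := Φ) (G := G) (p := T) (q := T + (Φ T / η + 1)) (by linarith) (by
    intro τ hτ
    have hτ1 : 1 < τ := lt_of_lt_of_le hT hτ.1
    choose F' h1 h2 using fun p : ℝ => S.Fderiv p h0 hτ1
    refine ⟨∑ p ∈ F, F' p, HasDerivAt.fun_sum fun p _ => h1 p, ?_⟩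
    rw [hG]; simp only; rw [← Finset.sum_neg_distrib]
    exact Finset.sum_le_sum fun p _ => h2 p)
  refine ⟨c, hc.1, fun p hp => ?_⟩
  have hc1 : 1 < c := hT.trans hc.1
  have h3 : gg v vx vxx t0 p c ≤ G c :=
    Finset.single_le_sum (f := fun p => gg v vx vxx t0 p c) (fun p _ => S.gg_nonneg p h0 hc1) hp
  refine h3.trans ?_
  by_contra! hlt
  have h4 := hΦ0 (T + (Φ T / η + 1)) (by linarith)
  have h5 : η * (Φ T / η + 1) = Φ T + η := by field_simp
  have h6 := mul_lt_mul_of_pos_right hlt hl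
  rw [h5] at h6
  rw [add_sub_cancel_left] at hc2
  linarith

/-- Zeros give sign changes slightly earlier. -/
lemma Sol.alts (S : Sol a b v vt vx vxx M) {t0 : ℝ} (h0 : 1 ≤ t0) (F : Finset ℝ) (c : ℝ → ℕ)
    (hF : ∀ p ∈ F, 0 ≤ p ∧ p < 2 * π ∧ v t0 p = 0 ∧ (c p = 1 ∨ c p = 2 ∧ vx t0 p = 0)) {ε : ℝ} (hε : 0 < ε) :
    ∃ t, t0 - ε < t ∧ t < t0 ∧ ∃ α β, β < α + 2 * π ∧ AltL (v t) α β (∑ p ∈ F, c p) := by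
  obtain ⟨τ2, h2, hτ2⟩ := tau2 M
  set K := ∑ p ∈ F, FF v vx M t0 p 2 with hK
  have hK0 : 0 ≤ K := Finset.sum_nonneg fun p _ => (S.FF_pos p h0 (by norm_num)).le
  obtain ⟨R, η, hR, hη, H⟩ := S.sc K hK0
  have hr : ∀ᶠ r in 𝓝[>] (0:ℝ), 3 * r < 2 * π ∧ (∀ p ∈ F, p + 4 * r < 2 * π) ∧ ∀ p ∈ F, ∀ q ∈ F, p < q → p + 3 * r < q := by
    have key : ∀ x y k : ℝ, x < y → ∀ᶠ r in 𝓝[>] (0:ℝ), x + k * r < y := by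
      intro x y k hxy
      have : Tendsto (fun r : ℝ => x + k * r) (𝓝[>] 0) (𝓝 (x + k * 0)) :=
        ((by fun_prop : Continuous fun r : ℝ => x + k * r).tendsto 0).mono_left nhdsWithin_le_nhds
      exact this.eventually (Iio_mem_nhds (by linarith))
    refine ((key 0 (2*π) 3 (by positivity)).mono fun r h => by linarith).and (Filter.Eventually.and ?_ ?_)
    · rw [Filter.eventually_all_finset]; intro p hp; exact key _ _ _ (hF p hp).2.1
    · rw [Filter.eventually_all_finset]; intro p hp
      rw [Filter.eventually_all_finset]; intro q hq
      by_cases hpq : p < q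
      · exact (key _ _ _ hpq).mono fun r h _ => h
      · exact Eventually.of_forall fun r h => absurd h hpq
  obtain ⟨r, ⟨hr1, hr2, hr3⟩, hr0⟩ := (hr.and self_mem_nhdsWithin).exists
  replace hr0 : 0 < r := hr0
  have hT : ∀ᶠ τ : ℝ in atTop, exp (-τ) < ε ∧ R * exp (-τ/2) < r ∧ τ2 ≤ τ := by
    have e1 := tendsto_exp_neg_atTop_nhds_zero.eventually (Iio_mem_nhds hε)
    have e2 : Tendsto (fun τ : ℝ => R * exp (-τ/2)) atTop (𝓝 (R * 0)) := by
      apply Tendsto.const_mul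
      have : Tendsto (fun τ : ℝ => τ / 2) atTop atTop := tendsto_id.atTop_div_const (by norm_num)
      refine (tendsto_exp_neg_atTop_nhds_zero.comp this).congr fun τ => ?_
      simp only [Function.comp]; congr 1; ring
    have e3 := e2.eventually (Iio_mem_nhds (show R * 0 < r by simpa))
    exact e1.and (e3.and (eventually_ge_atTop τ2))
  obtain ⟨T, hT⟩ := eventually_atTop.mp hT
  obtain ⟨τ, hτ, hg⟩ := S.good h0 F (η := η ^ 2) (by positivity) (T := max T 2) (lt_max_of_lt_right (by norm_num))
  obtain ⟨q1, q2, q3⟩ := hT τ ((le_max_left _ _).trans hτ.le)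
  have hτ2' : 2 < τ := (le_max_right _ _).trans_lt hτ
  refine ⟨t0 - exp (-τ), by linarith, by linarith [exp_pos (-τ)], -2 * r, 2 * π - 3 * r, by linarith, ?_⟩
  refine AltL.finset hr0 c F _ (by linarith) ?_ (fun p hp q hq h => (hr3 p hp q hq h).le)
  intro p hp
  obtain ⟨f1, f2, f3, f4⟩ := hF p hp
  have hLK : Lam v vx t0 p τ ≤ K := by
    have g1 := S.Lam_le p h0 (show 1 < τ by linarith)
    have g2 := S.Fanti p h0 (show (2:ℝ) ∈ Ioi 1 by norm_num) (show τ ∈ Ioi 1 by simp; linarith) hτ2'.le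
    have g3 : FF v vx M t0 p 2 ≤ K := Finset.single_le_sum (f := fun p => FF v vx M t0 p 2)
      (fun p _ => (S.FF_pos p h0 (by norm_num)).le) hp
    linarith
  obtain ⟨s1, s2⟩ := H t0 p τ h0 (by linarith) hLK (hg p hp)
  have hr4 := hr2 p hp
  refine ⟨?_, by omega, by linarith, by linarith⟩
  rcases f4 with f4 | ⟨f4, f5⟩
  · rw [f4]; exact (s1 (S.low1 h0 f3 h2 hτ2 q3)).mono (by linarith) (by linarith)
  · rw [f4]; exact (s2 (S.low2 h0 f3 f5 h2 hτ2 q3)).mono (by linarith) (by linarith)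

end ZN

namespace ZN
open MeasureTheory Filter Topology
variable {a b v vt vx vxx : ℝ → ℝ → ℝ} {M : ℝ}

lemma per_unif {f : ℝ → ℝ → ℝ} (h : ContinuousOn (fun p : ℝ × ℝ => f p.1 p.2) (Set.Ioi 0 ×ˢ Set.univ))
    (hp : ∀ t x, 0 < t → f t (x + 2 * π) = f t x) {t1 t2 : ℝ} (h1 : 0 < t1) {ω : ℝ} (hω : 0 < ω) :
    ∃ δ : ℝ, 0 < δ ∧ ∀ t t' x x', t1 ≤ t → t ≤ t2 → t1 ≤ t' → t' ≤ t2 → |t - t'| < δ → |x - x'| < δ →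
      |f t x - f t' x'| ≤ ω := by
  have hK : IsCompact (Icc t1 t2 ×ˢ Icc (-1:ℝ) (2 * π + 1)) := isCompact_Icc.prod isCompact_Icc
  have hu := hK.uniformContinuousOn_of_continuous (h.mono (fun p hp => ⟨lt_of_lt_of_le h1 hp.1.1, mem_univ _⟩))
  obtain ⟨δ, hδ, H⟩ := Metric.uniformContinuousOn_iff.mp hu ω hω
  refine ⟨min δ 1, lt_min hδ one_pos, ?_⟩
  intro t t' x x' a1 a2 a3 a4 a5 a6
  have hper : Function.Periodic (f t) (2 * π) := fun x => hp t x (by linarith)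
  have hper' : Function.Periodic (f t') (2 * π) := fun x => hp t' x (by linarith)
  have hπ : 0 < 2 * π := by positivity
  set n := ⌊x / (2 * π)⌋
  have e1 : (n:ℝ) * (2 * π) ≤ x := by rw [← le_div_iff₀ hπ]; exact Int.floor_le _
  have e2 : x < ((n:ℝ) + 1) * (2 * π) := by rw [← div_lt_iff₀ hπ]; exact Int.lt_floor_add_one _
  rw [← hper.sub_int_mul_eq n, ← hper'.sub_int_mul_eq n]
  have b1 := lt_min_iff.mp a5
  have b2 := lt_min_iff.mp a6
  have b3 := abs_lt.mp b2.2
  have := H (t, x - n * (2 * π)) ⟨⟨a1, a2⟩, ⟨by simp only; linarith, by simp only; linarith⟩⟩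
    (t', x' - n * (2 * π)) ⟨⟨a3, a4⟩, ⟨by simp only; linarith, by simp only; linarith⟩⟩ (by
      rw [Prod.dist_eq, max_lt_iff, Real.dist_eq, Real.dist_eq]
      refine ⟨b1.1, ?_⟩
      simp only [sub_sub_sub_cancel_right]; exact b2.1)
  rw [Real.dist_eq] at this
  exact this.le

/-- the explicit scheme -/
noncomputable def Sop (a b : ℝ → ℝ → ℝ) (h t : ℝ) (f : ℝ → ℝ) (x : ℝ) : ℝ :=
  (1 + h ^ 2 / 4 * b t x) * (f x / 2 + (f (x + h) + f (x - h)) / 4 + a t x * h / 8 * (f (x + h) - f (x - h)))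

lemma cons_alg {h κ ω M C A B v0 v1 vp vm ut ux uxx : ℝ} (hh : 0 < h) (hM : 0 ≤ M) (hC0 : 0 ≤ C) (hκ0 : 0 < κ) (hκ1 : 8 * κ ≤ 1)
    (hκ2 : κ * (1 + 8 + M) ≤ ω / 2) (k4 : h < 1) (k5 : h < ω / (2 * (M * (C + 1 + M * (C + 1)) + 1)))
    (E1 : |v1 - v0 - h ^ 2 / 4 * ut| ≤ κ * (h ^ 2 / 4)) (E2 : |vp + vm - 2 * v0 - h ^ 2 * uxx| ≤ κ * 2 * h ^ 2)
    (E3 : |vp - vm - 2 * h * ux| ≤ κ * (2 * h)) (heq : ut = uxx + A * ux + B * v0) (hat : |A| ≤ M) (hbt : |B| ≤ M)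
    (c3 : |ux| ≤ C) (c4 : |uxx| ≤ C) :
    |v1 - (1 + h ^ 2 / 4 * B) * (v0 / 2 + (vp + vm) / 4 + A * h / 8 * (vp - vm))| ≤ ω * (h ^ 2 / 4) := by
  obtain ⟨e1, he1⟩ : ∃ e1, e1 = v1 - v0 - h ^ 2 / 4 * ut := ⟨_, rfl⟩
  obtain ⟨e2, he2⟩ : ∃ e2, e2 = vp + vm - 2 * v0 - h ^ 2 * uxx := ⟨_, rfl⟩
  obtain ⟨e3, he3⟩ : ∃ e3, e3 = vp - vm - 2 * h * ux := ⟨_, rfl⟩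
  rw [← he1] at E1
  rw [← he2] at E2
  rw [← he3] at E3
  obtain ⟨d, hd⟩ : ∃ d, d = h ^ 2 / 4 := ⟨_, rfl⟩
  obtain ⟨D, hD⟩ : ∃ D, D = M * (C + 1 + M * (C + 1)) := ⟨_, rfl⟩
  have hD0 : 0 ≤ D := by rw [hD]; positivity
  rw [← hD] at k5
  have hd0 : 0 < d := by rw [hd]; positivity
  have hdh : d < h := by rw [hd]; nlinarith
  obtain ⟨Q, hQ⟩ : ∃ Q, Q = d * uxx + e2 / 4 + A * (d * ux + h * e3 / 8) := ⟨_, rfl⟩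
  have key : v1 - (1 + h ^ 2 / 4 * B) * (v0 / 2 + (vp + vm) / 4 + A * h / 8 * (vp - vm)) = e1 - e2 / 4 - A * (h * e3 / 8) - d * B * Q := by
    rw [hQ, he1, he2, he3, heq, hd]; ring
  rw [key]
  have hhd : h ^ 2 = 4 * d := by rw [hd]; ring
  rw [← hd] at E1 ⊢
  have hhe3 : |h * e3 / 8| ≤ κ * d := by
    rw [abs_div, abs_mul, abs_of_pos hh]; simp only [Nat.abs_ofNat]
    have y1 := mul_le_mul_of_nonneg_left E3 hh.le
    have y2 : h * (κ * (2 * h)) = 8 * (κ * d) := by rw [hd]; ring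
    linarith
  have he2' : |e2 / 4| ≤ κ * 2 * d := by
    rw [abs_div]; simp only [Nat.abs_ofNat]
    rw [hhd] at E2
    linarith
  have hAe : |A * (h * e3 / 8)| ≤ M * (κ * d) := by
    rw [abs_mul]; exact mul_le_mul hat hhe3 (abs_nonneg _) hM
  have hκd2 : κ * 2 * d ≤ 1 * d := mul_le_mul_of_nonneg_right (show κ*2≤1 by linarith) hd0.le
  have hκd0 : 0 < κ * d := mul_pos hκ0 hd0
  have hκd : κ * d ≤ d := by linarith
  have hQb : |Q| ≤ d * (C + 1 + M * (C + 1)) := by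
    have q1 : |d * uxx| ≤ d * C := by rw [abs_mul, abs_of_pos hd0]; gcongr
    have q2 : |d * ux| ≤ d * C := by rw [abs_mul, abs_of_pos hd0]; gcongr
    have q3 : |d * ux + h * e3 / 8| ≤ d * C + d := (abs_add_le _ _).trans (by linarith)
    have q4 : |A * (d * ux + h * e3 / 8)| ≤ M * (d * C + d) := by
      rw [abs_mul]; exact mul_le_mul hat q3 (abs_nonneg _) hM
    have q5 : |e2 / 4| ≤ d := he2'.trans (by linarith)
    rw [hQ]
    calc |d * uxx + e2 / 4 + A * (d * ux + h * e3 / 8)| ≤ |d * uxx| + |e2 / 4| + |A * (d * ux + h * e3 / 8)| := abs_add_three _ _ _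
      _ ≤ d * C + d + M * (d * C + d) := by linarith
      _ = _ := by ring
  have hBQ : |d * B * Q| ≤ d * (d * D) := by
    rw [mul_assoc, abs_mul, abs_of_pos hd0, abs_mul]
    have : |B| * |Q| ≤ M * (d * (C + 1 + M * (C + 1))) := mul_le_mul hbt hQb (abs_nonneg _) hM
    refine mul_le_mul_of_nonneg_left (this.trans (le_of_eq ?_)) hd0.le
    rw [hD]; ring
  have hdD : d * D ≤ ω / 2 := by
    rw [lt_div_iff₀ (by positivity)] at k5
    have := mul_le_mul_of_nonneg_right hdh.le hD0
    linarith
  have hfin : |e1 - e2 / 4 - A * (h * e3 / 8) - d * B * Q| ≤ |e1| + |e2/4| + |A * (h * e3 / 8)| + |d * B * Q| := by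
    refine (abs_sub _ _).trans (add_le_add_left ((abs_sub _ _).trans (add_le_add_left (abs_sub _ _) _)) _)
  have z1 := mul_le_mul_of_nonneg_right hκ2 hd0.le
  have z2 := mul_le_mul_of_nonneg_left hdD hd0.le
  linarith

lemma Sol.consist (S : Sol a b v vt vx vxx M) {t1 t2 : ℝ} (h1 : 0 < t1) {ω : ℝ} (hω : 0 < ω) :
    ∃ h0 : ℝ, 0 < h0 ∧ ∀ h, 0 < h → h < h0 → ∀ t x, t1 ≤ t → t + h ^ 2 / 4 ≤ t2 →
      |v (t + h ^ 2 / 4) x - Sop a b h t (v t) x| ≤ ω * (h ^ 2 / 4) := by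
  obtain ⟨C, hC0, hC⟩ := S.bdd t2 h1
  have hM := S.M0
  set D := M * (C + 1 + M * (C + 1)) with hD
  have hD0 : 0 ≤ D := by positivity
  set κ := min (ω / (2 * (3 + 8 + M))) 1 / 8 with hκ
  have hκ0 : 0 < κ := by positivity
  have hκ1 : 8 * κ ≤ 1 := by have := min_le_right (ω / (2 * (3 + 8 + M))) 1; rw [hκ]; linarith
  have hκ2 : κ * (1 + 8 + M) ≤ ω / 2 := by
    have h2 : κ ≤ ω / (2 * (3 + 8 + M)) := by
      have := min_le_left (ω / (2 * (3 + 8 + M))) 1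
      have h3 : 0 < ω / (2 * (3 + 8 + M)) := by positivity
      have : 8 * κ ≤ ω / (2 * (3 + 8 + M)) := by rw [hκ]; linarith
      linarith
    rw [le_div_iff₀ (by positivity)] at h2
    nlinarith
  obtain ⟨δ1, hδ1, H1⟩ := per_unif (t2 := t2) S.tC S.tP h1 hκ0
  obtain ⟨δ2, hδ2, H2⟩ := per_unif (t2 := t2) S.xC S.xP h1 hκ0
  obtain ⟨δ3, hδ3, H3⟩ := per_unif (t2 := t2) S.xxC S.xxP h1 hκ0
  set h0 := min (min δ1 (min δ2 δ3)) (min 1 (ω / (2 * (D + 1)))) with hh0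
  have hh00 : 0 < h0 := by positivity
  refine ⟨h0, hh00, ?_⟩
  intro h hh hlt t x htl htu
  have k1 : h < δ1 := hlt.trans_le ((min_le_left _ _).trans (min_le_left _ _))
  have k2 : h < δ2 := hlt.trans_le ((min_le_left _ _).trans ((min_le_right _ _).trans (min_le_left _ _)))
  have k3 : h < δ3 := hlt.trans_le ((min_le_left _ _).trans ((min_le_right _ _).trans (min_le_right _ _)))
  have k4 : h < 1 := hlt.trans_le ((min_le_right _ _).trans (min_le_left _ _))
  have k5 : h < ω / (2 * (D + 1)) := hlt.trans_le ((min_le_right _ _).trans (min_le_right _ _))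
  clear_value h0 κ
  set d := h ^ 2 / 4 with hd
  have hd0 : 0 < d := by positivity
  have hdh : d < h := by rw [hd]; nlinarith
  have ht0 : 0 < t := by linarith
  have ht2 : t ≤ t2 := by linarith
  -- time derivative
  have E1 : |v (t + d) x - v t x - d * vt t x| ≤ κ * d := by
    have := lip_of_deriv (convex_Icc t (t + d)) (f := fun s => v s x - s * vt t x) (f' := fun s => vt s x - vt t x) (C := κ)
      (fun s hs => by
        have := (S.ht s x (by linarith [hs.1])).fun_sub ((hasDerivAt_id s).mul_const (vt t x))
        simpa using this)
      (fun s hs => H1 s t x x (by linarith [hs.1]) (by linarith [hs.2]) htl ht2 (by rw [abs_lt]; constructor <;> linarith [hs.1, hs.2]) (by simpa))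
      (x := t) (y := t + d) ⟨le_rfl, by linarith⟩ ⟨by linarith, le_rfl⟩
    rw [add_sub_cancel_left, abs_of_pos hd0] at this
    convert this using 2; ring
  -- first derivative
  have E3 : |v t (x + h) - v t (x - h) - 2 * h * vx t x| ≤ κ * (2 * h) := by
    have := lip_of_deriv (convex_Icc (x - h) (x + h)) (f := fun s => v t s - s * vx t x) (f' := fun s => vx t s - vx t x) (C := κ)
      (fun s hs => by
        have := (S.hx t s ht0).fun_sub ((hasDerivAt_id s).mul_const (vx t x))
        simpa using this)
      (fun s hs => H2 t t s x htl ht2 htl ht2 (by simpa) (by rw [abs_lt]; constructor <;> linarith [hs.1, hs.2]))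
      (x := x - h) (y := x + h) ⟨le_rfl, by linarith⟩ ⟨by linarith, le_rfl⟩
    rw [show x + h - (x - h) = 2 * h by ring, abs_of_pos (by linarith : 0 < 2 * h)] at this
    convert this using 2; ring
  -- second derivative
  have E2 : |v t (x + h) + v t (x - h) - 2 * v t x - h ^ 2 * vxx t x| ≤ κ * 2 * h ^ 2 := by
    have A : ∀ s ∈ Icc 0 h, |vx t (x + s) - vx t (x - s) - 2 * s * vxx t x| ≤ κ * 2 * h := by
      intro s hs
      have := lip_of_deriv (convex_Icc (x - s) (x + s)) (f := fun s => vx t s - s * vxx t x) (f' := fun s => vxx t s - vxx t x) (C := κ)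
        (fun s hs => by
          have := (S.hxx t s ht0).fun_sub ((hasDerivAt_id s).mul_const (vxx t x))
          simpa using this)
        (fun s' hs' => H3 t t s' x htl ht2 htl ht2 (by simpa) (by rw [abs_lt]; constructor <;> linarith [hs.1, hs.2, hs'.1, hs'.2]))
        (x := x - s) (y := x + s) ⟨le_rfl, by linarith [hs.1]⟩ ⟨by linarith [hs.1], le_rfl⟩
      rw [show x + s - (x - s) = 2 * s by ring, abs_of_nonneg (by linarith [hs.1] : 0 ≤ 2 * s)] at this
      have h5 : κ * (2 * s) ≤ κ * 2 * h := by nlinarith [hs.2]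
      refine le_trans (le_of_eq ?_) (this.trans h5); congr 1; ring
    have := lip_of_deriv (convex_Icc 0 h) (f := fun s => v t (x + s) + v t (x - s) - s ^ 2 * vxx t x)
      (f' := fun s => vx t (x + s) - vx t (x - s) - 2 * s * vxx t x) (C := κ * 2 * h)
      (fun s hs => by
        have d1 := (S.hx t (x + s) ht0).comp_const_add x s
        have d2 := (S.hx t (x - s) ht0).comp_const_sub x s
        have d3 := ((hasDerivAt_id s).pow 2).mul_const (vxx t x)
        have := (d1.fun_add d2).fun_sub d3
        simpa [sub_eq_add_neg] using this) A (x := 0) (y := h) ⟨le_rfl, hh.le⟩ ⟨hh.le, le_rfl⟩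
    rw [sub_zero h, abs_of_pos hh] at this
    have h6 : κ * 2 * h * h = κ * 2 * h ^ 2 := by ring
    rw [h6] at this
    refine le_trans (le_of_eq ?_) this; congr 1; simp; ring
  have heq := S.eq t x ht0
  have hat := S.ha t x ht0.le
  have hbt := S.hb t x ht0.le
  obtain ⟨c1, c2, c3, c4⟩ := hC t x htl ht2
  exact cons_alg hh hM hC0 hκ0 hκ1 hκ2 k4 k5 E1 E2 E3 heq hat hbt c3 c4

lemma Sop_sub (a b : ℝ → ℝ → ℝ) (h t : ℝ) (f g : ℝ → ℝ) (x : ℝ) :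
    Sop a b h t f x - Sop a b h t g x = Sop a b h t (fun x => f x - g x) x := by unfold Sop; ring

lemma Sol.stab (S : Sol a b v vt vx vxx M) {h t : ℝ} (ht : 0 ≤ t) (hh : 0 < h) (h1 : M * h ≤ 2) 
    {f : ℝ → ℝ} {C : ℝ} (hf : ∀ x, |f x| ≤ C) (x : ℝ) : |Sop a b h t f x| ≤ (1 + M * (h ^ 2 / 4)) * C := by
  have hat := S.ha t x ht
  have hbt := S.hb t x ht
  have hM := S.M0
  have hC : 0 ≤ C := (abs_nonneg _).trans (hf 0)
  unfold Sop
  rw [abs_mul]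
  have hd : 0 < h ^ 2 / 4 := by positivity
  refine mul_le_mul ?_ ?_ (abs_nonneg _) (by positivity)
  · refine (abs_add_le _ _).trans ?_
    rw [abs_one, abs_mul, abs_of_pos hd]; nlinarith
  · have e : f x / 2 + (f (x + h) + f (x - h)) / 4 + a t x * h / 8 * (f (x + h) - f (x - h))
      = f x / 2 + (1/4 + a t x * h / 8) * f (x + h) + (1/4 - a t x * h / 8) * f (x - h) := by ring
    rw [e]
    have ha1 := abs_le.mp hat
    have p1 : 0 ≤ 1/4 + a t x * h / 8 := by nlinarith
    have p2 : 0 ≤ 1/4 - a t x * h / 8 := by nlinarith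
    have f1 := abs_le.mp (hf x)
    have f2 := abs_le.mp (hf (x+h))
    have f3 := abs_le.mp (hf (x-h))
    rw [abs_le]; constructor
    · nlinarith [mul_le_mul_of_nonneg_left f2.1 p1, mul_le_mul_of_nonneg_left f3.1 p2]
    · nlinarith [mul_le_mul_of_nonneg_left f2.2 p1, mul_le_mul_of_nonneg_left f3.2 p2]

noncomputable def uk (a b : ℝ → ℝ → ℝ) (h t1 : ℝ) (f : ℝ → ℝ) : ℕ → ℝ → ℝ
  | 0 => f
  | k + 1 => Sop a b h (t1 + k * (h ^ 2 / 4)) (uk a b h t1 f k)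

lemma Sol.uk_per (S : Sol a b v vt vx vxx M) {h t1 : ℝ} (h1 : 0 < t1) (k : ℕ) (x : ℝ) :
    uk a b h t1 (v t1) k (x + 2 * π) = uk a b h t1 (v t1) k x := by
  induction k generalizing x with
  | zero => exact S.vP t1 x h1.le
  | succ k ih =>
    simp only [uk, Sop]
    have hp : 0 ≤ t1 + k * (h ^ 2 / 4) := by positivity
    rw [S.aP _ _ hp, S.bP _ _ hp, ih, show x + 2 * π + h = (x + h) + 2 * π by ring, ih,
      show x + 2 * π - h = (x - h) + 2 * π by ring, ih]

lemma Sol.uk_err (S : Sol a b v vt vx vxx M) {h t1 t2 ω : ℝ} (ht1 : 0 < t1) (hω : 0 ≤ ω) (hh : 0 < h) (h1 : M * h ≤ 2) 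
    (hc : ∀ t x, t1 ≤ t → t + h ^ 2 / 4 ≤ t2 →
      |v (t + h ^ 2 / 4) x - Sop a b h t (v t) x| ≤ ω * (h ^ 2 / 4)) (k : ℕ) (hk : t1 + k * (h ^ 2 / 4) ≤ t2) (x : ℝ) :
    |uk a b h t1 (v t1) k x - v (t1 + k * (h ^ 2 / 4)) x| ≤ k * (h ^ 2 / 4) * ω * exp (M * (k * (h ^ 2 / 4))) := by
  induction k generalizing x with
  | zero => simp [uk]
  | succ k ih =>
    set d := h ^ 2 / 4 with hd
    have hd0 : 0 < d := by positivity
    have hM := S.M0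
    push_cast at hk ⊢
    have hk' : t1 + k * d ≤ t2 := by linarith
    have ihk := ih hk'
    have ht : 0 ≤ t1 + k * d := by positivity
    have s1 := S.stab ht hh h1 ihk x
    have s2 := hc (t1 + k * d) x (by have : 0 ≤ k * d := by positivity
                                     linarith) (by linarith)
    rw [← Sop_sub] at s1
    have hexp : 1 + M * d ≤ exp (M * d) := by linarith [Real.add_one_le_exp (M * d)]
    have hE : exp (M * ((k + 1) * d)) = exp (M * (k * d)) * exp (M * d) := by rw [← exp_add]; congr 1; ring
    have hE1 : 1 ≤ exp (M * ((k + 1) * d)) := one_le_exp (by positivity)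
    have hs3 : (1 + M * d) * (k * d * ω * exp (M * (k * d))) ≤ k * d * ω * exp (M * ((k + 1) * d)) := by
      rw [hE]
      have : 0 ≤ k * d * ω * exp (M * (k * d)) := by positivity
      nlinarith
    have hs4 : ω * d ≤ d * ω * exp (M * ((k + 1) * d)) := by
      have : 0 ≤ d * ω := by positivity
      nlinarith
    have e : uk a b h t1 (v t1) (k+1) x - v (t1 + (k + 1) * d) x =
      (Sop a b h (t1 + k * d) (uk a b h t1 (v t1) k) x - Sop a b h (t1 + k * d) (v (t1 + k * d)) x)
      - (v (t1 + k * d + d) x - Sop a b h (t1 + k * d) (v (t1 + k * d)) x) := by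
      simp only [uk]; rw [show t1 + (k + 1) * d = t1 + k * d + d by ring]; ring
    rw [e]
    refine (abs_sub _ _).trans ?_
    rw [← hd] at s1
    linarith

end ZN

namespace ZN
open MeasureTheory Filter Topology
variable {a b v vt vx vxx : ℝ → ℝ → ℝ} {M : ℝ}

def AltD (m : ℤ) (u : ℤ → ℝ) (n : ℕ) : Prop :=
  ∃ (j : ℕ → ℤ) (σ : ℝ), (∀ i, i + 1 < 2 * n → j i < j (i+1)) ∧ j (2 * n - 1) < j 0 + m ∧
    ∀ i < 2 * n, 0 < σ * (-1) ^ i * u (j i)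

lemma AltD.fwd {m : ℤ} {u u' : ℤ → ℝ} {n : ℕ} (hn : 1 ≤ n) (hp : ∀ j, u (j + m) = u j) {p q : ℤ → ℝ}
    (hp0 : ∀ j, 0 ≤ p j) (hq0 : ∀ j, 0 ≤ q j) (hu : ∀ j, u' j = p j * u j + q j * u (j + 1))
    (h : AltD m u' n) : AltD m u n := by
  obtain ⟨j, σ, h1, h2, h3⟩ := h
  have key : ∀ i, ∃ k, (k = j i ∨ k = j i + 1) ∧ (i < 2 * n → 0 < σ * (-1) ^ i * u k) := by
    intro i
    by_cases hi : i < 2 * n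
    · have := h3 i hi
      rw [hu] at this
      by_cases hc : 0 < σ * (-1) ^ i * u (j i)
      · exact ⟨j i, Or.inl rfl, fun _ => hc⟩
      · refine ⟨j i + 1, Or.inr rfl, fun _ => ?_⟩
        by_contra! hc2
        push Not at hc
        nlinarith [mul_nonneg (hp0 (j i)) (neg_nonneg.mpr hc), mul_nonneg (hq0 (j i)) (neg_nonneg.mpr hc2)]
    · exact ⟨j i, Or.inl rfl, fun h => absurd h hi⟩
  choose k hk1 hk2 using key
  refine ⟨k, σ, ?_, ?_, hk2⟩
  · intro i hi
    have h4 := h1 i hi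
    have h5 := hk1 i
    have h6 := hk1 (i+1)
    have hne : k i ≠ k (i+1) := by
      intro he
      have s1 := hk2 i (by omega)
      have s2 := hk2 (i+1) hi
      rw [← he, pow_succ] at s2
      linarith
    omega
  · have h5 := hk1 0
    have h6 := hk1 (2 * n - 1)
    have hne : k (2 * n - 1) ≠ k 0 + m := by
      intro he
      have s1 := hk2 0 (by omega)
      have s2 := hk2 (2 * n - 1) (by omega)
      rw [he, hp, Odd.neg_one_pow (by exact ⟨n - 1, by omega⟩)] at s2
      simp at s1
      linarith
    omega

lemma AltD.shift {m : ℤ} {u : ℤ → ℝ} {n : ℕ} (h : AltD m (fun j => u (j - 1)) n) : AltD m u n := by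
  obtain ⟨j, σ, h1, h2, h3⟩ := h
  exact ⟨fun i => j i - 1, σ, fun i hi => by have := h1 i hi; simp only; omega, by simp only; omega, h3⟩

lemma Sol.alt_step (S : Sol a b v vt vx vxx M) {h t : ℝ} (ht : 0 ≤ t) (hh : 0 < h) (h1 : M * h ≤ 2) (h2 : M * (h ^ 2 / 4) ≤ 1)
    {m : ℤ} {n : ℕ} (hn : 1 ≤ n) (hm : (m:ℝ) * h = 2 * π) {f : ℝ → ℝ} (hf : ∀ x, f (x + 2 * π) = f x)
    (hA : AltD m (fun j => Sop a b h t f (j * h)) n) : AltD m (fun j => f (j * h)) n := by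
  have hM := S.M0
  have hper : ∀ j : ℤ, f (((j + m : ℤ):ℝ) * h) = f (j * h) := by
    intro j; rw [← hf (j * h)]; congr 1; push_cast; linarith
  refine AltD.fwd hn hper (u' := fun j : ℤ => 1/2 * f (j * h) + 1/2 * f ((j + 1 : ℤ) * h)) (p := fun _ => 1/2) (q := fun _ => 1/2)
    (fun _ => by norm_num) (fun _ => by norm_num) (fun j => rfl) ?_
  apply AltD.shift
  have hB : ∀ j : ℤ, 0 ≤ 1 + h ^ 2 / 4 * b t (j * h) := by
    intro j
    have := abs_le.mp (S.hb t (j * h) ht)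
    have hd : 0 < h ^ 2 / 4 := by positivity
    nlinarith
  have hA1 : ∀ j : ℤ, |a t (j * h) * h| ≤ 2 := by
    intro j; rw [abs_mul, abs_of_pos hh]; have := S.ha t (j * h) ht; nlinarith
  refine AltD.fwd hn (u' := fun j => Sop a b h t f (j * h)) ?_
    (p := fun j => (1 + h ^ 2 / 4 * b t (j * h)) * (1/2 - a t (j * h) * h / 4))
    (q := fun j => (1 + h ^ 2 / 4 * b t (j * h)) * (1/2 + a t (j * h) * h / 4)) ?_ ?_ ?_ hA
  · intro j
    rw [show j + m - 1 = (j - 1) + m by ring, hper, show j - 1 + m + 1 = (j - 1 + 1) + m by ring, hper (j - 1 + 1)]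
  · intro j; have := abs_le.mp (hA1 j); exact mul_nonneg (hB j) (by linarith)
  · intro j; have := abs_le.mp (hA1 j); exact mul_nonneg (hB j) (by linarith)
  · intro j
    simp only [Sop]
    have e1 : (((j - 1 : ℤ):ℝ)) * h = j * h - h := by push_cast; ring
    have e2 : (((j - 1 + 1 : ℤ):ℝ)) * h = j * h := by push_cast; ring
    have e3 : (((j + 1 - 1 : ℤ):ℝ)) * h = j * h := by push_cast; ring
    have e4 : (((j + 1 - 1 + 1: ℤ):ℝ)) * h = j * h + h := by push_cast; ring
    rw [e1, e2, e3, e4]; ring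

lemma Sol.alt_uk (S : Sol a b v vt vx vxx M) {h t1 : ℝ} (ht : 0 < t1) (hh : 0 < h) (h1 : M * h ≤ 2) (h2 : M * (h ^ 2 / 4) ≤ 1)
    {m : ℤ} {n : ℕ} (hn : 1 ≤ n) (hm : (m:ℝ) * h = 2 * π) (k : ℕ)
    (hA : AltD m (fun j => uk a b h t1 (v t1) k (j * h)) n) : AltD m (fun j => v t1 (j * h)) n := by
  induction k with
  | zero => exact hA
  | succ k ih => exact ih (S.alt_step (by positivity) hh h1 h2 hn hm (S.uk_per ht k) hA)

/-- The number of sign changes is nonincreasing. -/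
lemma Sol.alt_mono (S : Sol a b v vt vx vxx M) {t1 t2 : ℝ} (h1 : 0 < t1) (h12 : t1 < t2) {n : ℕ} (hA : Alt (v t2) n) :
    Alt (v t1) n := by
  rcases Nat.eq_zero_or_pos n with rfl | hn
  · exact ⟨fun _ => 0, 1, one_ne_zero, by simp, by simp; positivity, by simp⟩
  obtain ⟨x, σ, hσ, A1, A2, A3⟩ := hA
  have hM := S.M0
  -- uniform positivity near the points
  have hpos : ∃ δ μ : ℝ, 0 < δ ∧ 0 < μ ∧ (∀ i < 2 * n, ∀ t y, |t - t2| < δ → |y - x i| < δ → μ < σ * (-1) ^ i * v t y) ∧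
      (∀ i, i + 1 < 2 * n → x i + δ < x (i+1)) ∧ x (2 * n - 1) + δ < x 0 + 2 * π := by
    have e1 : ∀ i < 2 * n, ∀ᶠ μ in 𝓝[>] (0:ℝ), ∀ t y, |t - t2| < μ → |y - x i| < μ → μ < σ * (-1) ^ i * v t y := by
      intro i hi
      have hc := (cAt S.vC (x i) (h1.trans h12)).const_mul (σ * (-1) ^ i)
      have hp := A3 i hi
      obtain ⟨δ, hδ, H⟩ := Metric.eventually_nhds_iff.mp (hc.eventually (Ioi_mem_nhds (show σ * (-1) ^ i * v t2 (x i) / 2 < σ * (-1) ^ i * v t2 (x i) by linarith)))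
      have hmem : Ioo 0 (min δ (σ * (-1) ^ i * v t2 (x i) / 2)) ∈ 𝓝[>] (0:ℝ) := Ioo_mem_nhdsGT (by positivity)
      filter_upwards [hmem] with μ hμ t y ht hy
      have hμ2 := lt_min_iff.mp hμ.2
      have := H (y := (t, y)) (by rw [Prod.dist_eq, max_lt_iff, Real.dist_eq, Real.dist_eq]; exact ⟨ht.trans hμ2.1, hy.trans hμ2.1⟩)
      simp only at this
      exact hμ2.2.trans this
    have key : ∀ p q : ℝ, p < q → ∀ᶠ r in 𝓝[>] (0:ℝ), p + r < q := by
      intro p q hpq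
      filter_upwards [Ioo_mem_nhdsGT (show 0 < q - p by linarith)] with r hr
      linarith [hr.2]
    have e2 : ∀ᶠ μ in 𝓝[>] (0:ℝ), ∀ i ∈ Finset.range (2 * n), ∀ t y, |t - t2| < μ → |y - x i| < μ → μ < σ * (-1) ^ i * v t y := by
      rw [Filter.eventually_all_finset]; intro i hi; exact e1 i (Finset.mem_range.mp hi)
    have e3 : ∀ᶠ μ in 𝓝[>] (0:ℝ), ∀ i ∈ Finset.range (2 * n - 1), x i + μ < x (i+1) := by
      rw [Filter.eventually_all_finset]; intro i hi; have := Finset.mem_range.mp hi; exact key _ _ (A1 i (by omega))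
    obtain ⟨μ, ⟨⟨f1, f2⟩, f3⟩, f4⟩ := (((e2.and e3).and (key _ _ A2)).and self_mem_nhdsWithin).exists
    exact ⟨μ, μ, f4, f4, fun i hi => f1 i (Finset.mem_range.mpr hi), fun i hi => f2 i (Finset.mem_range.mpr (by omega)), f3⟩
  obtain ⟨δ, μ, hδ, hμ, B1, B2, B3⟩ := hpos
  set L := t2 - t1 with hL
  have hL0 : 0 < L := by linarith
  have hσ0 : 0 < |σ| := abs_pos.mpr hσ
  set ω := μ / (|σ| * (L * exp (M * L))) with hω
  have hω0 : 0 < ω := by positivity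
  obtain ⟨h0, hh0, H⟩ := S.consist (t2 := t2) h1 hω0
  -- choose the grid
  obtain ⟨h, m, hh, hm, g1, g2, g3, g4⟩ : ∃ (h : ℝ) (m : ℤ), 0 < h ∧ (m:ℝ) * h = 2 * π ∧ h < h0 ∧ h < δ ∧ h < 1 ∧ M * h < 1 := by
    set ε := min (min h0 δ) (min 1 (1 / (M + 1))) with hε
    have hε0 : 0 < ε := by positivity
    obtain ⟨N, hN⟩ := exists_nat_gt (2 * π / ε)
    have hN0 : 0 < (N:ℝ) := lt_trans (by positivity) hN
    have hlt : 2 * π / N < ε := by rw [div_lt_iff₀ hN0]; rw [div_lt_iff₀ hε0] at hN; linarith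
    refine ⟨2 * π / N, N, by positivity, ?_, ?_, ?_, ?_, ?_⟩
    · push_cast; field_simp
    · exact hlt.trans_le ((min_le_left _ _).trans (min_le_left _ _))
    · exact hlt.trans_le ((min_le_left _ _).trans (min_le_right _ _))
    · exact hlt.trans_le ((min_le_right _ _).trans (min_le_left _ _))
    · have h5 : 2 * π / N < 1 / (M + 1) := hlt.trans_le ((min_le_right _ _).trans (min_le_right _ _))
      rw [lt_div_iff₀ (by positivity)] at h5
      have : 0 < 2 * π / N := by positivity
      linarith
  set d := h ^ 2 / 4 with hd
  have hd0 : 0 < d := by positivity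
  have hdh : d < h := by rw [hd]; nlinarith
  have hMd : M * d ≤ 1 := by nlinarith
  set k := ⌊L / d⌋₊ with hk
  have k1 : (k:ℝ) * d ≤ L := by rw [← le_div_iff₀ hd0]; exact Nat.floor_le (by positivity)
  have k2 : L < ((k:ℝ) + 1) * d := by rw [← div_lt_iff₀ hd0]; exact Nat.lt_floor_add_one _
  have herr := S.uk_err h1 hω0.le hh (by linarith) (fun t x ht1 ht2 => H h hh g1 t x ht1 ht2) k (by rw [← hd]; linarith)
  rw [← hd] at herr
  have herr2 : ∀ y, |σ| * |uk a b h t1 (v t1) k y - v (t1 + k * d) y| ≤ μ := by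
    intro y
    have r1 : k * d * ω * exp (M * (k * d)) ≤ L * ω * exp (M * L) := by
      gcongr
    have r2 : |σ| * (L * ω * exp (M * L)) = μ := by
      rw [hω]; have := exp_pos (M * L); field_simp
    rw [← r2]
    exact mul_le_mul_of_nonneg_left ((herr y).trans r1) (abs_nonneg _)
  have hfl : ∀ y : ℝ, (⌊y / h⌋ : ℝ) * h ≤ y ∧ y < ((⌊y / h⌋ : ℝ) + 1) * h := by
    intro y; constructor
    · rw [← le_div_iff₀ hh]; exact Int.floor_le _
    · rw [← div_lt_iff₀ hh]; exact Int.lt_floor_add_one _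
  have hflt : ∀ y z : ℝ, y + h < z → ⌊y / h⌋ < ⌊z / h⌋ := by
    intro y z hyz
    have z1 := hfl y
    have z2 := hfl z
    by_contra! hc
    have : (⌊z / h⌋ : ℝ) ≤ ⌊y / h⌋ := by exact_mod_cast hc
    nlinarith
  have hAD : AltD m (fun j => uk a b h t1 (v t1) k (j * h)) n := by
    refine ⟨fun i => ⌊x i / h⌋, σ, fun i hi => hflt _ _ (by linarith [B2 i hi]), ?_, ?_⟩
    · have z := hflt (x (2 * n - 1)) (x 0 + 2 * π) (by linarith)
      rw [← hm, add_div, mul_div_cancel_right₀ _ hh.ne', Int.floor_add_intCast] at z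
      exact z
    · intro i hi
      simp only
      have z1 := hfl (x i)
      set y := (⌊x i / h⌋ : ℝ) * h with hy
      have z2 := B1 i hi (t1 + k * d) y (by rw [abs_lt]; constructor <;> linarith) (by rw [abs_lt]; constructor <;> linarith)
      have z3 := herr2 y
      have z4 : |σ * (-1) ^ i * (uk a b h t1 (v t1) k y - v (t1 + k * d) y)| ≤ μ := by
        rw [abs_mul, abs_mul, abs_pow, abs_neg, abs_one, one_pow, mul_one]; exact z3
      have z5 := (abs_le.mp z4).1
      linarith
  obtain ⟨j, σ', C1, C2, C3⟩ := S.alt_uk h1 hh (by linarith) hMd hn hm k hAD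
  refine ⟨fun i => j i * h, σ', ?_, ?_, ?_, C3⟩
  · rintro rfl; have := C3 0 (by omega); simp at this
  · intro i hi
    have : (j i : ℝ) < j (i+1) := by exact_mod_cast C1 i hi
    simp only; nlinarith
  · have : (j (2 * n - 1) : ℝ) < j 0 + m := by exact_mod_cast C2
    simp only; rw [← hm]; nlinarith

end ZN

namespace ZN
open MeasureTheory Filter Topology
variable {a b v vt vx vxx : ℝ → ℝ → ℝ} {M : ℝ}

lemma Sol.cauchyF (S : Sol a b v vt vx vxx M) {t0 : ℝ} (x0 : ℝ) (h0 : 1 ≤ t0) {ε : ℝ} (hε : 0 < ε) :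
    ∃ N, 2 ≤ N ∧ ∀ p q, N ≤ p → p ≤ q → FF v vx M t0 x0 p - FF v vx M t0 x0 q ≤ ε := by
  set s := (FF v vx M t0 x0) '' (Ici 2)
  obtain ⟨_, ⟨N, hN, rfl⟩, h⟩ := Real.lt_sInf_add_pos (s := s) ⟨_, 2, mem_Ici.mpr le_rfl, rfl⟩ hε
  refine ⟨N, hN, fun p q hp hq => ?_⟩
  have hN2 : (2:ℝ) ≤ N := hN
  have h1 := S.Fanti x0 h0 (show N ∈ Ioi 1 by simp; linarith) (show p ∈ Ioi 1 by simp; linarith) hp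
  have h2 : sInf s ≤ FF v vx M t0 x0 q := by
    apply csInf_le
    · refine ⟨0, ?_⟩
      rintro _ ⟨τ, hτ, rfl⟩
      have : (2:ℝ) ≤ τ := hτ
      exact (S.FF_pos x0 h0 (by linarith)).le
    · exact ⟨q, by simp; linarith, rfl⟩
  linarith

/-- joint good time for two centres -/
lemma Sol.joint (S : Sol a b v vt vx vxx M) {t0 x0 t x p q1 q2 A κ : ℝ} (h0 : 1 ≤ t0) (h1 : 1 ≤ t)
    (hp : 2 < p) (hpq : p ≤ q1) (hq : q1 < q2) (hA : 0 < A) (hκ : ∀ q, q1 ≤ q → q ≤ q2 → κ ≤ exp (-q) / (exp (-p) + exp (-q))) :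
    ∃ q, q1 < q ∧ q < q2 ∧ (gg v vx vxx t x q + A * κ * gg v vx vxx t0 x0 (-log (exp (-p) + exp (-q)))) * (q2 - q1) ≤
      (FF v vx M t x q1 + A * FF v vx M t0 x0 (-log (exp (-p) + exp (-q1)))) -
      (FF v vx M t x q2 + A * FF v vx M t0 x0 (-log (exp (-p) + exp (-q2)))) := by
  obtain ⟨c, hc, hc2⟩ := mvt_good (Φ := fun q => FF v vx M t x q + A * FF v vx M t0 x0 (-log (exp (-p) + exp (-q))))
    (G := fun q => gg v vx vxx t x q + A * κ * gg v vx vxx t0 x0 (-log (exp (-p) + exp (-q)))) hq (by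
    intro q hqq
    have hs : 0 < exp (-p) + exp (-q) := by positivity
    have hτ0 : 1 < -log (exp (-p) + exp (-q)) := by
      have : exp (-p) + exp (-q) < exp (-1) := by
        have e1 : exp (-p) < exp (-2) := exp_lt_exp.mpr (by linarith)
        have e2 : exp (-q) < exp (-2) := exp_lt_exp.mpr (by linarith [hqq.1])
        have e3 : exp (-1 : ℝ) = exp (-2) * exp 1 := by rw [← exp_add]; norm_num
        have e4 := Real.add_one_le_exp (1:ℝ)
        nlinarith [exp_pos (-2 : ℝ)]
      have := (log_lt_iff_lt_exp hs).mpr this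
      linarith
    obtain ⟨F1, f1, f1'⟩ := S.Fderiv x h1 (show 1 < q by linarith [hqq.1])
    obtain ⟨F0, f0, f0'⟩ := S.Fderiv x0 h0 hτ0
    have d1 : HasDerivAt (fun q => -log (exp (-p) + exp (-q))) (exp (-q) / (exp (-p) + exp (-q))) q := by
      have := ((((hasDerivAt_neg q).exp).const_add (exp (-p))).log hs.ne').neg
      refine this.congr_deriv ?_
      ring
    have d2 := f0.comp q d1
    refine ⟨_, f1.add (d2.const_mul A), ?_⟩
    have hk := hκ q hqq.1 hqq.2
    have hg := S.gg_nonneg x0 h0 hτ0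
    have hd : 0 < exp (-q) / (exp (-p) + exp (-q)) := by positivity
    have z1 : F0 * (exp (-q) / (exp (-p) + exp (-q))) ≤ - (κ * gg v vx vxx t0 x0 (-log (exp (-p) + exp (-q)))) := by
      nlinarith
    have z2 := mul_le_mul_of_nonneg_left z1 hA.le
    linarith)
  exact ⟨c, hc.1, hc.2, hc2⟩

set_option maxHeartbeats 1000000 in
lemma Sol.cone (S : Sol a b v vt vx vxx M) {t0 : ℝ} (x0 : ℝ) (h0 : 1 ≤ t0) (n : ℕ) :
    ∃ δ : ℝ, 0 < δ ∧ ∀ t x, 1 ≤ t → t0 - δ < t → t < t0 → (x - x0) ^ 2 ≤ t0 - t → FF v vx M t x 2 ≤ n →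
      v t x = 0 → vx t x = 0 → False := by
  obtain ⟨τ2, hτ2, hτ2'⟩ := tau2 M
  have hK0 : 0 < FF v vx M t0 x0 2 := S.FF_pos x0 h0 (by norm_num)
  obtain ⟨η0, θ, hη0, hθ, SP⟩ := SEP (FF v vx M t0 x0 2) hK0.le
  obtain ⟨R, η1, hR, hη1, SC⟩ := S.sc n (Nat.cast_nonneg n)
  -- p0
  obtain ⟨p0, hp0, hRp, hRθ⟩ : ∃ p0 : ℝ, 0 ≤ p0 ∧ R * exp (-p0/2) ≤ 1 ∧ 2 * (R * exp (-p0/2)) ≤ θ := by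
    have e2 : Tendsto (fun τ : ℝ => R * exp (-τ/2)) atTop (𝓝 (R * 0)) := by
      apply Tendsto.const_mul
      have : Tendsto (fun τ : ℝ => τ / 2) atTop atTop := tendsto_id.atTop_div_const (by norm_num)
      refine (tendsto_exp_neg_atTop_nhds_zero.comp this).congr fun τ => ?_
      simp only [Function.comp]; congr 1; ring
    have e3 := e2.eventually (Iic_mem_nhds (show R * 0 < min 1 (θ/2) by simp; positivity))
    obtain ⟨p0, h1, h2⟩ := (e3.and (eventually_ge_atTop 0)).exists
    have h3 := le_min_iff.mp h1
    exact ⟨p0, h2, h3.1, by linarith [h3.2]⟩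
  set l := ((n:ℝ) + 1) / η1 ^ 2 with hl
  have hl0 : 0 < l := by positivity
  set κ := exp (-(p0 + l)) / 2 with hκ
  have hκ0 : 0 < κ := by positivity
  set A := η1 ^ 2 / (κ * η0 ^ 2) with hA
  have hA0 : 0 < A := by positivity
  obtain ⟨N, hN2, hN⟩ := S.cauchyF x0 h0 (ε := 1 / A) (by positivity)
  set P := max (N + 1) τ2 + 1 with hP
  refine ⟨exp (-P), exp_pos _, ?_⟩
  intro t x h1 ht1 ht2 hcone hFn hv hvx
  -- p
  obtain ⟨p, hp⟩ : ∃ p, exp (-p) = t0 - t := ⟨-log (t0 - t), by rw [neg_neg, exp_log (by linarith)]⟩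
  have hPp : P < p := by
    have : exp (-p) < exp (-P) := by linarith
    have := exp_lt_exp.mp this
    linarith
  have hpN : N + 2 < p := by have := le_max_left (N+1) τ2; linarith
  have hpτ : τ2 < p := by have := le_max_right (N+1) τ2; linarith
  have hτ0 : ∀ q, p ≤ q → N ≤ -log (exp (-p) + exp (-q)) := by
    intro q hq
    have hs : 0 < exp (-p) + exp (-q) := by positivity
    have e1 : exp (-p) < exp (-(N+2)) := exp_lt_exp.mpr (by linarith)
    have e2 : exp (-q) < exp (-(N+2)) := exp_lt_exp.mpr (by linarith)
    have e3 : exp (-(N+1)) = exp (-(N+2)) * exp 1 := by rw [← exp_add]; ring_nf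
    have e4 := Real.add_one_le_exp (1:ℝ)
    have : exp (-p) + exp (-q) < exp (-(N+1)) := by nlinarith [exp_pos (-(N+2))]
    have := (log_lt_iff_lt_exp hs).mpr this
    linarith
  have hκq : ∀ q, p + p0 ≤ q → q ≤ p + p0 + l → κ ≤ exp (-q) / (exp (-p) + exp (-q)) := by
    intro q hq1 hq2
    rw [le_div_iff₀ (by positivity), hκ]
    have e1 : exp (-q) ≤ exp (-p) := exp_le_exp.mpr (by linarith)
    have e2 : exp (-(p0 + l)) * exp (-p) ≤ exp (-q) := by rw [← exp_add]; exact exp_le_exp.mpr (by linarith)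
    have e3 := exp_pos (-(p0 + l))
    nlinarith
  obtain ⟨q, q1, q2, hq⟩ := S.joint (x0 := x0) (x := x) h0 h1 (p := p) (q1 := p + p0) (q2 := p + p0 + l) (by linarith)
    (by linarith) (by linarith) hA0 hκq
  have hFq : FF v vx M t x (p + p0) ≤ n :=
    (S.Fanti x h1 (show (2:ℝ) ∈ Ioi 1 by norm_num) (show p + p0 ∈ Ioi 1 by simp; linarith) (by linarith)).trans hFn
  have hFq2 := S.FF_pos x h1 (show 1 < p + p0 + l by linarith)
  have hmono : -log (exp (-p) + exp (-(p + p0))) ≤ -log (exp (-p) + exp (-(p + p0 + l))) := by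
    apply neg_le_neg
    apply log_le_log (by positivity)
    have : exp (-(p + p0 + l)) ≤ exp (-(p + p0)) := exp_le_exp.mpr (by linarith)
    linarith
  have hvar := hN _ _ (hτ0 (p + p0) (by linarith)) hmono
  have hvar2 := mul_le_mul_of_nonneg_left hvar hA0.le
  rw [mul_one_div_cancel hA0.ne'] at hvar2
  have hsum : (gg v vx vxx t x q + A * κ * gg v vx vxx t0 x0 (-log (exp (-p) + exp (-q)))) * l ≤ n + 1 := by
    rw [add_sub_cancel_left] at hq
    linarith
  set τ0 := -log (exp (-p) + exp (-q)) with hτ0def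
  have hτN : N ≤ τ0 := hτ0 q (by linarith)
  have hτ01 : 1 < τ0 := by linarith
  have hq1' : 1 < q := by linarith
  have hg1 := S.gg_nonneg x h1 hq1'
  have hg0 := S.gg_nonneg x0 h0 hτ01
  have hη : (n:ℝ) + 1 = η1 ^ 2 * l := by rw [hl]; field_simp
  rw [hη] at hsum
  have hsum2 := le_of_mul_le_mul_right hsum hl0
  have hAκ : A * κ * η0 ^ 2 = η1 ^ 2 := by rw [hA]; field_simp
  have hAκ0 : 0 < A * κ := by positivity
  have G1 : gg v vx vxx t x q ≤ η1 ^ 2 := by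
    have := mul_nonneg hAκ0.le hg0; linarith
  have G0 : gg v vx vxx t0 x0 τ0 ≤ η0 ^ 2 := by
    have : A * κ * gg v vx vxx t0 x0 τ0 ≤ A * κ * η0 ^ 2 := by rw [hAκ]; linarith
    exact le_of_mul_le_mul_left this hAκ0
  -- alternating triple
  have hLam1 : Lam v vx t x q ≤ n := by
    have := S.Lam_le x h1 hq1'
    have := S.Fanti x h1 (show (2:ℝ) ∈ Ioi 1 by norm_num) (show q ∈ Ioi 1 from hq1') (by linarith)
    linarith
  obtain ⟨z, z1, z2, z3⟩ := (SC t x q h1 hq1' hLam1 G1).2 (S.low2 h1 hv hvx hτ2 hτ2' (by linarith))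
  have hexpτ : exp (-τ0) = exp (-p) + exp (-q) := by
    rw [hτ0def, neg_neg, exp_log (by positivity)]
  have hT : t - exp (-q) = t0 - exp (-τ0) := by rw [hexpτ]; linarith
  have hTpos : 0 < t0 - exp (-τ0) := by linarith [(tm h0 hτ01).1]
  rw [hT] at z3
  set T := t0 - exp (-τ0) with hTdef
  have hcont : Continuous (v T) := continuous_iff_continuousAt.mpr fun y => (S.hx T y hTpos).continuousAt
  have ivt : ∀ y y', y < y' → v T y * v T y' < 0 → ∃ c, y < c ∧ c < y' ∧ v T c = 0 := by
    intro y y' hy hyy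
    have : (0:ℝ) ∈ v T '' (Ioo y y') := by
      rcases mul_neg_iff.mp hyy with h | h
      · exact intermediate_value_Ioo' hy.le hcont.continuousOn ⟨h.2, h.1⟩
      · exact intermediate_value_Ioo hy.le hcont.continuousOn ⟨h.1, h.2⟩
    obtain ⟨c, hc, hc'⟩ := this
    exact ⟨c, hc.1, hc.2, hc'⟩
  obtain ⟨c, c1, c2, c3⟩ := ivt _ _ (z3 0 (by norm_num)).1 (z3 0 (by norm_num)).2
  obtain ⟨c', c1', c2', c3'⟩ := ivt _ _ (z3 1 (by norm_num)).1 (z3 1 (by norm_num)).2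
  simp only [zero_add, Nat.reduceAdd] at c2 c1' c2'
  obtain ⟨ξ, hξ, hξ'⟩ := exists_hasDerivAt_eq_zero (f := v T) (f' := vx T) (show c < c' by linarith) hcont.continuousOn
    (by rw [c3, c3']) (fun y _ => S.hx T y hTpos)
  -- contradiction with SEP
  obtain ⟨w, w1, w2, hh, hF, hh0, hw, hw1, e1, e2, e3⟩ := S.norm x0 h0 hτ01
  have hLam0 : Lam v vx t0 x0 τ0 ≤ FF v vx M t0 x0 2 := by
    have := S.Lam_le x0 h0 hτ01
    have := S.Fanti x0 h0 (show (2:ℝ) ∈ Ioi 1 by norm_num) (show τ0 ∈ Ioi 1 from hτ01) (by linarith)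
    linarith
  set ρ := exp (-τ0/2) with hρ
  have hρ0 : 0 < ρ := exp_pos _
  have sqe : ∀ s : ℝ, exp (-s/2) ^ 2 = exp (-s) := by intro s; rw [← exp_nat_mul]; congr 1; push_cast; ring
  have hρ2 : ρ ^ 2 = exp (-τ0) := sqe τ0
  have hpρ : exp (-p/2) ≤ ρ := by
    refine abs_le_of_sq_le_sq' ?_ hρ0.le |>.2
    rw [hρ2, sqe, hexpτ]; linarith [exp_pos (-q)]
  have hqρ : R * exp (-q/2) ≤ R * exp (-p0/2) * exp (-p/2) := by
    rw [mul_assoc, ← exp_add]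
    apply mul_le_mul_of_nonneg_left _ hR.le
    exact exp_le_exp.mpr (by linarith)
  have hpp := exp_pos (-p/2)
  have hxx0 : |x - x0| ≤ exp (-p/2) := by
    apply abs_le_of_sq_le_sq _ hpp.le
    rw [sqe, hp]; exact hcone
  have hxx1 := abs_le.mp hxx0
  have hRq1 : R * exp (-q/2) ≤ exp (-p/2) := hqρ.trans (by nlinarith)
  have hRq2 : 2 * (R * exp (-q/2)) ≤ θ * ρ := by
    calc 2 * (R * exp (-q/2)) ≤ 2 * (R * exp (-p0/2)) * exp (-p/2) := by linarith
      _ ≤ θ * ρ := mul_le_mul hRθ hpρ hpp.le hθ.le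
  have bdy : ∀ y, x - R * exp (-q/2) ≤ y → y ≤ x + R * exp (-q/2) → |(y - x0) / ρ| ≤ 2 := by
    intro y y1 y2
    rw [abs_div, abs_of_pos hρ0, div_le_iff₀ hρ0, abs_le]
    constructor <;> linarith
  refine SP w w1 w2 hF e1 (by rw [e2]; exact hLam0) (by rw [e3]; exact G0) ((c - x0)/ρ) ((ξ - x0)/ρ)
    (bdy c (by linarith) (by linarith)) (bdy ξ (by linarith [hξ.1]) (by linarith [hξ.2])) ?_ ?_ ?_
  · rw [← sub_div, abs_div, abs_of_pos hρ0, div_le_iff₀ hρ0, abs_le]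
    constructor <;> linarith [hξ.1, hξ.2]
  · rw [hw]; unfold U
    rw [← hρ, mul_div_cancel₀ _ hρ0.ne', add_sub_cancel, ← hTdef, c3, mul_zero]
  · rw [hw1]; unfold W1 U
    rw [← hρ, mul_div_cancel₀ _ hρ0.ne', add_sub_cancel, ← hTdef, hξ', mul_zero, mul_zero]

end ZN

namespace ZN
open MeasureTheory Filter Topology
variable {a b v vt vx vxx : ℝ → ℝ → ℝ} {M : ℝ}

lemma piece_null (Y : Set (ℝ × ℝ)) (h : ∀ p ∈ Y, ∀ q ∈ Y, |p.1 - q.1| ≤ (p.2 - q.2) ^ 2) :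
    volume (Prod.fst '' Y) = 0 := by
  classical
  set f : ℝ → ℝ := fun x => if h : ∃ t, (t, x) ∈ Y then h.choose else 0 with hf
  have hfY : ∀ x ∈ Prod.snd '' Y, (f x, x) ∈ Y := by
    rintro _ ⟨⟨t, x⟩, hp, rfl⟩
    have hex : ∃ t, (t, x) ∈ Y := ⟨t, hp⟩
    simp only [hf, hex, dif_pos]
    exact hex.choose_spec
  have him : Prod.fst '' Y ⊆ f '' (Prod.snd '' Y) := by
    rintro _ ⟨⟨t, x⟩, hp, rfl⟩
    refine ⟨x, ⟨_, hp, rfl⟩, ?_⟩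
    have := h _ (hfY x ⟨_, hp, rfl⟩) _ hp
    simp only [sub_self] at this
    have h2 : |f x - t| ≤ 0 := by simpa using this
    have := abs_nonpos_iff.mp h2
    simp only; linarith
  have hH : HolderOnWith 1 2 f (Prod.snd '' Y) := by
    intro x hx y hy
    have := h _ (hfY x hx) _ (hfY y hy)
    simp only at this
    rw [edist_dist, edist_dist, Real.dist_eq, Real.dist_eq]
    rw [ENNReal.ofReal_rpow_of_nonneg (abs_nonneg _) (by norm_num)]
    simp only [ENNReal.coe_one, one_mul]
    apply ENNReal.ofReal_le_ofReal
    refine this.trans (le_of_eq ?_)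
    simp
  have hd := hH.dimH_image_le (by norm_num)
  have hd2 : dimH (f '' (Prod.snd '' Y)) < ((1 : NNReal) : ENNReal) := by
    refine hd.trans_lt ?_
    have h1 : dimH (Prod.snd '' Y) ≤ 1 := by
      refine (dimH_mono (subset_univ _)).trans (le_of_eq ?_)
      exact Real.dimH_univ
    calc _ ≤ (1 : ENNReal) / ((2 : NNReal) : ENNReal) := by gcongr
      _ < _ := by
        rw [ENNReal.div_lt_iff (by simp) (by simp)]; norm_num
  have := hausdorffMeasure_of_dimH_lt hd2
  refine measure_mono_null him ?_
  rw [← hausdorffMeasure_real]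
  simpa using this

lemma cone_null (Z : Set (ℝ × ℝ)) (δ : ℝ × ℝ → ℝ) (hδ : ∀ p ∈ Z, 0 < δ p)
    (h : ∀ p ∈ Z, ∀ q ∈ Z, p.1 - δ p < q.1 → q.1 < p.1 → p.1 - q.1 < (q.2 - p.2) ^ 2) :
    volume (Prod.fst '' Z) = 0 := by
  set Y : ℕ → ℤ → Set (ℝ × ℝ) := fun m k => {p | p ∈ Z ∧ 1 / ((m:ℝ) + 1) < δ p ∧ ⌊p.1 * ((m:ℝ) + 1)⌋ = k}
  have hsub : Prod.fst '' Z ⊆ ⋃ m, ⋃ k, Prod.fst '' (Y m k) := by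
    rintro _ ⟨p, hp, rfl⟩
    obtain ⟨m, hm⟩ := exists_nat_one_div_lt (hδ p hp)
    simp only [mem_iUnion]
    exact ⟨m, ⌊p.1 * ((m:ℝ) + 1)⌋, p, ⟨hp, hm, rfl⟩, rfl⟩
  refine measure_mono_null hsub ?_
  rw [measure_iUnion_null_iff]; intro m
  rw [measure_iUnion_null_iff]; intro k
  apply piece_null
  have aux : ∀ p ∈ Y m k, ∀ q ∈ Y m k, q.1 < p.1 → p.1 - q.1 < (q.2 - p.2) ^ 2 := by
    rintro p ⟨p1, p2, p3⟩ q ⟨q1, q2, q3⟩ hqp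
    refine h p p1 q q1 ?_ hqp
    have hm : (0:ℝ) < m + 1 := by positivity
    have e1 : p.1 * ((m:ℝ) + 1) < k + 1 := by rw [← p3]; exact Int.lt_floor_add_one _
    have e2 : (k:ℝ) ≤ q.1 * ((m:ℝ) + 1) := by rw [← q3]; exact Int.floor_le _
    have e3 : p.1 - q.1 < 1 / ((m:ℝ) + 1) := by rw [lt_div_iff₀ hm]; linarith
    linarith
  intro p hp q hq
  rcases lt_trichotomy p.1 q.1 with h1 | h1 | h1
  · have := aux q hq p hp h1
    rw [abs_of_neg (by linarith)]; linarith
  · rw [h1, sub_self, abs_zero]; positivity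
  · have := aux p hp q hq h1
    rw [abs_of_pos (by linarith)]; nlinarith

lemma Sol.exists_simple (S : Sol a b v vt vx vxx M) : ∃ t, 1 ≤ t ∧ t ≤ 2 ∧ ∀ x, v t x = 0 → vx t x ≠ 0 := by
  set Z : ℕ → Set (ℝ × ℝ) := fun n => {p | 1 ≤ p.1 ∧ v p.1 p.2 = 0 ∧ vx p.1 p.2 = 0 ∧ FF v vx M p.1 p.2 2 ≤ n}
  have hZ : ∀ n, volume (Prod.fst '' (Z n)) = 0 := by
    intro n
    have hc : ∀ p : ℝ × ℝ, ∃ δ : ℝ, p ∈ Z n → 0 < δ ∧ ∀ q ∈ Z n, p.1 - δ < q.1 → q.1 < p.1 → p.1 - q.1 < (q.2 - p.2) ^ 2 := by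
      intro p
      by_cases hp : p ∈ Z n
      · obtain ⟨δ, hδ, H⟩ := S.cone p.2 hp.1 n
        refine ⟨δ, fun _ => ⟨hδ, ?_⟩⟩
        rintro q ⟨q1, q2, q3, q4⟩ h1 h2
        by_contra! hcon
        exact H q.1 q.2 q1 h1 h2 hcon q4 q2 q3
      · exact ⟨0, fun h => absurd h hp⟩
    choose δ hδ using hc
    exact cone_null (Z n) δ (fun p hp => (hδ p hp).1) (fun p hp => (hδ p hp).2)
  by_contra! hcon
  have hsub : Icc (1:ℝ) 2 ⊆ ⋃ n, Prod.fst '' (Z n) := by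
    intro t ht
    obtain ⟨x, h1, h2⟩ := hcon t ht.1 ht.2
    obtain ⟨n, hn⟩ := exists_nat_ge (FF v vx M t x 2)
    simp only [mem_iUnion]
    exact ⟨n, (t, x), ⟨ht.1, h1, h2, hn⟩, rfl⟩
  have h0 : volume (Icc (1:ℝ) 2) = 0 := measure_mono_null hsub (by rw [measure_iUnion_null_iff]; exact hZ)
  rw [Real.volume_Icc] at h0
  norm_num at h0

lemma finite_zeros {u u' : ℝ → ℝ} (hu : ∀ x, HasDerivAt u (u' x) x) (hs : ∀ x, u x = 0 → u' x ≠ 0) :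
    {x ∈ Set.Ico 0 (2 * π) | u x = 0}.Finite := by
  by_contra hinf
  have hinf : {x ∈ Set.Ico 0 (2 * π) | u x = 0}.Infinite := hinf
  obtain ⟨x, hx, hacc⟩ := hinf.exists_accPt_of_subset_isCompact (K := Icc 0 (2 * π)) isCompact_Icc
    (fun x hx => Ico_subset_Icc_self hx.1)
  have hfr : ∃ᶠ y in 𝓝[≠] x, u y = 0 := by
    rw [accPt_iff_frequently_nhdsNE] at hacc
    exact hacc.mono fun y hy => hy.2
  have hux : u x = 0 := by
    by_contra hne
    have := ((hu x).continuousAt.eventually_ne hne).filter_mono (nhdsWithin_le_nhds (s := {x}ᶜ))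
    exact hfr (this.mono fun y hy => hy)
  have := (hu x).eventually_ne (c := 0) (hs x hux)
  exact hfr this

lemma Alt.zeros {u : ℝ → ℝ} (hc : Continuous u) (hp : ∀ x, u (x + 2 * π) = u x) {n : ℕ} (h : Alt u n)
    (hfin : {x ∈ Set.Ico 0 (2 * π) | u x = 0}.Finite) : 2 * n ≤ {x ∈ Set.Ico 0 (2 * π) | u x = 0}.ncard := by
  rcases Nat.eq_zero_or_pos n with rfl | hn
  · simp
  obtain ⟨x, σ, hσ, h1, h2, h3⟩ := h
  have hπ : 0 < 2 * π := by positivity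
  set X : ℕ → ℝ := fun i => if i < 2 * n then x i else x 0 + 2 * π with hX
  have hXlt : ∀ i < 2 * n, X i < X (i+1) := by
    intro i hi
    by_cases hi2 : i + 1 < 2 * n
    · simp only [hX, hi, hi2, if_true]; exact h1 i hi2
    · simp only [hX, hi, hi2, if_true, if_false]
      obtain rfl : i = 2 * n - 1 := by omega
      exact h2
  have hXs : ∀ i ≤ 2 * n, 0 < σ * (-1) ^ i * u (X i) := by
    intro i hi
    by_cases hi2 : i < 2 * n
    · simp only [hX, hi2, if_true]; exact h3 i hi2
    · obtain rfl : i = 2 * n := by omega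
      simp only [hX, lt_irrefl, if_false]
      rw [hp]; have := h3 0 (by omega); simpa [pow_mul] using this
  have key : ∀ i, ∃ c, i < 2 * n → X i < c ∧ c < X (i+1) ∧ u c = 0 := by
    intro i
    by_cases hi : i < 2 * n
    · have s1 := hXs i hi.le
      have s2 := hXs (i+1) hi
      rw [pow_succ] at s2
      have hcc : Continuous (fun y => σ * (-1) ^ i * u y) := by fun_prop
      have := intermediate_value_Ioo' (hXlt i hi).le hcc.continuousOn (show (0:ℝ) ∈ Ioo _ _ from ⟨by linarith, s1⟩)
      obtain ⟨c, hc1, hc2⟩ := this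
      refine ⟨c, fun _ => ⟨hc1.1, hc1.2, ?_⟩⟩
      have : σ * (-1) ^ i ≠ 0 := by
        intro h; rw [h] at s1; simp at s1
      exact (mul_eq_zero.mp hc2).resolve_left this
    · exact ⟨0, fun h => absurd h hi⟩
  choose c hc using key
  have hclt : ∀ i j, i < j → j < 2 * n → c i < c j := by
    intro i j hij
    induction j with
    | zero => omega
    | succ j ih =>
      intro hj
      have z1 := (hc j (by omega)).2.1
      have z2 := (hc (j+1) hj).1
      rcases Nat.lt_or_ge i j with h | h
      · linarith [ih h (by omega)]
      · obtain rfl : i = j := by omega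
        linarith
  have hXle : ∀ i ≤ 2 * n, X 0 ≤ X i ∧ X i ≤ X (2 * n) := by
    have mono : ∀ i j, i ≤ j → j ≤ 2 * n → X i ≤ X j := by
      intro i j hij
      induction j with
      | zero => intro _; obtain rfl : i = 0 := by omega
                exact le_rfl
      | succ j ih =>
        intro hj
        rcases Nat.lt_or_ge i (j+1) with h | h
        · exact (ih (by omega) (by omega)).trans (hXlt j (by omega)).le
        · obtain rfl : i = j + 1 := by omega
          exact le_rfl
    exact fun i hi => ⟨mono 0 i (by omega) hi, mono i _ hi le_rfl⟩
  have hX0 : X 0 = x 0 := by simp [hX, hn]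
  have hX2 : X (2 * n) = x 0 + 2 * π := by simp [hX]
  have hcb : ∀ i < 2 * n, x 0 < c i ∧ c i < x 0 + 2 * π := by
    intro i hi
    have z1 := (hc i hi).1
    have z2 := (hc i hi).2.1
    have z3 := (hXle i hi.le).1
    have z4 := (hXle (i+1) hi).2
    rw [hX0] at z3; rw [hX2] at z4
    exact ⟨by linarith, by linarith⟩
  set r : ℝ → ℝ := fun z => z - ⌊z / (2 * π)⌋ * (2 * π) with hr
  have hper : Function.Periodic u (2 * π) := hp
  have hinj : Set.InjOn (fun i => r (c i)) (Finset.range (2 * n) : Set ℕ) := by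
    have aux : ∀ i j, i < j → j < 2 * n → r (c i) ≠ r (c j) := by
      intro i j hij hj he
      have z1 := hclt i j hij hj
      have z2 := hcb i (by omega)
      have z3 := hcb j hj
      simp only [hr] at he
      have e : c j - c i = ((⌊c j / (2 * π)⌋ - ⌊c i / (2 * π)⌋ : ℤ) : ℝ) * (2 * π) := by push_cast; linarith
      set k := ⌊c j / (2 * π)⌋ - ⌊c i / (2 * π)⌋
      have k0 : 0 < (k:ℝ) := by by_contra! hk; nlinarith
      have k1 : (k:ℝ) < 1 := by by_contra! hk; nlinarith
      have k0' : 0 < k := by exact_mod_cast k0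
      have k1' : k < 1 := by exact_mod_cast k1
      omega
    intro i hi j hj he
    simp only [Finset.coe_range, mem_Iio] at hi hj
    rcases lt_trichotomy i j with h | h | h
    · exact absurd he (aux i j h hj)
    · exact h
    · exact absurd he.symm (aux j i h hi)
  have hcard := Finset.card_image_of_injOn hinj
  rw [Finset.card_range] at hcard
  rw [← hcard, ← Set.ncard_coe_finset]
  apply Set.ncard_le_ncard _ hfin
  intro z hz
  simp only [Finset.coe_image, Finset.coe_range, mem_image, mem_Iio] at hz
  obtain ⟨i, hi, rfl⟩ := hz
  refine ⟨⟨?_, ?_⟩, ?_⟩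
  · have : (⌊c i / (2 * π)⌋:ℝ) * (2 * π) ≤ c i := by rw [← le_div_iff₀ hπ]; exact Int.floor_le _
    simp only [hr]; linarith
  · have : c i < ((⌊c i / (2 * π)⌋:ℝ) + 1) * (2 * π) := by rw [← div_lt_iff₀ hπ]; exact Int.lt_floor_add_one _
    simp only [hr]; linarith
  · simp only [hr]; rw [hper.sub_int_mul_eq]; exact (hc i hi).2.2

theorem Sol.main (S : Sol a b v vt vx vxx M) : ∃ T₀ : ℝ, 0 < T₀ ∧
      (∀ t : ℝ, T₀ ≤ t → ∀ x : ℝ, v t x = 0 → vx t x ≠ 0) ∧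
      (∀ t₁ t₂ : ℝ, T₀ ≤ t₁ → T₀ ≤ t₂ →
        {x ∈ Set.Ico 0 (2 * π) | v t₁ x = 0}.ncard =
          {x ∈ Set.Ico 0 (2 * π) | v t₂ x = 0}.ncard) := by
  classical
  have hcont : ∀ t, 0 < t → Continuous (v t) := fun t ht =>
    continuous_iff_continuousAt.mpr fun y => (S.hx t y ht).continuousAt
  obtain ⟨ts, hts1, hts2, hsimple⟩ := S.exists_simple
  have hfin := finite_zeros (fun x => S.hx ts x (by linarith)) hsimple
  set N := {x ∈ Set.Ico 0 (2 * π) | v ts x = 0}.ncard with hN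
  have hbig : ∀ t, ts ≤ t → ∀ n, N < n → ¬ Alt (v t) n := by
    intro t ht n hn hA
    have hA' : Alt (v ts) n := by
      rcases ht.eq_or_lt with rfl | h
      · exact hA
      · exact S.alt_mono (by linarith) h hA
    have := hA'.zeros (hcont ts (by linarith)) (fun x => S.vP ts x (by linarith)) hfin
    omega
  set P : ℕ → Prop := fun n => ∀ t, 2 ≤ t → Alt (v t) n with hP
  set n := Nat.findGreatest P N with hn
  have hPn : P n := by
    apply Nat.findGreatest_spec (m := 0) (Nat.zero_le _)
    intro t _
    exact ⟨fun _ => 0, 1, one_ne_zero, by simp, by simp; positivity, by simp⟩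
  obtain ⟨T, hT2, hT⟩ : ∃ T, 2 ≤ T ∧ ∀ t, T ≤ t → ¬ Alt (v t) (n+1) := by
    by_cases hnN : n + 1 ≤ N
    · have : ¬ P (n+1) := Nat.findGreatest_is_greatest (Nat.lt_succ_self _) hnN
      simp only [hP] at this
      push Not at this
      obtain ⟨T, hT, hTA⟩ := this
      refine ⟨T, hT, fun t ht hA => ?_⟩
      rcases ht.eq_or_lt with rfl | h
      · exact hTA hA
      · exact hTA (S.alt_mono (by linarith) h hA)
    · exact ⟨2, le_rfl, fun t ht => hbig t (by linarith) _ (by omega)⟩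
  have hsum : ∀ t, T + 1 ≤ t → ∀ (F : Finset ℝ) (c : ℝ → ℕ),
      (∀ p ∈ F, 0 ≤ p ∧ p < 2 * π ∧ v t p = 0 ∧ (c p = 1 ∨ c p = 2 ∧ vx t p = 0)) → ∑ p ∈ F, c p ≤ 2 * n := by
    intro t ht F c hF
    by_contra! hlt
    obtain ⟨s, s1, s2, α, β, s3, s4⟩ := S.alts (by linarith) F c hF one_pos
    exact hT s (by linarith) (s4.alt s3 (by omega) (by omega))
  have hZ : ∀ t, T + 1 ≤ t → {x ∈ Set.Ico 0 (2 * π) | v t x = 0}.Finite ∧ {x ∈ Set.Ico 0 (2 * π) | v t x = 0}.ncard = 2 * n := by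
    intro t ht
    have hf : {x ∈ Set.Ico 0 (2 * π) | v t x = 0}.Finite := by
      by_contra hinf
      obtain ⟨F, hF, hFc⟩ := Set.Infinite.exists_subset_card_eq hinf (2 * n + 1)
      have := hsum t ht F (fun _ => 1) (fun p hp => ⟨(hF hp).1.1, (hF hp).1.2, (hF hp).2, Or.inl rfl⟩)
      simp only [Finset.sum_const, smul_eq_mul, mul_one] at this
      omega
    refine ⟨hf, le_antisymm ?_ ((hPn t (by linarith)).zeros (hcont t (by linarith)) (fun x => S.vP t x (by linarith)) hf)⟩
    have := hsum t ht hf.toFinset (fun _ => 1) (fun p hp => by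
      have hp := hf.mem_toFinset.mp hp
      exact ⟨hp.1.1, hp.1.2, hp.2, Or.inl rfl⟩)
    simp only [Finset.sum_const, smul_eq_mul, mul_one] at this
    rwa [Set.ncard_eq_toFinset_card _ hf]
  refine ⟨T + 1, by linarith, ?_, fun t₁ t₂ h1 h2 => by rw [(hZ t₁ h1).2, (hZ t₂ h2).2]⟩
  intro t ht x hx hxx
  obtain ⟨hf, hcard⟩ := hZ t ht
  have ht0 : 0 < t := by linarith
  have hper : Function.Periodic (fun x => (v t x, vx t x)) (2 * π) := fun x => by
    simp only [S.vP t x ht0.le, S.xP t x ht0]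
  obtain ⟨y, hy, hxy⟩ := hper.exists_mem_Ico₀ (by positivity) x
  simp only [Prod.mk.injEq] at hxy
  have hy0 : v t y = 0 := by rw [← hxy.1]; exact hx
  have hy1 : vx t y = 0 := by rw [← hxy.2]; exact hxx
  have hyF : y ∈ hf.toFinset := hf.mem_toFinset.mpr ⟨hy, hy0⟩
  have := hsum t ht hf.toFinset (fun p => if p = y then 2 else 1) (fun p hp => by
      have hp := hf.mem_toFinset.mp hp
      refine ⟨hp.1.1, hp.1.2, hp.2, ?_⟩
      by_cases hpy : p = y
      · right; simp [hpy, hy1]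
      · left; simp [hpy])
  rw [← Finset.add_sum_erase _ _ hyF] at this
  have h2 : ∑ p ∈ hf.toFinset.erase y, (if p = y then 2 else 1) = (hf.toFinset.erase y).card := by
    rw [Finset.card_eq_sum_ones]
    exact Finset.sum_congr rfl fun p hp => by simp [Finset.ne_of_mem_erase hp]
  rw [h2, Finset.card_erase_of_mem hyF, ← Set.ncard_eq_toFinset_card _ hf, hcard] at this
  have h3 : 0 < hf.toFinset.card := Finset.card_pos.mpr ⟨y, hyF⟩
  rw [← Set.ncard_eq_toFinset_card _ hf, hcard] at h3
  simp at this
  omega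

end ZN



/-- Eventual simplicity of zeros and eventual constancy of the zero number for a
solution of a linear parabolic equation `v_t = v_xx + a v_x + b v` on the circle
`S¹ = ℝ/2πℤ`. -/
theorem zero_number_eventually_simple_and_constant
    (a b v vt vx vxx : ℝ → ℝ → ℝ)
    -- `a`, `b` are bounded continuous on `[0,∞) × ℝ`, `2π`-periodic in `x`
    (haC : ContinuousOn (fun p : ℝ × ℝ => a p.1 p.2) (Set.Ici 0 ×ˢ Set.univ))
    (hbC : ContinuousOn (fun p : ℝ × ℝ => b p.1 p.2) (Set.Ici 0 ×ˢ Set.univ))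
    (haB : ∃ M : ℝ, ∀ t x : ℝ, 0 ≤ t → |a t x| ≤ M)
    (hbB : ∃ M : ℝ, ∀ t x : ℝ, 0 ≤ t → |b t x| ≤ M)
    (haP : ∀ t x : ℝ, 0 ≤ t → a t (x + 2 * π) = a t x)
    (hbP : ∀ t x : ℝ, 0 ≤ t → b t (x + 2 * π) = b t x)
    -- `v` is continuous on `[0,∞) × ℝ` and `2π`-periodic in `x`
    (hvC : ContinuousOn (fun p : ℝ × ℝ => v p.1 p.2) (Set.Ici 0 ×ˢ Set.univ))
    (hvP : ∀ t x : ℝ, 0 ≤ t → v t (x + 2 * π) = v t x)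
    -- the partial derivatives `v_t, v_x, v_xx` exist on `(0,∞) × ℝ`
    (hvt : ∀ t x : ℝ, 0 < t → HasDerivAt (fun s => v s x) (vt t x) t)
    (hvx : ∀ t x : ℝ, 0 < t → HasDerivAt (fun y => v t y) (vx t x) x)
    (hvxx : ∀ t x : ℝ, 0 < t → HasDerivAt (fun y => vx t y) (vxx t x) x)
    -- and are continuous on `(0,∞) × ℝ`
    (hvtC : ContinuousOn (fun p : ℝ × ℝ => vt p.1 p.2) (Set.Ioi 0 ×ˢ Set.univ))
    (hvxC : ContinuousOn (fun p : ℝ × ℝ => vx p.1 p.2) (Set.Ioi 0 ×ˢ Set.univ))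
    (hvxxC : ContinuousOn (fun p : ℝ × ℝ => vxx p.1 p.2) (Set.Ioi 0 ×ˢ Set.univ))
    -- the equation holds on `(0,∞) × ℝ`
    (heq : ∀ t x : ℝ, 0 < t → vt t x = vxx t x + a t x * vx t x + b t x * v t x)
    -- `v(t,·)` is not identically zero for every `t ≥ 0`
    (hnz : ∀ t : ℝ, 0 ≤ t → ∃ x : ℝ, v t x ≠ 0) :
    ∃ T₀ : ℝ, 0 < T₀ ∧
      (∀ t : ℝ, T₀ ≤ t → ∀ x : ℝ, v t x = 0 → vx t x ≠ 0) ∧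
      (∀ t₁ t₂ : ℝ, T₀ ≤ t₁ → T₀ ≤ t₂ →
        {x ∈ Set.Ico 0 (2 * π) | v t₁ x = 0}.ncard =
          {x ∈ Set.Ico 0 (2 * π) | v t₂ x = 0}.ncard) := by
  obtain ⟨Ma, hMa⟩ := haB
  obtain ⟨Mb, hMb⟩ := hbB
  have S : ZN.Sol a b v vt vx vxx (max Ma Mb) :=
    { M0 := le_trans ((abs_nonneg _).trans (hMa 0 0 le_rfl)) (le_max_left _ _)
      ha := fun t x h => (hMa t x h).trans (le_max_left _ _)
      hb := fun t x h => (hMb t x h).trans (le_max_right _ _)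
      vP := hvP, aP := haP, bP := hbP, ht := hvt, hx := hvx, hxx := hvxx
      tC := hvtC, xC := hvxC, xxC := hvxxC, eq := heq, nz := hnz }
  exact S.main
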